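/- Let A, B be finite algebras in a locally finite Taylor variety, and let ρ ∈ Con(A), σ ∈ Con(B) be meet-irreducible with unique upper covers ρ⁺, σ⁺ respectively. Then the following are equivalent: (1) there exists a good bridge from (A,ρ) to (B,σ); (2) there exists a bridge from (A,ρ,ρ⁺) to (B,σ,σ⁺) satisfying property (B3): for all (a₁,a₂,b₁,b₂) in the bridge T, both (a₁,b₁) ∈ tr(T) and (a₂,b₂) ∈ tr(T); (3) A/ρ and B/σ are similar, i.e., A/ρ ∼ B/σ. -/

import Mathlib

namespace Zhuk

/-- A signature: a type of operation symbols with arities. -/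
structure Signature where
  ops : Type
  arity : ops → ℕ

/-- An algebra structure of signature `S` on carrier `A`. -/
class SAlg (S : Signature) (A : Type) where
  interp : (o : S.ops) → (Fin (S.arity o) → A) → A

variable {S : Signature}

/-- Componentwise algebra structure on a product. -/
instance prodSAlg {A B : Type} [SAlg S A] [SAlg S B] : SAlg S (A × B) :=
  ⟨fun o x => (SAlg.interp o fun i => (x i).1, SAlg.interp o fun i => (x i).2)⟩

/-- A subset closed under all the operations. -/
def IsSubuniverse (S : Signature) {A : Type} [SAlg S A] (R : Set A) : Prop :=
  ∀ (o : S.ops) (x : Fin (S.arity o) → A), (∀ i, x i ∈ R) → SAlg.interp o x ∈ R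

/-- The algebra structure on (the subtype of) a subuniverse. -/
def subAlg {A : Type} [SAlg S A] (R : Set A) (h : IsSubuniverse S R) : SAlg S ↥R :=
  ⟨fun o x => ⟨SAlg.interp o fun i => (x i).1, h o _ fun i => (x i).2⟩⟩

/-- Terms of signature `S` in `n` variables. -/
inductive STerm (S : Signature) (n : ℕ) : Type
  | var : Fin n → STerm S n
  | app (o : S.ops) : (Fin (S.arity o) → STerm S n) → STerm S n

/-- Evaluation of a term in an algebra. -/
def STerm.eval {A : Type} [SAlg S A] {n : ℕ} : STerm S n → (Fin n → A) → A
  | .var i, v => v i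
  | .app o ts, v => SAlg.interp o fun i => (ts i).eval v

/-- The diagonal (smallest) congruence `0_A`. -/
def diag (A : Type) : Set (A × A) := {p | p.1 = p.2}

/-- Relational composition. -/
def rcomp {A B C : Type} (R : Set (A × B)) (T : Set (B × C)) : Set (A × C) :=
  {p | ∃ b, (p.1, b) ∈ R ∧ (b, p.2) ∈ T}

/-- Relational inverse. -/
def rinv {A B : Type} (R : Set (A × B)) : Set (B × A) := {p | (p.2, p.1) ∈ R}

/-- Transitive closure of a binary relation (as a set of pairs). -/
def transCl {A : Type} (R : Set (A × A)) : Set (A × A) :=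
  {p | Relation.TransGen (fun a b => (a, b) ∈ R) p.1 p.2}

/-- `R` is stable under (saturated with respect to) `ρ`:  `R = ρ ∘ R ∘ ρ`. -/
def Saturated {A : Type} (ρ R : Set (A × A)) : Prop := rcomp ρ (rcomp R ρ) = R

/-- A congruence: a subuniverse of `A²` which is an equivalence relation. -/
def IsCongruence (S : Signature) {A : Type} [SAlg S A] (θ : Set (A × A)) : Prop :=
  IsSubuniverse S θ ∧ Equivalence fun a b => (a, b) ∈ θ

/-- `ρ ∈ Con*(A)`: a congruence different from the full congruence `1_A`. -/
def ConStar (S : Signature) {A : Type} [SAlg S A] (ρ : Set (A × A)) : Prop :=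
  IsCongruence S ρ ∧ ρ ≠ Set.univ

/-- The ternary centralizer relation `C(φ, θ; δ)`, via the term condition. -/
def Centralizes (S : Signature) {A : Type} [SAlg S A] (φ θ δ : Set (A × A)) : Prop :=
  ∀ (n : ℕ) (t : STerm S (n + 1)) (a b : A) (c d : Fin n → A),
    (a, b) ∈ φ → (∀ i, (c i, d i) ∈ θ) →
    (t.eval (Fin.cons a c), t.eval (Fin.cons a d)) ∈ δ →
    (t.eval (Fin.cons b c), t.eval (Fin.cons b d)) ∈ δ

/-- The centralizer `(δ : θ)`: the largest congruence `φ` with `C(φ, θ; δ)`. -/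
def centralizer (S : Signature) {A : Type} [SAlg S A] (δ θ : Set (A × A)) : Set (A × A) :=
  ⋃₀ {φ | IsCongruence S φ ∧ Centralizes S φ θ δ}

/-- A congruence of the subalgebra `A(θ) ≤ A²`, viewed ambiently as a subset of
`(A×A) × (A×A)` whose field is `θ`. -/
def IsConOn (S : Signature) {A : Type} [SAlg S A] (θ : Set (A × A))
    (Δ : Set ((A × A) × (A × A))) : Prop :=
  Δ ⊆ θ ×ˢ θ ∧ IsSubuniverse S Δ ∧ (∀ p ∈ θ, (p, p) ∈ Δ) ∧
    (∀ p q, (p, q) ∈ Δ → (q, p) ∈ Δ) ∧ (∀ p q r, (p, q) ∈ Δ → (q, r) ∈ Δ → (p, r) ∈ Δ)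

/-- `Δ_{θ,α}`: the congruence of `A(θ)` generated by `{((a,a),(b,b)) : (a,b) ∈ α}`. -/
def DeltaCon (S : Signature) {A : Type} [SAlg S A] (θ α : Set (A × A)) :
    Set ((A × A) × (A × A)) :=
  ⋂₀ {Δ | IsConOn S θ Δ ∧ ∀ a b : A, (a, b) ∈ α → ((a, a), (b, b)) ∈ Δ}

/-- Projection of a quaternary relation to its first two coordinates. -/
def pr12 {A B : Type} (T : Set (A × A × B × B)) : Set (A × A) :=
  {p | ∃ b₁ b₂, (p.1, p.2, b₁, b₂) ∈ T}

/-- Projection of a quaternary relation to its last two coordinates. -/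
def pr34 {A B : Type} (T : Set (A × A × B × B)) : Set (B × B) :=
  {q | ∃ a₁ a₂, (a₁, a₂, q.1, q.2) ∈ T}

/-- The trace of a quaternary relation. -/
def btr {A B : Type} (T : Set (A × A × B × B)) : Set (A × B) :=
  {p | (p.1, p.1, p.2, p.2) ∈ T}

/-- Zhuk's bridges: Definition 4.3 (B0*), (B1*), (B2*). -/
def IsBridge (S : Signature) {A B : Type} [SAlg S A] [SAlg S B]
    (ρ : Set (A × A)) (σ : Set (B × B)) (T : Set (A × A × B × B)) : Prop :=
  IsSubuniverse S T ∧
  (∀ a₁ a₂ b₁ b₂ a₁' a₂', (a₁, a₂, b₁, b₂) ∈ T → (a₁, a₁') ∈ ρ → (a₂, a₂') ∈ ρ →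
    (a₁', a₂', b₁, b₂) ∈ T) ∧
  (∀ a₁ a₂ b₁ b₂ b₁' b₂', (a₁, a₂, b₁, b₂) ∈ T → (b₁, b₁') ∈ σ → (b₂, b₂') ∈ σ →
    (a₁, a₂, b₁', b₂') ∈ T) ∧
  ρ ⊂ pr12 T ∧ σ ⊂ pr34 T ∧
  (∀ a₁ a₂ b₁ b₂, (a₁, a₂, b₁, b₂) ∈ T → ((a₁, a₂) ∈ ρ ↔ (b₁, b₂) ∈ σ))

/-- A bridge from `(A,ρ,L)` to `(B,σ,R)`: a bridge with prescribed anchors. -/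
def IsBridgeLR (S : Signature) {A B : Type} [SAlg S A] [SAlg S B]
    (ρ : Set (A × A)) (σ : Set (B × B)) (L : Set (A × A)) (R : Set (B × B))
    (T : Set (A × A × B × B)) : Prop :=
  IsBridge S ρ σ T ∧ pr12 T = L ∧ pr34 T = R

/-- A reflexive bridge (case `B = A`): `0_A ⊆ tr(T)`. -/
def ReflBridge {A : Type} (T : Set (A × A × A × A)) : Prop :=
  ∀ a : A, (a, a) ∈ btr T

/-- `Cov(ρ)`: the inclusion-minimal ρ-saturated subuniverses of `A²` properly containing ρ. -/
def Cov (S : Signature) {A : Type} [SAlg S A] (ρ : Set (A × A)) : Set (Set (A × A)) :=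
  {L | IsSubuniverse S L ∧ Saturated ρ L ∧ ρ ⊂ L ∧
    ∀ L', IsSubuniverse S L' → Saturated ρ L' → ρ ⊂ L' → L' ⊆ L → L' = L}

/-- `ref.tr(ρ,L)`: traces of reflexive bridges from `(A,ρ,L)` to itself. -/
def refTr (S : Signature) {A : Type} [SAlg S A] (ρ L : Set (A × A)) : Set (Set (A × A)) :=
  {γ | ∃ T : Set (A × A × A × A), IsBridgeLR S ρ ρ L L T ∧ ReflBridge T ∧ btr T = γ}

/-- `γ = Opt(ρ,L)`: `γ` is the (unique) inclusion-maximal member of `ref.tr(ρ,L)`. -/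
def IsOptOf (S : Signature) {A : Type} [SAlg S A] (ρ L γ : Set (A × A)) : Prop :=
  γ ∈ refTr S ρ L ∧ ∀ δ ∈ refTr S ρ L, γ ⊆ δ → δ = γ

/-- `ρ` is meet-irreducible with unique upper cover `ρplus`. -/
def MeetIrredWith (S : Signature) {A : Type} [SAlg S A] (ρ ρplus : Set (A × A)) : Prop :=
  IsCongruence S ρ ∧ ρ ≠ Set.univ ∧ IsCongruence S ρplus ∧ ρ ⊂ ρplus ∧
    ∀ θ, IsCongruence S θ → ρ ⊂ θ → ρplus ⊆ θ

/-- `Cov⁺(ρ) = {τ ∈ Cov(ρ) : τ ⊆ ρ⁺}`. -/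
def CovPlus (S : Signature) {A : Type} [SAlg S A] (ρ ρplus : Set (A × A)) :
    Set (Set (A × A)) :=
  {τ | τ ∈ Cov S ρ ∧ τ ⊆ ρplus}

/-- A good bridge between meet-irreducible congruences with upper covers `ρplus`, `σplus`. -/
def GoodBridge (S : Signature) {A B : Type} [SAlg S A] [SAlg S B]
    (ρ ρplus : Set (A × A)) (σ σplus : Set (B × B)) (T : Set (A × A × B × B)) : Prop :=
  IsBridge S ρ σ T ∧
    ∃ τ ∈ CovPlus S ρ ρplus, ∃ τ' ∈ CovPlus S σ σplus, ∃ T' ⊆ T,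
      IsBridgeLR S ρ σ τ τ' T' ∧ btr T' = btr T

/-- `t` (with Taylor-identity data `u v`) is idempotent on `A` and satisfies the
corresponding identities on `A`. -/
def TaylorOn (S : Signature) (A : Type) [SAlg S A] {n : ℕ} (t : STerm S n)
    (u v : Fin n → Fin n → Fin 2) : Prop :=
  (∀ a : A, t.eval (fun _ => a) = a) ∧
    ∀ (i : Fin n) (x y : A),
      t.eval (fun j => if u i j = 0 then x else y) =
        t.eval (fun j => if v i j = 0 then x else y)

/-- `A` is a Taylor algebra. -/
def IsTaylorAlg (S : Signature) (A : Type) [SAlg S A] : Prop :=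
  ∃ (n : ℕ) (t : STerm S n) (u v : Fin n → Fin n → Fin 2),
    1 < n ∧ (∀ i, u i i ≠ v i i) ∧ TaylorOn S A t u v

/-- `A` and `B` lie in a common (locally finite, as they are finite) Taylor variety:
they share a common Taylor term with common Taylor identities. -/
def CommonTaylor (S : Signature) (A B : Type) [SAlg S A] [SAlg S B] : Prop :=
  ∃ (n : ℕ) (t : STerm S n) (u v : Fin n → Fin n → Fin 2),
    1 < n ∧ (∀ i, u i i ≠ v i i) ∧ TaylorOn S A t u v ∧ TaylorOn S B t u v

/-- The quotient of `A` by (the equivalence relation of) `θ`. -/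
abbrev ConQuot {A : Type} (θ : Set (A × A)) : Type :=
  Quot (fun a b => (a, b) ∈ θ)

/-- The class of `a` in `A/θ`. -/
def ConQuot.mk {A : Type} (θ : Set (A × A)) (a : A) : ConQuot θ :=
  Quot.mk _ a

/-- The quotient algebra structure on `A/θ` (extensionally correct when `θ` is a
congruence). -/
noncomputable def quotAlg {S : Signature} {A : Type} (iA : SAlg S A) (θ : Set (A × A)) :
    SAlg S (ConQuot θ) :=
  ⟨fun o x => ConQuot.mk θ
    (@SAlg.interp S A iA o fun i => Classical.choose (Quot.exists_rep (x i)))⟩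

/-- `f` is a homomorphism with respect to the given algebra structures. -/
def IsHomI {S : Signature} {A B : Type} (iA : SAlg S A) (iB : SAlg S B) (f : A → B) : Prop :=
  ∀ (o : S.ops) (x : Fin (S.arity o) → A),
    f (@SAlg.interp S A iA o x) = @SAlg.interp S B iB o fun i => f (x i)

/-- The two algebras are isomorphic. -/
def IsoAlgI {S : Signature} {A B : Type} (iA : SAlg S A) (iB : SAlg S B) : Prop :=
  ∃ f : A ≃ B, IsHomI iA iB f

/-- The identity bridge `I_{(A,ρ,L)}`. -/
def idBridge {A : Type} (ρ L : Set (A × A)) : Set (A × A × A × A) :=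
  {p | (p.1, p.2.1) ∈ L ∧ (p.2.2.1, p.2.2.2) ∈ L ∧ (p.1, p.2.2.1) ∈ ρ ∧ (p.2.1, p.2.2.2) ∈ ρ}

/-- Composition of quaternary relations (bridges). -/
def bComp {A B C : Type} (T : Set (A × A × B × B)) (T' : Set (B × B × C × C)) :
    Set (A × A × C × C) :=
  {p | ∃ b₁ b₂, (p.1, p.2.1, b₁, b₂) ∈ T ∧ (b₁, b₂, p.2.2.1, p.2.2.2) ∈ T'}

/-- Converse of a quaternary relation (bridge). -/
def bConv {A B : Type} (T : Set (A × A × B × B)) : Set (B × B × A × A) :=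
  {p | (p.2.2.1, p.2.2.2, p.1, p.2.1) ∈ T}

/-- `Δ♭_{θ,α}`: the congruence `Δ_{θ,α}` of `A(θ)` viewed as a quaternary relation. -/
def deltaFlat (S : Signature) {A : Type} [SAlg S A] (θ α : Set (A × A)) :
    Set (A × A × A × A) :=
  {p | ((p.1, p.2.1), (p.2.2.1, p.2.2.2)) ∈ DeltaCon S θ α}

/-- `T^opt_{(A,ρ)} = I_{(A,ρ,ρ⁺)} ∘ Δ♭_{ρ⁺,(ρ:ρ⁺)} ∘ I_{(A,ρ,ρ⁺)}`. -/
def Topt (S : Signature) {A : Type} [SAlg S A] (ρ ρplus : Set (A × A)) :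
    Set (A × A × A × A) :=
  bComp (idBridge ρ ρplus)
    (bComp (deltaFlat S ρplus (centralizer S ρ ρplus)) (idBridge ρ ρplus))

/-- `A` is subdirectly irreducible with monolith `μ`. -/
def IsMonolith (S : Signature) {A : Type} [SAlg S A] (μ : Set (A × A)) : Prop :=
  IsCongruence S μ ∧ μ ≠ diag A ∧ ∀ θ, IsCongruence S θ → θ ≠ diag A → μ ⊆ θ

/-- The carrier of `D(A,θ)`-style quotients: `A(μ)/Δ_{μ,α}`. -/
abbrev DCar (S : Signature) (A : Type) [SAlg S A] (μ α : Set (A × A)) : Type :=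
  Quot (fun p q : ↥μ => ((p : A × A), (q : A × A)) ∈ DeltaCon S μ α)

/-- The class of a pair `p ∈ μ` in `A(μ)/Δ_{μ,α}`. -/
def DCar.mk (S : Signature) (A : Type) [SAlg S A] (μ α : Set (A × A)) (p : ↥μ) :
    DCar S A μ α :=
  Quot.mk _ p

/-- The algebra structure on `A(μ)/Δ_{μ,α}` (extensionally correct when `μ` is a
congruence and `Δ_{μ,α}` is a congruence of `A(μ)`). -/
noncomputable def DAlg (S : Signature) (A : Type) [SAlg S A] (μ α : Set (A × A))
    (h : IsSubuniverse S μ) : SAlg S (DCar S A μ α) :=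
  letI := subAlg μ h
  ⟨fun o x => DCar.mk S A μ α
    (SAlg.interp o fun i => Classical.choose (Quot.exists_rep (x i)))⟩

/-- The canonical similarity bridge `T_{D(A)}` from `A` to `D(A)`. -/
def TDBridge (S : Signature) (A : Type) [SAlg S A] (μ α : Set (A × A)) :
    Set (A × A × DCar S A μ α × DCar S A μ α) :=
  {x | ∃ (a b e : A) (_ : (a, b) ∈ μ) (h1 : (a, e) ∈ μ) (h2 : (b, e) ∈ μ),
    x = (a, b, DCar.mk S A μ α ⟨(a, e), h1⟩, DCar.mk S A μ α ⟨(b, e), h2⟩)}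

/-- Similarity of (subdirectly irreducible) algebras: `D(A) ≅ D(B)`, where `D(X)` is
`X(μ)/Δ_{μ,(0:μ)}` if the monolith `μ` is abelian, and `X` itself otherwise. -/
def SimilarI (S : Signature) {A B : Type} (iA : SAlg S A) (iB : SAlg S B) : Prop :=
  letI := iA
  letI := iB
  ∃ (μA : Set (A × A)) (μB : Set (B × B)) (hA : IsMonolith S μA) (hB : IsMonolith S μB),
    ((Centralizes S μA μA (diag A) ∧ Centralizes S μB μB (diag B)) →
      IsoAlgI (DAlg S A μA (centralizer S (diag A) μA) hA.1.1)
        (DAlg S B μB (centralizer S (diag B) μB) hB.1.1)) ∧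
    ((Centralizes S μA μA (diag A) ∧ ¬ Centralizes S μB μB (diag B)) →
      IsoAlgI (DAlg S A μA (centralizer S (diag A) μA) hA.1.1) iB) ∧
    ((¬ Centralizes S μA μA (diag A) ∧ Centralizes S μB μB (diag B)) →
      IsoAlgI iA (DAlg S B μB (centralizer S (diag B) μB) hB.1.1)) ∧
    ((¬ Centralizes S μA μA (diag A) ∧ ¬ Centralizes S μB μB (diag B)) →
      IsoAlgI iA iB)

end Zhuk

namespace Zhuk

variable {S : Signature}

/-! ### Terms, subuniverses and homomorphisms -/

section Basics
variable {A B : Type} [SAlg S A] [SAlg S B]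

theorem STerm.eval_prod {n : ℕ} (t : STerm S n) (v : Fin n → A × B) :
    t.eval v = (t.eval fun i => (v i).1, t.eval fun i => (v i).2) := by
  induction t with
  | var i => rfl
  | app o ts ih => simp only [STerm.eval, ih]; rfl

theorem IsSubuniverse.eval_mem {R : Set A} (h : IsSubuniverse S R) {n : ℕ} (t : STerm S n)
    (v : Fin n → A) (hv : ∀ i, v i ∈ R) : t.eval v ∈ R := by
  induction t with
  | var i => exact hv i
  | app o ts ih => exact h o _ ih

/-- Homomorphisms between algebras whose structures are found by instance search. -/
def IsHom (S : Signature) {A B : Type} [SAlg S A] [SAlg S B] (f : A → B) : Prop :=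
  ∀ (o : S.ops) (x : Fin (S.arity o) → A),
    f (SAlg.interp o x) = SAlg.interp o fun i => f (x i)

theorem IsHom.eval {f : A → B} (hf : IsHom S f) {n : ℕ} (t : STerm S n) (v : Fin n → A) :
    f (t.eval v) = t.eval fun i => f (v i) := by
  induction t with
  | var i => rfl
  | app o ts ih =>
    simp only [STerm.eval]
    rw [hf o]
    simp only [ih]

/-- Substitution of terms for the variables of a term. -/
def STerm.subst {n m : ℕ} : STerm S n → (Fin n → STerm S m) → STerm S m
  | .var i, s => s i
  | .app o ts, s => .app o fun i => (ts i).subst s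

theorem STerm.eval_subst {n m : ℕ} (t : STerm S n) (s : Fin n → STerm S m) (v : Fin m → A) :
    (t.subst s).eval v = t.eval fun i => (s i).eval v := by
  induction t with
  | var i => rfl
  | app o ts ih => simp only [STerm.subst, STerm.eval, ih]

/-- The ternary operation defined by a term. -/
def STerm.tri (d : STerm S 3) (x y z : A) : A := d.eval ![x, y, z]

theorem STerm.tri_prod (d : STerm S 3) (x y z : A × B) :
    d.tri x y z = (d.tri x.1 y.1 z.1, d.tri x.2 y.2 z.2) := by
  unfold STerm.tri
  rw [STerm.eval_prod]
  congr 2 <;> (funext i; fin_cases i <;> rfl)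

theorem IsSubuniverse.tri_mem {R : Set A} (h : IsSubuniverse S R) (d : STerm S 3) {x y z : A}
    (hx : x ∈ R) (hy : y ∈ R) (hz : z ∈ R) : d.tri x y z ∈ R :=
  h.eval_mem d _ fun i => by fin_cases i <;> assumption

theorem IsHom.symm {f : A ≃ B} (hf : IsHom S f) : IsHom S f.symm := fun o x => by
  apply f.injective
  simp only [hf o, Equiv.apply_symm_apply]

end Basics

theorem hybrid {ι X : Type} [Finite ι] [DecidableEq ι] (P : (ι → X) → Prop) (x y : ι → X)
    (h : ∀ j z, P (Function.update z j (x j)) → P (Function.update z j (y j))) (hx : P x) :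
    P y := by
  classical
  cases nonempty_fintype ι
  have key : ∀ s : Finset ι, P (fun i => if i ∈ s then y i else x i) := by
    intro s
    induction s using Finset.induction_on with
    | empty => simpa using hx
    | insert j s hj ih =>
      have e1 : (fun i => if i ∈ s then y i else x i)
          = Function.update (fun i => if i ∈ s then y i else x i) j (x j) := by
        funext i
        by_cases hi : i = j
        · subst hi; simp [hj]
        · simp [Function.update, hi]
      have e2 : (fun i => if i ∈ insert j s then y i else x i)
          = Function.update (fun i => if i ∈ s then y i else x i) j (y j) := by
        funext i
        by_cases hi : i = j
        · subst hi; simp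
        · simp [Function.update, hi]
      rw [e2]
      exact h j _ (e1 ▸ ih)
  simpa using key Finset.univ

/-! ### Twins, matrices and the term condition -/

/-- Pairs of unary polynomials obtained from one term with `θ`-related parameters. -/
inductive Twin (S : Signature) {A : Type} [SAlg S A] (θ : Set (A × A)) : (A → A) → (A → A) → Prop
  | id : Twin S θ (fun a => a) (fun a => a)
  | const {c d : A} (h : (c, d) ∈ θ) : Twin S θ (fun _ => c) (fun _ => d)
  | op (o : S.ops) (g h : Fin (S.arity o) → A → A) (H : ∀ i, Twin S θ (g i) (h i)) :
      Twin S θ (fun a => SAlg.interp o fun i => g i a) (fun a => SAlg.interp o fun i => h i a)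

/-- The 2×2 matrices generated by `φ`-rows and `θ`-columns. -/
inductive Mat (S : Signature) {A : Type} [SAlg S A] (φ θ : Set (A × A)) : A → A → A → A → Prop
  | row {a b : A} (h : (a, b) ∈ φ) : Mat S φ θ a a b b
  | col {c d : A} (h : (c, d) ∈ θ) : Mat S φ θ c d c d
  | op (o : S.ops) (p q r s : Fin (S.arity o) → A) (H : ∀ i, Mat S φ θ (p i) (q i) (r i) (s i)) :
      Mat S φ θ (SAlg.interp o p) (SAlg.interp o q) (SAlg.interp o r) (SAlg.interp o s)

/-- The term condition `C(φ, θ; 0)`. -/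
def TC (S : Signature) {A : Type} [SAlg S A] (φ θ : Set (A × A)) : Prop :=
  ∀ p q r s, Mat S φ θ p q r s → p = q → r = s

/-- The largest congruence centralizing `θ`, described by twins. -/
def Zrel (S : Signature) {A : Type} [SAlg S A] (θ : Set (A × A)) : Set (A × A) :=
  {x | ∀ g h, Twin S θ g h → (g x.1 = h x.1 ↔ g x.2 = h x.2)}

section Twins
variable {A : Type} [SAlg S A] {θ φ : Set (A × A)}

theorem Twin.comp {g h g' h' : A → A} (H : Twin S θ g h) (H' : Twin S θ g' h') :
    Twin S θ (fun a => g (g' a)) (fun a => h (h' a)) := by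
  induction H with
  | id => exact H'
  | const hc => exact .const hc
  | op o g h _ ih => exact .op o _ _ ih

theorem Twin.congr {g h g' h' : A → A} (H : Twin S θ g h) (e : ∀ a, g a = g' a)
    (e' : ∀ a, h a = h' a) : Twin S θ g' h' := by
  rw [← funext e, ← funext e']; exact H

theorem Twin.mono {θ' : Set (A × A)} (hθ : θ ⊆ θ') {g h : A → A} (H : Twin S θ g h) :
    Twin S θ' g h := by
  induction H with
  | id => exact .id
  | const hc => exact .const (hθ hc)
  | op o g h _ ih => exact .op o _ _ ih

theorem Twin.inv (hθ : ∀ a b, (a, b) ∈ θ → (b, a) ∈ θ) {g h : A → A} (H : Twin S θ g h) :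
    Twin S θ h g := by
  induction H with
  | id => exact .id
  | const hc => exact .const (hθ _ _ hc)
  | op o g h _ ih => exact .op o _ _ ih

theorem Twin.left (hr : ∀ a, (a, a) ∈ θ) {g h : A → A} (H : Twin S θ g h) : Twin S θ g g := by
  induction H with
  | id => exact .id
  | const hc => exact .const (hr _)
  | op o g h _ ih => exact .op o _ _ ih

theorem Twin.right (hr : ∀ a, (a, a) ∈ θ) {g h : A → A} (H : Twin S θ g h) : Twin S θ h h := by
  induction H with
  | id => exact .id
  | const hc => exact .const (hr _)
  | op o g h _ ih => exact .op o _ _ ih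

/-- The two components of a twin agree up to any reflexive subuniverse containing `θ`. -/
theorem Twin.pair_mem {R : Set (A × A)} (hR : IsSubuniverse S R) (hθ : θ ⊆ R) {g h : A → A}
    (H : Twin S θ g h) {a b : A} (hab : (a, b) ∈ R) : (g a, h b) ∈ R := by
  induction H with
  | id => exact hab
  | const hc => exact hθ hc
  | op o g h _ ih => exact hR o _ ih

theorem Twin.mat {g h : A → A} (H : Twin S θ g h) {a b : A} (hab : (a, b) ∈ φ) :
    Mat S φ θ (g a) (h a) (g b) (h b) := by
  induction H with
  | id => exact .row hab
  | const hc => exact .col hc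
  | op o g h _ ih => exact .op o _ _ _ _ ih

theorem Twin.eval {n : ℕ} (t : STerm S n) {g h : Fin n → A → A}
    (H : ∀ i, Twin S θ (g i) (h i)) :
    Twin S θ (fun a => t.eval fun i => g i a) (fun a => t.eval fun i => h i a) := by
  induction t with
  | var i => exact H i
  | app o ts ih => exact .op o _ _ ih

theorem Twin.translation (hr : ∀ a, (a, a) ∈ θ) (o : S.ops) (z : Fin (S.arity o) → A)
    (j : Fin (S.arity o)) :
    Twin S θ (fun w => SAlg.interp o (Function.update z j w))
      (fun w => SAlg.interp o (Function.update z j w)) := by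
  refine .op o (fun i w => Function.update z j w i) (fun i w => Function.update z j w i) fun i => ?_
  by_cases hi : i = j
  · subst hi; simpa using Twin.id
  · simpa [Function.update, hi] using Twin.const (hr (z i))

theorem Mat.subuniverse : IsSubuniverse S
    {x : A × A × A × A | Mat S φ θ x.1 x.2.1 x.2.2.1 x.2.2.2} :=
  fun o _ hx => .op o _ _ _ _ hx

theorem Mat.transpose {p q r s : A} (H : Mat S φ θ p q r s) : Mat S θ φ p r q s := by
  induction H with
  | row h => exact .col h
  | col h => exact .row h
  | op o p q r s _ ih => exact .op o _ _ _ _ ih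

theorem Mat.swapCols (hθ : ∀ a b, (a, b) ∈ θ → (b, a) ∈ θ) {p q r s : A}
    (H : Mat S φ θ p q r s) : Mat S φ θ q p s r := by
  induction H with
  | row h => exact .row h
  | col h => exact .col (hθ _ _ h)
  | op o p q r s _ ih => exact .op o _ _ _ _ ih

theorem Mat.swapRows (hφ : ∀ a b, (a, b) ∈ φ → (b, a) ∈ φ) {p q r s : A}
    (H : Mat S φ θ p q r s) : Mat S φ θ r s p q :=
  (H.transpose.swapCols hφ).transpose

/-- Closure of the left column of matrices under a twin, applied columnwise. -/
theorem Mat.twin {p q r s : A} (H : Mat S φ θ p q r s) {g h : A → A} (hgh : Twin S θ g h) :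
    Mat S φ θ (g p) (h q) (g r) (h s) := by
  induction hgh with
  | id => exact H
  | const hc => exact .col hc
  | op o g h _ ih => exact .op o _ _ _ _ ih

theorem Mat.row_mem {R : Set (A × A)} (hR : IsSubuniverse S R) (hr : ∀ a, (a, a) ∈ R)
    (hθ : θ ⊆ R) {p q r s : A} (H : Mat S φ θ p q r s) : (p, q) ∈ R ∧ (r, s) ∈ R := by
  induction H with
  | row h => exact ⟨hr _, hr _⟩
  | col h => exact ⟨hθ h, hθ h⟩
  | op o p q r s _ ih => exact ⟨hR o _ fun i => (ih i).1, hR o _ fun i => (ih i).2⟩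

theorem Zrel.mono {θ' : Set (A × A)} (hθ : θ ⊆ θ') : Zrel S θ' ⊆ Zrel S θ :=
  fun _ hx g h hgh => hx g h (hgh.mono hθ)

theorem zrel_isCongruence (hr : ∀ a, (a, a) ∈ θ) : IsCongruence S (Zrel S θ) := by
  classical
  refine ⟨fun o x hx g h hgh => ?_, fun a g h _ => Iff.rfl, fun h1 g h hgh => (h1 g h hgh).symm,
    fun h1 h2 g h hgh => (h1 g h hgh).trans (h2 g h hgh)⟩
  refine hybrid (fun z => g (SAlg.interp o fun i => (x i).1) = h (SAlg.interp o fun i => (x i).1) ↔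
    g (SAlg.interp o z) = h (SAlg.interp o z)) (fun i => (x i).1) (fun i => (x i).2) ?_ Iff.rfl
  intro j z hz
  exact hz.trans (hx j _ _ (hgh.comp (Twin.translation hr o z j)))

theorem Twin.exists_term [Finite ↥θ] :
    ∃ (n : ℕ) (c d : Fin n → A), (∀ i, (c i, d i) ∈ θ) ∧ ∀ g h, Twin S θ g h →
      ∃ t : STerm S (n + 1), (∀ a, g a = t.eval (Fin.cons a c)) ∧
        ∀ a, h a = t.eval (Fin.cons a d) := by
  cases nonempty_fintype ↥θ
  let e := Fintype.equivFin ↥θ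
  refine ⟨Fintype.card ↥θ, fun i => (e.symm i).1.1, fun i => (e.symm i).1.2,
    fun i => (e.symm i).2, fun g h H => ?_⟩
  induction H with
  | id => exact ⟨.var 0, fun a => rfl, fun a => rfl⟩
  | @const c d hc => exact ⟨.var (e ⟨(c, d), hc⟩).succ, fun a => by simp [STerm.eval],
      fun a => by simp [STerm.eval]⟩
  | op o g h _ ih =>
    choose t ht ht' using ih
    exact ⟨.app o t, fun a => by simp [STerm.eval, ht], fun a => by simp [STerm.eval, ht']⟩

theorem centralizes_iff [Finite A] (hφ : ∀ a b, (a, b) ∈ φ → (b, a) ∈ φ) :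
    Centralizes S φ θ (diag A) ↔ φ ⊆ Zrel S θ := by
  constructor
  · rintro H ⟨a, b⟩ hab g h hgh
    obtain ⟨n, c, d, hcd, ht⟩ := Twin.exists_term (S := S) (θ := θ)
    obtain ⟨t, hg, hh⟩ := ht g h hgh
    simp only [hg, hh]
    exact ⟨H n t a b c d hab hcd, H n t b a c d (hφ _ _ hab) hcd⟩
  · intro H n t a b c d hab hcd h
    refine (H hab (fun x => t.eval (Fin.cons x c)) (fun x => t.eval (Fin.cons x d)) ?_).1 h
    refine Twin.eval t (g := fun i x => (Fin.cons x c : Fin (n + 1) → A) i)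
      (h := fun i x => (Fin.cons x d : Fin (n + 1) → A) i) fun i => ?_
    refine Fin.cases ?_ (fun i => ?_) i
    · exact .id
    · exact .const (hcd i)

theorem centralizer_eq [Finite A] (hr : ∀ a, (a, a) ∈ θ) :
    centralizer S (diag A) θ = Zrel S θ := by
  apply Set.Subset.antisymm
  · rintro x ⟨φ, ⟨hφ, hc⟩, hx⟩
    exact (centralizes_iff fun _ _ h => hφ.2.symm h).1 hc hx
  · intro x hx
    have hZ := zrel_isCongruence (S := S) hr
    exact ⟨_, ⟨hZ, (centralizes_iff fun _ _ h => hZ.2.symm h).2 subset_rfl⟩, hx⟩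

theorem Mat.exists_twin_family [DecidableEq ↥φ] (hr : ∀ a, (a, a) ∈ θ) (hs : IsSubuniverse S θ)
    {p q r s : A} (H : Mat S φ θ p q r s) : ∃ G K : (↥φ → A) → A,
      (∀ z, (G z, K z) ∈ θ) ∧
      (∀ z j, Twin S θ (fun w => G (Function.update z j w)) fun w => K (Function.update z j w)) ∧
      G (fun x => x.1.1) = p ∧ K (fun x => x.1.1) = q ∧
      G (fun x => x.1.2) = r ∧ K (fun x => x.1.2) = s := by
  induction H with
  | @row a b h =>
    refine ⟨fun z => z ⟨(a, b), h⟩, fun z => z ⟨(a, b), h⟩, fun _ => hr _, fun z j => ?_,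
      rfl, rfl, rfl, rfl⟩
    by_cases hj : ⟨(a, b), h⟩ = j
    · subst hj; simpa using Twin.id
    · simpa [Function.update, hj] using Twin.const (hr _)
  | @col c d h => exact ⟨fun _ => c, fun _ => d, fun _ => h, fun _ _ => .const h, rfl, rfl, rfl, rfl⟩
  | op o p q r s _ ih =>
    choose G K h1 h2 hp hq hp' hq' using ih
    refine ⟨fun z => SAlg.interp o fun i => G i z, fun z => SAlg.interp o fun i => K i z,
      fun z => hs o _ fun i => h1 i z, fun z j => .op o _ _ fun i => h2 i z j, ?_, ?_, ?_, ?_⟩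
    · simp only [hp]
    · simp only [hq]
    · simp only [hp']
    · simp only [hq']

theorem tc_of_subset_zrel [Finite A] (hr : ∀ a, (a, a) ∈ θ) (hs : IsSubuniverse S θ)
    (h : φ ⊆ Zrel S θ) : TC S φ θ := by
  classical
  intro p q r s H hpq
  obtain ⟨G, K, -, h2, rfl, rfl, rfl, rfl⟩ := H.exists_twin_family hr hs
  refine hybrid (fun z => G z = K z) _ _ (fun j z hz => ?_) hpq
  exact (h j.2 _ _ (h2 z j)).1 hz

end Twins

theorem IsCongruence.refl {A : Type} [SAlg S A] {θ : Set (A × A)} (h : IsCongruence S θ) (a : A) :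
    (a, a) ∈ θ := h.2.refl a

theorem IsCongruence.symm {A : Type} [SAlg S A] {θ : Set (A × A)} (h : IsCongruence S θ) {a b : A}
    (hab : (a, b) ∈ θ) : (b, a) ∈ θ := h.2.symm hab

theorem IsCongruence.trans {A : Type} [SAlg S A] {θ : Set (A × A)} (h : IsCongruence S θ)
    {a b c : A} (hab : (a, b) ∈ θ) (hbc : (b, c) ∈ θ) : (a, c) ∈ θ := h.2.trans hab hbc

/-! ### Finite abelian Taylor algebras have a Maltsev operation -/

theorem exists_iterate_idem {X : Type} [Finite X] (g : X → X) :
    ∃ k, 1 ≤ k ∧ ∀ x, g^[k] (g^[k] x) = g^[k] x := by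
  obtain ⟨m, n, hmn, he⟩ := Finite.exists_ne_map_eq_of_infinite (fun n : ℕ => g^[n])
  wlog h : m < n generalizing m n
  · exact this n m hmn.symm he.symm (by omega)
  replace he : g^[m] = g^[n] := he
  obtain ⟨p, rfl⟩ : ∃ p, n = p + m := ⟨n - m, by omega⟩
  have h1 : ∀ l j, m ≤ j → g^[l * p + j] = g^[j] := by
    intro l
    induction l with
    | zero => simp
    | succ l ih =>
      intro j hj
      obtain ⟨j, rfl⟩ := Nat.exists_eq_add_of_le hj
      rw [show (l + 1) * p + (m + j) = l * p + (m + (p + j)) by ring, ih _ (by omega),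
        show m + (p + j) = (p + m) + j by ring, Function.iterate_add, ← he, ← Function.iterate_add]
  refine ⟨(m + 1) * p, Nat.mul_pos (by omega) (by omega), fun x => ?_⟩
  rw [← Function.iterate_add_apply]
  rw [h1 (m + 1) ((m + 1) * p)]
  nlinarith

section Abelian
variable {P : Type} [SAlg S P]

/-- `b` is the value at `a` of a unary polynomial that is a twin of the identity. -/
def Orb (S : Signature) {P : Type} [SAlg S P] (a b : P) : Prop :=
  ∃ h, Twin S (Set.univ : Set (P × P)) (fun a => a) h ∧ h a = b

theorem Orb.refl (a : P) : Orb S a a := ⟨_, .id, rfl⟩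

theorem Orb.of_eq {a b : P} (h : a = b) : Orb S a b := h ▸ .refl a

theorem Orb.trans {a b c : P} (h1 : Orb S a b) (h2 : Orb S b c) : Orb S a c := by
  obtain ⟨g, hg, rfl⟩ := h1
  obtain ⟨h, hh, rfl⟩ := h2
  exact ⟨_, hh.comp hg, rfl⟩

theorem Orb.symm [Finite P] (hab : TC S (Set.univ : Set (P × P)) Set.univ) {a b : P}
    (h1 : Orb S a b) : Orb S b a := by
  obtain ⟨g, hg, rfl⟩ := h1
  have hinj : Function.Injective g := fun x y hxy =>
    hab _ _ _ _ ((hg.mat (φ := Set.univ) (Set.mem_univ (x, y))).transpose.swapRows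
      fun _ _ _ => Set.mem_univ _) hxy
  have hit : ∀ n, Twin S (Set.univ : Set (P × P)) (fun a => a) g^[n] := by
    intro n
    induction n with
    | zero => exact .id
    | succ n ih => exact ih.comp hg
  let e : Equiv.Perm P := Equiv.ofBijective g (Finite.injective_iff_bijective.1 hinj)
  refine ⟨_, hit (orderOf e - 1), ?_⟩
  have h2 : e ^ orderOf e = 1 := pow_orderOf_eq_one e
  rw [← Function.iterate_succ_apply, Nat.succ_eq_add_one, Nat.sub_add_cancel (orderOf_pos e)]
  have h3 : (e ^ orderOf e) a = a := by rw [h2]; rfl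
  rwa [← Equiv.Perm.iterate_eq_pow] at h3

theorem Orb.mat (hab : TC S (Set.univ : Set (P × P)) Set.univ) {p q r s : P}
    (H : Mat S Set.univ Set.univ p q r s) (h : Orb S p q) : Orb S r s := by
  obtain ⟨g, hg, rfl⟩ := h
  exact ⟨g, hg, hab _ _ _ _ (H.twin (hg.inv fun _ _ _ => Set.mem_univ _)) rfl⟩

/-- The unary polynomial `z ↦ s(w, …, w, z, w, …, w)` with `z` at coordinate `j`. -/
def STerm.slot {m : ℕ} (s : STerm S m) (j : Fin m) (w z : P) : P :=
  s.eval (Function.update (fun _ => w) j z)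

theorem STerm.slot_self {m : ℕ} {s : STerm S m} (hid : ∀ a : P, s.eval (fun _ => a) = a)
    (j : Fin m) (w : P) : s.slot j w w = w := by
  unfold STerm.slot
  rw [Function.update_eq_self_iff.2 rfl, hid]

theorem STerm.slot_iterate_self {m : ℕ} {s : STerm S m} (hid : ∀ a : P, s.eval (fun _ => a) = a)
    (j : Fin m) (w : P) (k : ℕ) : (s.slot j w)^[k] w = w := by
  induction k with
  | zero => rfl
  | succ k ih => rw [Function.iterate_succ_apply, STerm.slot_self hid, ih]

variable {θ φ : Set (P × P)}

theorem Mat.eval {n : ℕ} (t : STerm S n) {p q r s : Fin n → P}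
    (H : ∀ i, Mat S φ θ (p i) (q i) (r i) (s i)) :
    Mat S φ θ (t.eval p) (t.eval q) (t.eval r) (t.eval s) := by
  induction t with
  | var i => exact H i
  | app o ts ih => exact .op o _ _ _ _ ih

theorem Mat.eval_update {m : ℕ} (t : STerm S m) (j : Fin m) {x y x' y' : Fin m → P} {p q r s : P}
    (H : ∀ i, Mat S φ θ (x i) (y i) (x' i) (y' i)) (H' : Mat S φ θ p q r s) :
    Mat S φ θ (t.eval (Function.update x j p)) (t.eval (Function.update y j q))
      (t.eval (Function.update x' j r)) (t.eval (Function.update y' j s)) := by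
  refine Mat.eval t fun i => ?_
  by_cases hi : i = j
  · subst hi; simpa using H'
  · simpa [Function.update, hi] using H i

theorem Mat.slot {m : ℕ} (t : STerm S m) (j : Fin m) {w w' w'' w''' p q r s : P}
    (H : Mat S φ θ w w' w'' w''') (H' : Mat S φ θ p q r s) :
    Mat S φ θ (t.slot j w p) (t.slot j w' q) (t.slot j w'' r) (t.slot j w''' s) :=
  Mat.eval_update t j (fun _ => H) H'

theorem Mat.slot_iterate {m : ℕ} (t : STerm S m) (j : Fin m) (k : ℕ) {w w' w'' w''' p q r s : P}
    (H : Mat S φ θ w w' w'' w''') (H' : Mat S φ θ p q r s) :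
    Mat S φ θ ((t.slot j w)^[k] p) ((t.slot j w')^[k] q) ((t.slot j w'')^[k] r)
      ((t.slot j w''')^[k] s) := by
  induction k with
  | zero => exact H'
  | succ k ih => simp only [Function.iterate_succ_apply']; exact Mat.slot t j H ih

theorem Twin.eval_update {m : ℕ} (t : STerm S m) (j : Fin m) {x y : Fin m → P → P} {g h : P → P}
    (H : ∀ i, Twin S θ (x i) (y i)) (H' : Twin S θ g h) :
    Twin S θ (fun a => t.eval (Function.update (fun i => x i a) j (g a)))
      (fun a => t.eval (Function.update (fun i => y i a) j (h a))) := by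
  have := Twin.eval (θ := θ) t (g := Function.update x j g) (h := Function.update y j h) fun i => ?_
  · refine this.congr (fun a => ?_) (fun a => ?_) <;> congr 1 <;> funext i <;>
      by_cases hi : i = j
    · subst hi; simp
    · simp [Function.update, hi]
    · subst hi; simp
    · simp [Function.update, hi]
  · by_cases hi : i = j
    · subst hi; simpa using H'
    · simpa [Function.update, hi] using H i

theorem Twin.slot_iterate {m : ℕ} (t : STerm S m) (j : Fin m) (k : ℕ) {w w' g h : P → P}
    (H : Twin S θ w w') (H' : Twin S θ g h) :
    Twin S θ (fun a => (t.slot j (w a))^[k] (g a)) (fun a => (t.slot j (w' a))^[k] (h a)) := by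
  induction k with
  | zero => exact H'
  | succ k ih =>
    simp only [Function.iterate_succ_apply']
    exact Twin.eval_update t j (fun _ => H) ih

theorem orb_slot_iterate [Finite P] (hab : TC S (Set.univ : Set (P × P)) Set.univ) {m : ℕ}
    {s : STerm S m} (hid : ∀ a : P, s.eval (fun _ => a) = a) (j : Fin m) :
    ∃ n, ∀ (w : P) (x x' : Fin m → P), x j = x' j →
      Orb S ((s.slot j w)^[n] (s.eval x)) ((s.slot j w)^[n] (s.eval x')) := by
  have hu : ∀ x : P × P, x ∈ Set.univ := Set.mem_univ
  obtain ⟨k, hk, hΦ⟩ := exists_iterate_idem (fun x : P × P => (x.1, s.slot (P := P) j x.1 x.2))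
  have hit : ∀ n (w z : P), (fun x : P × P => (x.1, s.slot (P := P) j x.1 x.2))^[n] (w, z)
      = (w, (s.slot j w)^[n] z) := by
    intro n w z
    induction n generalizing z with
    | zero => rfl
    | succ n ih => simp only [Function.iterate_succ_apply, ih]
  have hidem : ∀ w z : P, (s.slot j w)^[k] ((s.slot j w)^[k] z) = (s.slot j w)^[k] z := by
    intro w z
    simpa [hit] using hΦ (w, z)
  have hI : ∀ y y' u : P, (s.slot j y)^[k] ((s.slot j y')^[k] u) = (s.slot j y)^[k] u := by
    intro y y' u
    exact hab _ _ _ _ (Mat.slot_iterate s j k (Mat.row (hu (y', y)))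
      (Mat.col (hu ((s.slot j y')^[k] u, u)))) (hidem y' u)
  have hself := fun (w : P) n => STerm.slot_iterate_self hid j w n
  have h2 : ∀ w u : P, (s.slot j w)^[2 * k - 1] u = (s.slot j w)^[k - 1] ((s.slot j w)^[k] u) := by
    intro w u
    rw [← Function.iterate_add_apply]
    congr 1
    omega
  have hIII : ∀ u z : P, (s.slot j ((s.slot j z)^[k] u))^[2 * k - 1] (s.slot j u z) = z := by
    intro u z
    have h := hab _ _ _ _ (Mat.slot_iterate s j (2 * k - 1)
      (Mat.slot_iterate s j k (Mat.row (hu (z, z))) (Mat.col (hu (u, z))))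
      (Mat.slot s j (Mat.col (hu (u, z))) (Mat.row (hu (u, z))))) ?_
    · rw [h, hself, STerm.slot_self hid, hself]
    · rw [hself z k, STerm.slot_self hid, h2, ← hI ((s.slot j z)^[k] u) z u, hself, hself,
        ← Function.iterate_succ_apply, show Nat.succ (2 * k - 1) = k + k by omega,
        Function.iterate_add_apply, hidem]
  refine ⟨2 * k - 1, fun w x x' hx => ?_⟩
  have hK : ∀ x : Fin m → P, Orb S (x j)
      ((s.slot j ((s.slot j (x j))^[k] w))^[2 * k - 1] (s.eval x)) := by
    intro x
    refine ⟨fun z => (s.slot j ((s.slot j z)^[k] w))^[2 * k - 1]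
      (s.eval (Function.update x j z)), ?_, ?_⟩
    · refine Twin.congr (Twin.slot_iterate s j (2 * k - 1)
        (Twin.slot_iterate s j k .id (.const (hu (w, w))))
        (Twin.eval_update s j (x := fun i _ => w) (y := fun i _ => x i)
          (fun i => .const (hu _)) .id)) (fun z => ?_) fun z => rfl
      exact hIII w z
    · simp
  have h3 := ((hK x).symm hab).trans (hx ▸ hK x')
  exact h3.mat hab (Mat.slot_iterate s j _ (Mat.row (hu _)) (Mat.col (hu _)))

theorem orb_total [Finite P] (hab : TC S (Set.univ : Set (P × P)) Set.univ) {n : ℕ}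
    {t : STerm S n} {u v : Fin n → Fin n → Fin 2} (huv : ∀ i, u i i ≠ v i i)
    (ht : TaylorOn S P t u v) (a b : P) : Orb S a b := by
  have hu : ∀ x : P × P, x ∈ Set.univ := Set.mem_univ
  have hcoord : ∀ i : Fin n, ∀ z y : P, Orb S (t.slot i z y) z := by
    intro i
    obtain ⟨m, hm⟩ := orb_slot_iterate hab ht.1 i
    have h1 : ∀ w x : P, Orb S ((t.slot i w)^[m] x) w := by
      intro w x
      have key : ∀ X X' : Fin n → P, X i = x → X' i = w → t.eval X = t.eval X' →
          Orb S ((t.slot i w)^[m] x) w := by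
        intro X X' hX hX' he
        have e1 := hm w X (fun _ => x) hX
        have e2 := hm w X' (fun _ => w) hX'
        rw [ht.1] at e1 e2
        rw [STerm.slot_iterate_self ht.1] at e2
        exact (e1.symm hab).trans (he ▸ e2)
      have hne := huv i
      by_cases h0 : u i i = 0
      · exact key _ _ (by simp [h0]) (by rw [if_neg]; intro h; exact hne (h0.trans h.symm))
          (ht.2 i x w)
      · have h1 : v i i = 0 := by omega
        exact key _ _ (by simp [h0]) (by simp [h1]) (ht.2 i w x)
    have hcompat : ∀ z a b : P, Orb S a b → Orb S (t.slot i z a) (t.slot i z b) := by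
      rintro z a _ ⟨h, hh, rfl⟩
      refine Orb.mat hab (Mat.slot t i (Mat.row (hu (a, z))) (Mat.col (hu (a, h a)))) ?_
      rw [STerm.slot_self ht.1]
      refine ⟨fun y => t.slot i y (h y), ?_, rfl⟩
      exact Twin.congr (Twin.slot_iterate t i 1 .id hh)
        (fun y => STerm.slot_self ht.1 i y) fun y => rfl
    have hinj : ∀ w z z' : P, Orb S (t.slot i z w) (t.slot i z' w) → Orb S z z' := by
      intro w z z' h
      have h2 : Orb S (t.slot i z z') z' := by
        have := Orb.mat hab (Mat.slot t i (Mat.col (hu (z, z'))) (Mat.row (hu (w, z')))) h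
        rwa [STerm.slot_self ht.1 i z'] at this
      have h3 : ∀ k, Orb S ((t.slot i z)^[k] z') z' := by
        intro k
        induction k with
        | zero => exact .refl _
        | succ k ih =>
          rw [Function.iterate_succ_apply']
          exact (hcompat _ _ _ ih).trans h2
      exact ((h1 z z').symm hab).trans (h3 m)
    let s : STerm S 2 := t.subst (Function.update (fun _ => .var 0) i (.var 1))
    have hs : ∀ x : Fin 2 → P, s.eval x = t.slot i (x 0) (x 1) := by
      intro x
      simp only [s, STerm.eval_subst, STerm.slot]
      congr 1
      funext l
      by_cases hl : l = i
      · subst hl; simp [STerm.eval]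
      · simp [Function.update, hl, STerm.eval]
    have hsid : ∀ a : P, s.eval (fun _ => a) = a := fun a => by
      rw [hs, STerm.slot_self ht.1]
    have hs0 : ∀ w z : P, s.slot 0 w z = t.slot i z w := by
      intro w z
      change s.eval _ = _
      simp [hs]
    obtain ⟨m', hm'⟩ := orb_slot_iterate hab hsid 0
    intro z y
    have h4 := hm' y ![z, y] ![z, z] rfl
    have hcancel : ∀ k (p q : P), Orb S ((s.slot 0 y)^[k] p) ((s.slot 0 y)^[k] q) → Orb S p q := by
      intro k
      induction k with
      | zero => exact fun _ _ h => h
      | succ k ih =>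
        intro p q h
        rw [Function.iterate_succ_apply, Function.iterate_succ_apply] at h
        have := ih _ _ h
        rw [hs0, hs0] at this
        exact hinj _ _ _ this
    have h5 := hcancel _ _ _ h4
    rw [hs, hs] at h5
    simpa [STerm.slot_self ht.1] using h5
  have hstep : ∀ (j : Fin n) (z : Fin n → P),
      Orb S (t.eval (Function.update z j a)) (t.eval (Function.update z j b)) := by
    intro j z
    refine Orb.mat hab (Mat.eval_update t j (x := fun _ => b) (y := fun _ => b)
      (fun i => .row (hu (b, z i))) (Mat.col (hu (a, b)))) ?_
    have := hcoord j b a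
    change Orb S _ (t.slot j b b)
    rwa [STerm.slot_self ht.1 j b]
  have := hybrid (fun z => Orb S a (t.eval z)) (fun _ => a) (fun _ => b)
    (fun j z hz => hz.trans (hstep j z)) (.of_eq (ht.1 a).symm)
  rwa [ht.1] at this

end Abelian

/-- The signature with a single operation, of arity `n`. -/
abbrev oneOp (n : ℕ) : Signature := ⟨Unit, fun _ => n⟩

section Extraction
variable {C : Type} [SAlg S C]

/-- The binary idempotent term operations of `C`, restricted to `θ`. -/
abbrev IdemOps (S : Signature) {C : Type} [SAlg S C] (θ : Set (C × C)) : Type :=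
  {f : ↥θ → C // ∃ s : STerm S 2, (∀ c : C, s.eval (fun _ => c) = c) ∧
    ∀ p, f p = s.eval ![p.1.1, p.1.2]}

/-- An idempotent term acts on the binary idempotent term operations. -/
abbrev idemOpsAlg {n : ℕ} (t : STerm S n) (ht : ∀ c : C, t.eval (fun _ => c) = c)
    (θ : Set (C × C)) : SAlg (oneOp n) (IdemOps S θ) :=
  ⟨fun _ x => ⟨fun p => t.eval fun i => (x i).1 p, by
    choose s hs hs' using fun i => (x i).2
    refine ⟨t.subst s, fun c => ?_, fun p => ?_⟩
    · simp only [STerm.eval_subst, hs, ht]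
    · simp only [STerm.eval_subst, ← hs']⟩⟩

theorem exists_maltsev [Finite C] {n : ℕ} {t : STerm S n} {u v : Fin n → Fin n → Fin 2}
    (huv : ∀ i, u i i ≠ v i i) (ht : TaylorOn S C t u v) {θ : Set (C × C)}
    (hθ : IsCongruence S θ) (hab : TC S θ θ) :
    ∃ d : STerm S 3, ∀ a b : C, (a, b) ∈ θ → d.tri a b b = a ∧ d.tri a a b = b := by
  let _ := idemOpsAlg t ht.1 θ
  have : Finite (IdemOps S θ) := inferInstance
  have hrel : ∀ (f g : IdemOps S θ) (p : ↥θ), (f.1 p, g.1 p) ∈ θ := by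
    have h1 : ∀ (f : IdemOps S θ) (p : ↥θ), (p.1.1, f.1 p) ∈ θ := by
      intro f p
      obtain ⟨s, hs, hf⟩ := f.2
      have := hθ.1.eval_mem s ![(p.1.1, p.1.1), (p.1.1, p.1.2)] fun i => by
        fin_cases i
        · exact hθ.refl _
        · exact p.2
      rw [STerm.eval_prod] at this
      rw [hf]
      convert this using 2
      · refine (hs p.1.1).symm.trans ?_
        congr 1
        funext i; fin_cases i <;> rfl
      · congr 1
        funext i; fin_cases i <;> rfl
    exact fun f g p => hθ.trans (hθ.symm (h1 f p)) (h1 g p)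
  have hmat : ∀ f g h k : IdemOps S θ, Mat (oneOp n) Set.univ Set.univ f g h k →
      ∀ p, Mat S θ θ (f.1 p) (g.1 p) (h.1 p) (k.1 p) := by
    intro f g h k H p
    induction H with
    | row _ => exact .row (hrel _ _ p)
    | col _ => exact .col (hrel _ _ p)
    | op o p q r s _ ih => exact Mat.eval t ih
  have hPab : TC (oneOp n) (Set.univ : Set (IdemOps S θ × IdemOps S θ)) Set.univ := by
    intro f g h k H hfg
    apply Subtype.ext
    funext p
    exact hab _ _ _ _ (hmat _ _ _ _ H p) (by rw [hfg])
  let pt : STerm (oneOp n) n := .app () fun i => .var i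
  have hpt : TaylorOn (oneOp n) (IdemOps S θ) pt u v := by
    refine ⟨fun f => Subtype.ext (funext fun p => ht.1 (f.1 p)), fun i x y =>
      Subtype.ext (funext fun p => ?_)⟩
    have := ht.2 i (x.1 p) (y.1 p)
    have e : ∀ w : Fin n → Fin 2, (pt.eval fun j => if w j = 0 then x else y).1 p
        = t.eval fun j => if w j = 0 then x.1 p else y.1 p := by
      intro w
      change (t.eval fun j => (if w j = 0 then x else y : IdemOps S θ).1 p) = _
      congr 1
      funext j
      split <;> rfl
    rw [e, e, this]
  let fst : IdemOps S θ := ⟨fun p => p.1.1, .var 0, fun _ => rfl, fun _ => rfl⟩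
  let snd : IdemOps S θ := ⟨fun p => p.1.2, .var 1, fun _ => rfl, fun _ => rfl⟩
  obtain ⟨h, hh, hfs⟩ := orb_total hPab huv hpt fst snd
  have hterm : ∀ g h : IdemOps S θ → IdemOps S θ, Twin (oneOp n) Set.univ g h →
      ∃ G H : STerm S 3, (∀ r (p : ↥θ), (g r).1 p = G.tri p.1.1 p.1.2 (r.1 p)) ∧
        (∀ r (p : ↥θ), (h r).1 p = H.tri p.1.1 p.1.2 (r.1 p)) ∧
        ∀ x z : C, G.tri x x z = H.tri x x z := by
    intro g h H
    induction H with
    | id => exact ⟨.var 2, .var 2, fun _ _ => rfl, fun _ _ => rfl, fun _ _ => rfl⟩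
    | @const c d _ =>
      obtain ⟨s, hs, hs'⟩ := c.2
      obtain ⟨r, hr, hr'⟩ := d.2
      have e : ∀ (s : STerm S 2) (x y z : C), (s.subst ![.var 0, .var 1]).tri x y z
          = s.eval ![x, y] := by
        intro s x y z
        simp only [STerm.tri, STerm.eval_subst]
        congr 1
        funext i; fin_cases i <;> rfl
      have e' : ∀ x : C, ![x, x] = fun _ => x := fun x => by
        funext i; fin_cases i <;> rfl
      refine ⟨s.subst ![.var 0, .var 1], r.subst ![.var 0, .var 1], ?_, ?_, ?_⟩
      · intro _ p; rw [e, hs']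
      · intro _ p; rw [e, hr']
      · intro x z; rw [e, e, e', hs, hr]
    | op o g h _ ih =>
      choose G H h1 h2 h3 using ih
      refine ⟨t.subst G, t.subst H, fun r p => ?_, fun r p => ?_, fun x z => ?_⟩
      · simp only [STerm.tri, STerm.eval_subst] at h1 ⊢
        simp only [← h1]; rfl
      · simp only [STerm.tri, STerm.eval_subst] at h2 ⊢
        simp only [← h2]; rfl
      · simp only [STerm.tri, STerm.eval_subst] at h3 ⊢
        simp only [h3]
  obtain ⟨G, H, hG, hH, hGH⟩ := hterm _ _ hh
  have hG1 : ∀ x y, (x, y) ∈ θ → G.tri x y x = x := fun x y hxy => (hG fst ⟨(x, y), hxy⟩).symm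
  have hG2 : ∀ x y, (x, y) ∈ θ → G.tri x y y = y := fun x y hxy => (hG snd ⟨(x, y), hxy⟩).symm
  have hG3 : ∀ x z, (x, z) ∈ θ → G.tri x x z = z := by
    intro x z hxz
    have hM : Mat S θ θ (G.tri x x x) (G.tri x z x) (G.tri x x z) (G.tri x z z) := by
      refine Mat.eval G fun i => ?_
      fin_cases i
      · exact .row (hθ.refl x)
      · exact .col hxz
      · exact .row hxz
    rw [hab _ _ _ _ hM (by rw [hG1 _ _ (hθ.refl x), hG1 _ _ hxz]), hG2 _ _ hxz]
  have hH1 : ∀ x y, (x, y) ∈ θ → H.tri x y x = y := fun x y hxy => by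
    have := hH fst ⟨(x, y), hxy⟩
    rw [hfs] at this
    exact this.symm
  refine ⟨H.subst ![.var 1, .var 0, .var 2], fun a b hab' => ?_⟩
  have e : ∀ x y z : C, (H.subst ![.var 1, .var 0, .var 2]).tri x y z = H.tri y x z := by
    intro x y z
    simp only [STerm.tri, STerm.eval_subst]
    congr 1
    funext i; fin_cases i <;> rfl
  rw [e, e, ← hGH, hG3 _ _ hab']
  exact ⟨hH1 _ _ (hθ.symm hab'), rfl⟩

end Extraction

/-! ### The algebra `D(A)` -/

section Delta
variable {A : Type} [SAlg S A] {μ : Set (A × A)}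

/-- Pairs of `θ` that are indistinguishable by equations between twins. -/
def SynD (S : Signature) {A : Type} [SAlg S A] (θ : Set (A × A)) : Set ((A × A) × (A × A)) :=
  {p | p.1 ∈ θ ∧ p.2 ∈ θ ∧ ∀ g h, Twin S θ g h → (g p.1.1 = h p.1.2 ↔ g p.2.1 = h p.2.2)}

theorem synD_isConOn (hμ : IsCongruence S μ) : IsConOn S μ (SynD S μ) := by
  classical
  refine ⟨fun p hp => ⟨hp.1, hp.2.1⟩, ?_, fun p hp => ⟨hp, hp, fun _ _ _ => Iff.rfl⟩,
    fun p q h => ⟨h.2.1, h.1, fun g k H => (h.2.2 g k H).symm⟩,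
    fun p q r h h' => ⟨h.1, h'.2.1, fun g k H => (h.2.2 g k H).trans (h'.2.2 g k H)⟩⟩
  intro o x hx
  refine ⟨hμ.1 o _ fun i => (hx i).1, hμ.1 o _ fun i => (hx i).2.1, fun g h H => ?_⟩
  let X : Fin (S.arity o) → ↥μ := fun i => ⟨(x i).1, (hx i).1⟩
  let Y : Fin (S.arity o) → ↥μ := fun i => ⟨(x i).2, (hx i).2.1⟩
  refine hybrid (fun z : Fin (S.arity o) → ↥μ =>
    g (SAlg.interp o fun i => (X i).1.1) = h (SAlg.interp o fun i => (X i).1.2) ↔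
    g (SAlg.interp o fun i => (z i).1.1) = h (SAlg.interp o fun i => (z i).1.2)) X Y ?_ Iff.rfl
  intro j z hz
  refine hz.trans ?_
  have hT : Twin S μ
      (fun w => SAlg.interp o (Function.update (fun i => (z i).1.1) j w))
      (fun w => SAlg.interp o (Function.update (fun i => (z i).1.2) j w)) := by
    refine .op o (fun i w => Function.update (fun i => (z i).1.1) j w i)
      (fun i w => Function.update (fun i => (z i).1.2) j w i) fun i => ?_
    by_cases hi : i = j
    · subst hi; simpa using Twin.id
    · simpa [Function.update, hi] using Twin.const (z i).2
  have key := (hx j).2.2 _ _ (H.comp hT)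
  have e1 : ∀ w : ↥μ, (fun i => (Function.update z j w i).1.1)
      = Function.update (fun i => (z i).1.1) j w.1.1 := by
    intro w; funext i
    by_cases hi : i = j
    · subst hi; simp
    · simp [Function.update, hi]
  have e2 : ∀ w : ↥μ, (fun i => (Function.update z j w i).1.2)
      = Function.update (fun i => (z i).1.2) j w.1.2 := by
    intro w; funext i
    by_cases hi : i = j
    · subst hi; simp
    · simp [Function.update, hi]
  rw [e1, e1, e2, e2]
  exact key

theorem deltaCon_subset {α : Set (A × A)} {Δ : Set ((A × A) × (A × A))} (h : IsConOn S μ Δ)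
    (hα : ∀ a b, (a, b) ∈ α → ((a, a), (b, b)) ∈ Δ) : DeltaCon S μ α ⊆ Δ :=
  Set.sInter_subset_of_mem ⟨h, hα⟩

theorem deltaCon_subset_synD (hμ : IsCongruence S μ) :
    DeltaCon S μ (Zrel S μ) ⊆ SynD S μ :=
  deltaCon_subset (synD_isConOn hμ) fun a b hab => ⟨hμ.refl a, hμ.refl b, fun g h H => hab g h H⟩

theorem deltaCon_isConOn (hμ : IsCongruence S μ) : IsConOn S μ (DeltaCon S μ (Zrel S μ)) := by
  refine ⟨fun p hp => (synD_isConOn hμ).1 (deltaCon_subset_synD hμ hp), ?_, ?_, ?_, ?_⟩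
  · exact fun o x hx Δ hΔ => hΔ.1.2.1 o x fun i => hx i Δ hΔ
  · exact fun p hp Δ hΔ => hΔ.1.2.2.1 p hp
  · exact fun p q h Δ hΔ => hΔ.1.2.2.2.1 p q (h Δ hΔ)
  · exact fun p q r h h' Δ hΔ => hΔ.1.2.2.2.2 p q r (h Δ hΔ) (h' Δ hΔ)

theorem deltaCon_zrel (hμ : IsCongruence S μ) {p q : A × A}
    (h : (p, q) ∈ DeltaCon S μ (Zrel S μ)) :
    (p.1, q.1) ∈ Zrel S μ ∧ (p.2, q.2) ∈ Zrel S μ := by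
  have hZ := zrel_isCongruence (S := S) (θ := μ) hμ.refl
  have := deltaCon_subset (S := S) (μ := μ) (α := Zrel S μ)
    (Δ := {x | x.1 ∈ μ ∧ x.2 ∈ μ ∧ (x.1.1, x.2.1) ∈ Zrel S μ ∧ (x.1.2, x.2.2) ∈ Zrel S μ})
    ⟨fun x hx => ⟨hx.1, hx.2.1⟩, fun o x hx => ⟨hμ.1 o _ fun i => (hx i).1,
      hμ.1 o _ fun i => (hx i).2.1, hZ.1 o _ fun i => (hx i).2.2.1,
      hZ.1 o _ fun i => (hx i).2.2.2⟩, fun p hp => ⟨hp, hp, hZ.refl _, hZ.refl _⟩,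
      fun p q h => ⟨h.2.1, h.1, hZ.symm h.2.2.1, hZ.symm h.2.2.2⟩,
      fun p q r h h' => ⟨h.1, h'.2.1, hZ.trans h.2.2.1 h'.2.2.1, hZ.trans h.2.2.2 h'.2.2.2⟩⟩
    (fun a b hab => ⟨hμ.refl a, hμ.refl b, hab, hab⟩) h
  exact this.2.2

end Delta

/-- The properties of the difference map `A(μ) → D(A)` that determine `D(A)`. -/
structure DModel (S : Signature) {A D : Type} [SAlg S A] [SAlg S D] (μ : Set (A × A))
    (z : A → A → D) : Prop where
  surj : ∀ x, ∃ a b, (a, b) ∈ μ ∧ z a b = x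
  hom : ∀ (o : S.ops) (x y : Fin (S.arity o) → A), (∀ i, (x i, y i) ∈ μ) →
    z (SAlg.interp o x) (SAlg.interp o y) = SAlg.interp o fun i => z (x i) (y i)
  diagEq : ∀ a b, (a, b) ∈ Zrel S μ → z a a = z b b
  eqv : ∀ a b c e, (a, b) ∈ μ → (c, e) ∈ μ → z a b = z c e → (a = b ↔ c = e)
  zrel : ∀ a b c e, (a, b) ∈ μ → (c, e) ∈ μ → z a b = z c e →
    (a, c) ∈ Zrel S μ ∧ (b, e) ∈ Zrel S μ

open Classical in
/-- The difference map of an algebra with an abelian congruence `μ`. -/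
noncomputable def dmap (S : Signature) {A : Type} [SAlg S A] (μ α : Set (A × A))
    (h : ∀ a, (a, a) ∈ μ) (a b : A) : DCar S A μ α :=
  if hab : (a, b) ∈ μ then DCar.mk S A μ α ⟨(a, b), hab⟩ else DCar.mk S A μ α ⟨(a, a), h a⟩

theorem dModel_dmap {A : Type} [SAlg S A] {μ : Set (A × A)} (hμ : IsCongruence S μ) :
    @DModel S A (DCar S A μ (Zrel S μ)) _ (DAlg S A μ (Zrel S μ) hμ.1) μ
      (dmap S μ (Zrel S μ) hμ.refl) := by
  have hΔ := deltaCon_isConOn hμ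
  have hmk : ∀ p q : ↥μ, DCar.mk S A μ (Zrel S μ) p = DCar.mk S A μ (Zrel S μ) q ↔
      (p.1, q.1) ∈ DeltaCon S μ (Zrel S μ) := fun p q =>
    Equivalence.quot_mk_eq_iff (r := fun p q : ↥μ => (p.1, q.1) ∈ DeltaCon S μ (Zrel S μ))
      ⟨fun p => hΔ.2.2.1 _ p.2, fun h => hΔ.2.2.2.1 _ _ h, fun h h' => hΔ.2.2.2.2 _ _ _ h h'⟩ p q
  have hz : ∀ a b (h : (a, b) ∈ μ),
      dmap S μ (Zrel S μ) hμ.refl a b = DCar.mk S A μ (Zrel S μ) ⟨(a, b), h⟩ :=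
    fun a b h => dif_pos h
  have heq : ∀ a b c e, (a, b) ∈ μ → (c, e) ∈ μ →
      dmap S μ (Zrel S μ) hμ.refl a b = dmap S μ (Zrel S μ) hμ.refl c e →
      ((a, b), (c, e)) ∈ DeltaCon S μ (Zrel S μ) := by
    intro a b c e h h' H
    rw [hz _ _ h, hz _ _ h', hmk] at H
    exact H
  let _ := DAlg S A μ (Zrel S μ) hμ.1
  refine ⟨fun x => ?_, fun o x y hxy => ?_, fun a b hab => ?_, fun a b c e h h' H => ?_,
    fun a b c e h h' H => deltaCon_zrel hμ (heq a b c e h h' H)⟩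
  · obtain ⟨p, rfl⟩ := Quot.exists_rep x
    exact ⟨p.1.1, p.1.2, p.2, hz _ _ p.2⟩
  · rw [hz _ _ (hμ.1 o (fun i => (x i, y i)) hxy)]
    refine (hmk _ _).2 ?_
    refine hΔ.2.1 o (fun i => ((x i, y i), (Classical.choose (Quot.exists_rep
      (dmap S μ (Zrel S μ) hμ.refl (x i) (y i)))).1)) fun i => ?_
    refine (hmk ⟨(x i, y i), hxy i⟩ _).1 ?_
    rw [← hz _ _ (hxy i)]
    exact (Classical.choose_spec (Quot.exists_rep
      (dmap S μ (Zrel S μ) hμ.refl (x i) (y i)))).symm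
  · rw [hz _ _ (hμ.refl a), hz _ _ (hμ.refl b), hmk]
    exact fun Δ hΔ' => hΔ'.2 a b hab
  · exact (deltaCon_subset_synD hμ (heq a b c e h h' H)).2.2 _ _ .id

/-- `d` is a Maltsev operation on the blocks of `θ`. -/
def MaltsevOn {A : Type} [SAlg S A] (d : STerm S 3) (θ : Set (A × A)) : Prop :=
  ∀ a b : A, (a, b) ∈ θ → d.tri a b b = a ∧ d.tri a a b = b

namespace DModel
variable {A D : Type} [SAlg S A] [SAlg S D] {μ : Set (A × A)} {z : A → A → D}

theorem eval (hD : DModel S μ z) (hμ : IsCongruence S μ) {n : ℕ} (t : STerm S n) (x y : Fin n → A)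
    (hxy : ∀ i, (x i, y i) ∈ μ) :
    (t.eval x, t.eval y) ∈ μ ∧ z (t.eval x) (t.eval y) = t.eval fun i => z (x i) (y i) := by
  induction t with
  | var i => exact ⟨hxy i, rfl⟩
  | app o ts ih =>
    refine ⟨hμ.1 o _ fun i => (ih i).1, ?_⟩
    simp only [STerm.eval]
    rw [hD.hom o _ _ fun i => (ih i).1]
    simp only [ih]

theorem tri (hD : DModel S μ z) (hμ : IsCongruence S μ) (d : STerm S 3) {a b c a' b' c' : A}
    (ha : (a, a') ∈ μ) (hb : (b, b') ∈ μ) (hc : (c, c') ∈ μ) :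
    z (d.tri a b c) (d.tri a' b' c') = d.tri (z a a') (z b b') (z c c') := by
  have := (hD.eval hμ d ![a, b, c] ![a', b', c'] (fun i => by fin_cases i <;> assumption)).2
  unfold STerm.tri
  rw [this]
  congr 1
  funext i; fin_cases i <;> rfl

theorem finite [Finite A] (hD : DModel S μ z) : Finite D :=
  Finite.of_surjective (fun p : A × A => z p.1 p.2) fun x => by
    obtain ⟨a, b, -, h⟩ := hD.surj x
    exact ⟨(a, b), h⟩

theorem taylorOn (hD : DModel S μ z) (hμ : IsCongruence S μ) {n : ℕ} {t : STerm S n}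
    {u v : Fin n → Fin n → Fin 2} (ht : TaylorOn S A t u v) : TaylorOn S D t u v := by
  refine ⟨fun x => ?_, fun i x y => ?_⟩
  · obtain ⟨a, b, h, rfl⟩ := hD.surj x
    rw [← (hD.eval hμ t (fun _ => a) (fun _ => b) fun _ => h).2, ht.1, ht.1]
  · obtain ⟨a, b, h, rfl⟩ := hD.surj x
    obtain ⟨a', b', h', rfl⟩ := hD.surj y
    have key : ∀ w : Fin n → Fin 2, (t.eval fun j => if w j = 0 then z a b else z a' b')
        = z (t.eval fun j => if w j = 0 then a else a') (t.eval fun j => if w j = 0 then b else b')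
        := by
      intro w
      rw [(hD.eval hμ t (fun j => if w j = 0 then a else a') (fun j => if w j = 0 then b else b')
        fun j => by split <;> assumption).2]
      congr 1
      funext j
      split <;> rfl
    rw [key, key, ht.2, ht.2]

/-- The relation on `D(A)` of having the same base point up to the centralizer. -/
def phi (S : Signature) {A D : Type} [SAlg S A] (μ : Set (A × A)) (z : A → A → D) : Set (D × D) :=
  {p | ∃ a b c e, (a, b) ∈ μ ∧ (c, e) ∈ μ ∧ (b, e) ∈ Zrel S μ ∧ p = (z a b, z c e)}

theorem phi_iff (hD : DModel S μ z) (hμ : IsCongruence S μ) {a b c e : A} (h : (a, b) ∈ μ)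
    (h' : (c, e) ∈ μ) : (z a b, z c e) ∈ phi S μ z ↔ (b, e) ∈ Zrel S μ := by
  have hZ := zrel_isCongruence (S := S) hμ.refl
  constructor
  · rintro ⟨a', b', c', e', h1, h2, h3, h4⟩
    obtain ⟨h4, h5⟩ := Prod.mk.inj h4
    exact hZ.trans (hD.zrel _ _ _ _ h h1 h4).2 (hZ.trans h3 (hZ.symm (hD.zrel _ _ _ _ h' h2 h5).2))
  · exact fun h3 => ⟨a, b, c, e, h, h', h3, rfl⟩

theorem phi_isCongruence (hD : DModel S μ z) (hμ : IsCongruence S μ) :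
    IsCongruence S (phi S μ z) := by
  have hZ := zrel_isCongruence (S := S) hμ.refl
  refine ⟨fun o x hx => ?_, fun x => ?_, ?_, ?_⟩
  · choose a b c e h1 h2 h3 h4 using hx
    refine ⟨_, _, _, _, hμ.1 o _ h1, hμ.1 o _ h2, hZ.1 o _ h3, ?_⟩
    rw [hD.hom o _ _ h1, hD.hom o _ _ h2, funext h4]
    rfl
  · obtain ⟨a, b, h, rfl⟩ := hD.surj x
    exact (hD.phi_iff hμ h h).2 (hZ.refl _)
  · rintro _ _ ⟨a, b, c, e, h1, h2, h3, h4⟩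
    obtain ⟨rfl, rfl⟩ := Prod.mk.inj h4
    exact (hD.phi_iff hμ h2 h1).2 (hZ.symm h3)
  · rintro x y w hxy hyw
    obtain ⟨a, b, h, rfl⟩ := hD.surj x
    obtain ⟨a', b', h', rfl⟩ := hD.surj y
    obtain ⟨a'', b'', h'', rfl⟩ := hD.surj w
    rw [hD.phi_iff hμ (by assumption) (by assumption)] at *
    exact hZ.trans hxy hyw

variable {d : STerm S 3}

theorem diag_of_mem (hD : DModel S μ z) (hab : μ ⊆ Zrel S μ) {a b : A} (h : (a, b) ∈ μ) :
    z a a = z b b := hD.diagEq a b (hab h)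

/-- Concatenation of differences. -/
theorem vtrans (hD : DModel S μ z) (hμ : IsCongruence S μ) (hd : MaltsevOn d μ)
    {y x s y' x' s' : A} (h1 : (y, x) ∈ μ) (h2 : (x, s) ∈ μ) (h1' : (y', x') ∈ μ)
    (h2' : (x', s') ∈ μ) (e1 : z y x = z y' x') (e2 : z x s = z x' s') : z y s = z y' s' := by
  have key : ∀ {y x s : A}, (y, x) ∈ μ → (x, s) ∈ μ → z y s = d.tri (z y x) (z x x) (z x s) := by
    intro y x s h1 h2
    rw [← hD.tri hμ d h1 (hμ.refl x) h2, (hd _ _ h1).1, (hd _ _ h2).2]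
  rw [key h1 h2, key h1' h2', e1, e2, hD.diagEq _ _ (hD.zrel _ _ _ _ h1 h1' e1).2]

theorem twin_diff (hD : DModel S μ z) (hμ : IsCongruence S μ) {g h : A → A}
    (H : Twin S (Zrel S μ) g h) {x y : A} (hxy : (y, x) ∈ μ) :
    (g y, g x) ∈ μ ∧ (h y, h x) ∈ μ ∧ z (g y) (g x) = z (h y) (h x) := by
  induction H with
  | id => exact ⟨hxy, hxy, rfl⟩
  | const hc => exact ⟨hμ.refl _, hμ.refl _, hD.diagEq _ _ hc⟩
  | op o g h _ ih =>
    refine ⟨hμ.1 o _ fun i => (ih i).1, hμ.1 o _ fun i => (ih i).2.1, ?_⟩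
    rw [hD.hom o _ _ fun i => (ih i).1, hD.hom o _ _ fun i => (ih i).2.1]
    simp only [ih]

theorem lift_twin (hD : DModel S μ z) (hμ : IsCongruence S μ) (hab : μ ⊆ Zrel S μ) {g h : D → D}
    (H : Twin S (phi S μ z) g h) : ∃ g1 g2 h1 h2 : A → A, Twin S (Zrel S μ) g1 h1 ∧
      ∀ a b, (a, b) ∈ μ → (g1 a, g2 b) ∈ μ ∧ (h1 a, h2 b) ∈ μ ∧ g (z a b) = z (g1 a) (g2 b) ∧
        h (z a b) = z (h1 a) (h2 b) := by
  have hZ := zrel_isCongruence (S := S) hμ.refl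
  induction H with
  | id => exact ⟨_, fun b => b, _, fun b => b, .id, fun a b h => ⟨h, h, rfl, rfl⟩⟩
  | const hc =>
    obtain ⟨a, b, c, e, h1, h2, h3, h4⟩ := hc
    obtain ⟨rfl, rfl⟩ := Prod.mk.inj h4
    exact ⟨_, fun _ => b, _, fun _ => e, .const (hZ.trans (hab h1) (hZ.trans h3 (hZ.symm (hab h2)))),
      fun _ _ _ => ⟨h1, h2, rfl, rfl⟩⟩
  | op o g h _ ih =>
    choose g1 g2 h1 h2 ht H using ih
    refine ⟨_, fun b => SAlg.interp o fun i => g2 i b, _, fun b => SAlg.interp o fun i => h2 i b,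
      .op o g1 h1 ht, fun a b hm => ⟨hμ.1 o _ fun i => (H i a b hm).1,
      hμ.1 o _ fun i => (H i a b hm).2.1, ?_, ?_⟩⟩
    · rw [hD.hom o _ _ fun i => (H i a b hm).1]
      simp only [(H _ a b hm).2.2.1]
    · rw [hD.hom o _ _ fun i => (H i a b hm).2.1]
      simp only [(H _ a b hm).2.2.2]

theorem phi_subset_zrel (hD : DModel S μ z) (hμ : IsCongruence S μ) (hab : μ ⊆ Zrel S μ)
    (hd : MaltsevOn d μ) : phi S μ z ⊆ Zrel S (phi S μ z) := by
  have hφ := hD.phi_isCongruence hμ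
  have key : ∀ x y g h, (x, y) ∈ phi S μ z → Twin S (phi S μ z) g h → g x = h x → g y = h y := by
    rintro _ _ g h ⟨x1, x2, y1, y2, hx, hy, hxy, he⟩ H hgh
    obtain ⟨rfl, rfl⟩ := Prod.mk.inj he
    obtain ⟨g1, g2, h1, h2, ht, H⟩ := hD.lift_twin hμ hab H
    have hmove : ∀ a a' b, (a, b) ∈ μ → (a', b) ∈ μ → g (z a b) = h (z a b) →
        g (z a' b) = h (z a' b) := by
      intro a a' b hm hm' e
      have haa : (a', a) ∈ μ := hμ.trans hm' (hμ.symm hm)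
      obtain ⟨p1, p2, p3⟩ := hD.twin_diff hμ ht haa
      rw [(H a b hm).2.2.1, (H a b hm).2.2.2] at e
      rw [(H a' b hm').2.2.1, (H a' b hm').2.2.2]
      exact hD.vtrans hμ hd p1 (H a b hm).1 p2 (H a b hm).2.1 p3 e
    have e1 := hmove _ _ _ hx (hμ.refl x2) hgh
    rw [hD.diagEq _ _ hxy] at e1
    exact hmove _ _ _ (hμ.refl y2) hy e1
  exact fun x hx g h H => ⟨key _ _ g h hx H, key _ _ g h (hφ.symm hx) H⟩

theorem twin_rel (hD : DModel S μ z) (hμ : IsCongruence S μ) {Ψ : Set (D × D)}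
    (hΨ : IsCongruence S Ψ) {g h : A → A} (H : Twin S μ g h) {a b c e : A} (h1 : (a, b) ∈ μ)
    (h2 : (c, e) ∈ μ) (h3 : (z a b, z c e) ∈ Ψ) : (g a, h b) ∈ μ ∧ (g c, h e) ∈ μ ∧
      (z (g a) (h b), z (g c) (h e)) ∈ Ψ := by
  induction H with
  | id => exact ⟨h1, h2, h3⟩
  | const hc => exact ⟨hc, hc, hΨ.refl _⟩
  | op o g h _ ih =>
    refine ⟨hμ.1 o _ fun i => (ih i).1, hμ.1 o _ fun i => (ih i).2.1, ?_⟩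
    rw [hD.hom o _ _ fun i => (ih i).1, hD.hom o _ _ fun i => (ih i).2.1]
    exact hΨ.1 o _ fun i => (ih i).2.2

theorem isMonolith_phi (hD : DModel S μ z) (hM : IsMonolith S μ) (hab : μ ⊆ Zrel S μ)
    (hd : MaltsevOn d μ) {dD : STerm S 3} (hdD : MaltsevOn dD (phi S μ z))
    [Finite D] : IsMonolith S (phi S μ z) := by
  have hμ := hM.1
  have hZ := zrel_isCongruence (S := S) hμ.refl
  have hφ := hD.phi_isCongruence hμ
  have hTC := tc_of_subset_zrel hφ.refl hφ.1 (hD.phi_subset_zrel hμ hab hd)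
  refine ⟨hφ, ?_, fun Ψ hΨ hne => ?_⟩
  · intro he
    apply hM.2.1
    apply Set.Subset.antisymm
    · rintro ⟨p, q⟩ hpq
      have : (z p q, z q q) ∈ phi S μ z := (hD.phi_iff hμ hpq (hμ.refl q)).2 (hZ.refl q)
      rw [he] at this
      exact (hD.eqv _ _ _ _ hpq (hμ.refl q) this).2 rfl
    · rintro ⟨p, q⟩ hpq
      obtain rfl : p = q := hpq
      exact hμ.refl p
  let θ : Set (A × A) := {p | p ∈ μ ∧ (z p.1 p.2, z p.2 p.2) ∈ Ψ}
  have hdd : ∀ x : D, dD.tri x x x = x := fun x => (hdD x x (hφ.refl x)).1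
  have hdz : ∀ b, d.tri (z b b) (z b b) (z b b) = z b b := fun b => by
    rw [← hD.tri hμ d (hμ.refl b) (hμ.refl b) (hμ.refl b), (hd b b (hμ.refl b)).1]
  have htri : ∀ (d : STerm S 3) {x y w x' y' w' : D}, (x, x') ∈ Ψ → (y, y') ∈ Ψ → (w, w') ∈ Ψ →
      (d.tri x y w, d.tri x' y' w') ∈ Ψ := by
    intro d x y w x' y' w' h1 h2 h3
    have := hΨ.1.tri_mem d h1 h2 h3
    rwa [STerm.tri_prod] at this
  have hθ : IsCongruence S θ := by
    refine ⟨fun o x hx => ⟨hμ.1 o _ fun i => (hx i).1, ?_⟩, fun a => ⟨hμ.refl a, hΨ.refl _⟩, ?_, ?_⟩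
    · have := hΨ.1 o _ fun i => (hx i).2
      change (z (SAlg.interp o fun i => (x i).1) (SAlg.interp o fun i => (x i).2),
        z (SAlg.interp o fun i => (x i).2) (SAlg.interp o fun i => (x i).2)) ∈ Ψ
      rw [hD.hom o _ _ fun i => (hx i).1, hD.hom o _ _ fun i => hμ.refl _]
      exact this
    · rintro a b ⟨h1, h2⟩
      refine ⟨hμ.symm h1, ?_⟩
      have e : z b a = d.tri (z a a) (z a b) (z b b) := by
        rw [← hD.tri hμ d (hμ.refl a) h1 (hμ.refl b), (hd _ _ h1).1, (hd _ _ h1).2]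
      have := htri d (hΨ.refl (z a a)) h2 (hΨ.refl (z b b))
      rw [← e, ← hD.diag_of_mem hab h1, hdz] at this
      exact this
    · rintro a b c ⟨h1, h2⟩ ⟨h3, h4⟩
      refine ⟨hμ.trans h1 h3, ?_⟩
      have e : z a c = d.tri (z a b) (z b b) (z b c) := by
        rw [← hD.tri hμ d h1 (hμ.refl b) h3, (hd _ _ h1).1, (hd _ _ h3).2]
      have := htri d h2 (hΨ.refl (z b b)) h4
      rw [← e, hD.diag_of_mem hab h3, hdz] at this
      exact this
  have hsuff : ∀ p q, p ≠ q → (p, q) ∈ θ → phi S μ z ⊆ Ψ := by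
    rintro p q hpq hmem _ ⟨a, b, c, e, h1, h2, h3, rfl⟩
    have hμθ : μ ⊆ θ := hM.2.2 θ hθ fun he => hpq (by rw [he] at hmem; exact hmem)
    have := hΨ.trans (hμθ h1).2 ((hD.diagEq _ _ h3) ▸ hΨ.symm (hμθ h2).2)
    exact this
  have hcase2 : ∀ a b c e g h, (a, b) ∈ μ → (c, e) ∈ μ → (z a b, z c e) ∈ Ψ → Twin S μ g h →
      g a = h a → g c ≠ h c → phi S μ z ⊆ Ψ := by
    intro a b c e g h h1 h2 h3 H e1 hne
    refine hsuff (g c) (h c) hne ?_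
    have k1 := hD.twin_rel hμ hΨ H h1 h2 h3
    have k2 := hD.twin_rel hμ hΨ (H.right hμ.refl) h1 h2 h3
    have hgh : ∀ c, (g c, h c) ∈ μ := fun c => H.pair_mem hμ.1 subset_rfl (hμ.refl c)
    have hhh : (h c, h e) ∈ μ := (H.right hμ.refl).pair_mem hμ.1 subset_rfl h2
    refine ⟨hgh c, ?_⟩
    have k3 : (z (g c) (h e), z (h c) (h e)) ∈ Ψ := by
      refine hΨ.trans (hΨ.symm k1.2.2) ?_
      rw [e1]
      exact k2.2.2
    have := htri d k3 (hΨ.refl (z (h c) (h e))) (hΨ.refl (z (h c) (h c)))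
    rw [← hD.tri hμ d k1.2.1 hhh (hμ.refl _), ← hD.tri hμ d hhh hhh (hμ.refl _),
      (hd _ _ (hgh c)).1, (hd _ _ (hμ.symm hhh)).2, (hd _ _ (hμ.refl (h c))).1] at this
    exact this
  obtain ⟨x, y, hxy, hne'⟩ : ∃ x y, (x, y) ∈ Ψ ∧ x ≠ y := by
    by_contra! hcon
    apply hne
    apply Set.Subset.antisymm
    · exact fun p hp => hcon _ _ hp
    · rintro ⟨p, q⟩ hpq
      obtain rfl : p = q := hpq
      exact hΨ.refl p
  obtain ⟨a, b, h1, rfl⟩ := hD.surj x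
  obtain ⟨c, e, h2, rfl⟩ := hD.surj y
  by_cases hα : (a, c) ∈ Zrel S μ
  · have hbe : (b, e) ∈ Zrel S μ := hZ.trans (hZ.symm (hab h1)) (hZ.trans hα (hab h2))
    have f1 : (z a b, z c e) ∈ phi S μ z := (hD.phi_iff hμ h1 h2).2 hbe
    have f2 : (z c e, z e e) ∈ phi S μ z := (hD.phi_iff hμ h2 (hμ.refl e)).2 (hZ.refl e)
    obtain ⟨p, q, h3, hw⟩ := hD.surj (dD.tri (z a b) (z c e) (z e e))
    have hwφ : (z p q, z e e) ∈ phi S μ z := by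
      rw [hw]
      have := hφ.1.tri_mem dD f1 (hφ.refl (z c e)) (hφ.refl (z e e))
      rw [STerm.tri_prod] at this
      simp only at this
      rwa [(hdD _ _ f2).2] at this
    have hqe := (hD.phi_iff hμ h3 (hμ.refl e)).1 hwφ
    refine hsuff p q ?_ ⟨h3, ?_⟩
    · rintro rfl
      rw [hD.diagEq _ _ hqe] at hw
      apply hne'
      have hM' : Mat S (phi S μ z) (phi S μ z) (dD.tri (z a b) (z c e) (z e e))
          (dD.tri (z c e) (z c e) (z e e)) (dD.tri (z a b) (z c e) (z c e))
          (dD.tri (z c e) (z c e) (z c e)) := by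
        refine Mat.eval dD fun i => ?_
        fin_cases i
        · exact .col f1
        · exact .row (hφ.refl _)
        · exact .row (hφ.symm f2)
      have := hTC _ _ _ _ hM' (by rw [← hw, (hdD _ _ f2).2])
      rwa [(hdD _ _ f1).1, hdd] at this
    · rw [hw, hD.diagEq _ _ hqe]
      have := htri dD hxy (hΨ.refl (z c e)) (hΨ.refl (z e e))
      rwa [(hdD _ _ f2).2] at this
  · obtain ⟨g, h, H, hgh⟩ : ∃ g h, Twin S μ g h ∧ ¬ (g a = h a ↔ g c = h c) := by
      by_contra! hcon
      exact hα fun g h H => hcon g h H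
    by_cases e1 : g a = h a
    · exact hcase2 a b c e g h h1 h2 hxy H e1 fun e2 => hgh ⟨fun _ => e2, fun _ => e1⟩
    · refine hcase2 c e a b g h h2 h1 (hΨ.symm hxy) H ?_ e1
      by_contra e2
      exact hgh ⟨fun h => absurd h e1, fun h => absurd h e2⟩

end DModel

/-! ### From similarity to bridges -/

section Monolith
variable {A B : Type} [SAlg S A] [SAlg S B]

theorem IsMonolith.unique {μ ν : Set (A × A)} (h : IsMonolith S μ) (h' : IsMonolith S ν) : μ = ν :=
  Set.Subset.antisymm (h.2.2 _ h'.1 h'.2.1) (h'.2.2 _ h.1 h.2.1)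

theorem IsCongruence.diag_subset {θ : Set (A × A)} (h : IsCongruence S θ) : diag A ⊆ θ := by
  rintro ⟨a, b⟩ (rfl : a = b)
  exact h.refl a

theorem IsMonolith.diag_ssubset {μ : Set (A × A)} (h : IsMonolith S μ) : diag A ⊂ μ :=
  h.1.diag_subset.ssubset_of_ne h.2.1.symm

theorem IsCongruence.eq_diag {θ : Set (A × A)} (h : IsCongruence S θ)
    (H : ∀ a b, (a, b) ∈ θ → a = b) : θ = diag A :=
  Set.Subset.antisymm (fun x hx => H x.1 x.2 hx) h.diag_subset

theorem IsCongruence.exists_ne {θ : Set (A × A)} (h : IsCongruence S θ) (hne : θ ≠ diag A) :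
    ∃ a b, (a, b) ∈ θ ∧ a ≠ b := by
  by_contra! hcon
  exact hne (h.eq_diag hcon)

/-- A congruence pulled back along a homomorphism. -/
theorem IsHom.comap_isCongruence {f : A → B} (hf : IsHom S f) {θ : Set (B × B)}
    (hθ : IsCongruence S θ) : IsCongruence S {p : A × A | (f p.1, f p.2) ∈ θ} := by
  refine ⟨fun o x hx => ?_, fun a => hθ.refl _, fun h => hθ.symm h, fun h h' => hθ.trans h h'⟩
  have := hθ.1 o _ hx
  change (f (SAlg.interp o fun i => (x i).1), f (SAlg.interp o fun i => (x i).2)) ∈ θ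
  rw [hf o, hf o]
  exact this

theorem IsMonolith.map_equiv {f : A ≃ B} (hf : IsHom S f) {μ : Set (A × A)} (h : IsMonolith S μ) :
    IsMonolith S {p : B × B | (f.symm p.1, f.symm p.2) ∈ μ} := by
  refine ⟨hf.symm.comap_isCongruence h.1, ?_, fun θ hθ hne => ?_⟩
  · intro he
    obtain ⟨a, b, hab, hne⟩ := h.1.exists_ne h.2.1
    have : (f a, f b) ∈ {p : B × B | (f.symm p.1, f.symm p.2) ∈ μ} := by simpa using hab
    rw [he] at this
    exact hne (f.injective this)
  · have := h.2.2 _ (hf.comap_isCongruence hθ) fun he => ?_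
    · rintro ⟨x, y⟩ hxy
      simpa using this hxy
    · obtain ⟨a, b, hab, hne'⟩ := hθ.exists_ne hne
      have hm : (f.symm a, f.symm b) ∈ {p : A × A | (f p.1, f p.2) ∈ θ} := by simpa using hab
      rw [he] at hm
      exact hne' (f.symm.injective hm)

theorem Mat.tri (d : STerm S 3) {φ θ : Set (A × A)} {p q r s p' q' r' s' p'' q'' r'' s'' : A}
    (h : Mat S φ θ p q r s) (h' : Mat S φ θ p' q' r' s') (h'' : Mat S φ θ p'' q'' r'' s'') :
    Mat S φ θ (d.tri p p' p'') (d.tri q q' q'') (d.tri r r' r'') (d.tri s s' s'') := by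
  have := Mat.subuniverse.tri_mem d (x := (p, q, r, s)) (y := (p', q', r', s'))
    (z := (p'', q'', r'', s'')) h h' h''
  simp only [STerm.tri_prod] at this
  exact this

theorem isBridgeLR_diag {μ : Set (A × A)} {κ : Set (B × B)} (hμ : diag A ⊂ μ) (hκ : diag B ⊂ κ)
    {T : Set (A × A × B × B)} (hT : IsSubuniverse S T) (h1 : pr12 T = μ) (h2 : pr34 T = κ)
    (h3 : ∀ a₁ a₂ b₁ b₂, (a₁, a₂, b₁, b₂) ∈ T → (a₁ = a₂ ↔ b₁ = b₂)) :
    IsBridgeLR S (diag A) (diag B) μ κ T := by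
  refine ⟨⟨hT, ?_, ?_, h1 ▸ hμ, h2 ▸ hκ, h3⟩, h1, h2⟩
  · rintro a₁ a₂ b₁ b₂ _ _ h (rfl : a₁ = _) (rfl : a₂ = _)
    exact h
  · rintro a₁ a₂ b₁ b₂ _ _ h (rfl : b₁ = _) (rfl : b₂ = _)
    exact h

theorem exists_bridge_of_iso {μ : Set (A × A)} {κ : Set (B × B)} (hμ : IsMonolith S μ)
    (hκ : IsMonolith S κ) {f : A ≃ B} (hf : IsHom S f) :
    ∃ T, IsBridgeLR S (diag A) (diag B) μ κ T ∧ ∀ a₁ a₂ b₁ b₂, (a₁, a₂, b₁, b₂) ∈ T →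
      (a₁, b₁) ∈ btr T ∧ (a₂, b₂) ∈ btr T := by
  obtain rfl := hκ.unique (hμ.map_equiv hf)
  refine ⟨{p | (p.1, p.2.1) ∈ μ ∧ p.2.2 = (f p.1, f p.2.1)},
    isBridgeLR_diag hμ.diag_ssubset hκ.diag_ssubset ?_ ?_ ?_ ?_, ?_⟩
  · intro o x hx
    refine ⟨hμ.1.1 o _ fun i => (hx i).1, ?_⟩
    have : ∀ i, (x i).2.2 = _ := fun i => (hx i).2
    change (SAlg.interp o fun i => (x i).2.2) = (f (SAlg.interp o fun i => (x i).1),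
      f (SAlg.interp o fun i => (x i).2.1))
    rw [hf o, hf o, funext this]
    rfl
  · ext ⟨a, b⟩
    exact ⟨fun ⟨_, _, h, _⟩ => h, fun h => ⟨f a, f b, h, rfl⟩⟩
  · ext ⟨x, y⟩
    constructor
    · rintro ⟨a, b, h, h'⟩
      change (x, y) = (f a, f b) at h'
      obtain ⟨rfl, rfl⟩ := Prod.mk.inj h'
      simpa using h
    · intro h
      exact ⟨f.symm x, f.symm y, h, by simp⟩
  · rintro a₁ a₂ b₁ b₂ ⟨-, h⟩
    change (b₁, b₂) = (f a₁, f a₂) at h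
    obtain ⟨rfl, rfl⟩ := Prod.mk.inj h
    exact f.injective.eq_iff.symm
  · rintro a₁ a₂ b₁ b₂ ⟨-, h⟩
    change (b₁, b₂) = (f a₁, f a₂) at h
    obtain ⟨rfl, rfl⟩ := Prod.mk.inj h
    exact ⟨⟨hμ.1.refl _, rfl⟩, ⟨hμ.1.refl _, rfl⟩⟩

theorem DModel.map_equiv {D E : Type} [SAlg S D] [SAlg S E] {μ : Set (A × A)} {z : A → A → D}
    (hD : DModel S μ z) {f : D ≃ E} (hf : IsHom S f) : DModel S μ fun a b => f (z a b) := by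
  refine ⟨fun x => ?_, fun o x y h => ?_, fun a b h => by rw [hD.diagEq _ _ h],
    fun a b c e h h' H => hD.eqv _ _ _ _ h h' (f.injective H),
    fun a b c e h h' H => hD.zrel _ _ _ _ h h' (f.injective H)⟩
  · obtain ⟨a, b, h, h'⟩ := hD.surj (f.symm x)
    exact ⟨a, b, h, by simp [h']⟩
  · rw [hD.hom o _ _ h, hf o]

open DModel (phi)

section Shared
variable {D : Type} [SAlg S D] {μ : Set (A × A)} {κ : Set (B × B)} {z : A → A → D} {z' : B → B → D}

/-- The bridge between two algebras with a common difference algebra. -/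
def diffBridge (S : Signature) {A B D : Type} [SAlg S D] (μ : Set (A × A)) (κ : Set (B × B))
    (z : A → A → D) (z' : B → B → D) (φ : Set (D × D)) : Set (A × A × B × B) :=
  {p | (p.1, p.2.1) ∈ μ ∧ (p.2.2.1, p.2.2.2) ∈ κ ∧
    Mat S φ φ (z p.2.1 p.2.1) (z' p.2.2.2 p.2.2.2) (z p.1 p.2.1) (z' p.2.2.1 p.2.2.2)}

theorem exists_diffBridge (hD : DModel S μ z) (hE : DModel S κ z') (hμ : IsCongruence S μ)
    (hκ : IsCongruence S κ) (hφ : phi S μ z = phi S κ z') {d : STerm S 3}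
    (hd : MaltsevOn d (phi S μ z)) {a₁ a₂ : A} (h : (a₁, a₂) ∈ μ) :
    ∃ b₁ b₂, (a₁, a₂, b₁, b₂) ∈ diffBridge S μ κ z z' (phi S μ z) := by
  have hF := hD.phi_isCongruence hμ
  have hZA := zrel_isCongruence (S := S) hμ.refl
  have hZB := zrel_isCongruence (S := S) hκ.refl
  have hrp : (z a₂ a₂, z a₁ a₂) ∈ phi S μ z := (hD.phi_iff hμ (hμ.refl _) h).2 (hZA.refl _)
  obtain ⟨e₁, e₂, he, hep⟩ := hE.surj (z a₂ a₂)
  have hpq : (z a₂ a₂, z' e₂ e₂) ∈ phi S μ z := by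
    rw [hφ, ← hep, hE.phi_iff hκ he (hκ.refl _)]
    exact hZB.refl _
  have hM : Mat S (phi S μ z) (phi S μ z) (z a₂ a₂) (z' e₂ e₂) (z a₁ a₂)
      (d.tri (z a₁ a₂) (z a₂ a₂) (z' e₂ e₂)) := by
    have := (Mat.row (S := S) (θ := phi S μ z) hrp).tri d (.row (hF.refl (z a₂ a₂))) (.col hpq)
    simpa [(hd _ _ (hF.refl (z a₂ a₂))).1, (hd _ _ hpq).2, (hd _ _ (hF.symm hrp)).1] using this
  obtain ⟨c₁, c₂, hc, hcs⟩ := hE.surj (d.tri (z a₁ a₂) (z a₂ a₂) (z' e₂ e₂))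
  have hqs := (hM.row_mem hF.1 hF.refl subset_rfl).2
  have hce : (z' e₂ e₂, z' c₁ c₂) ∈ phi S κ z' := by
    rw [← hφ, hcs]
    exact hF.trans (hF.symm hpq) (hF.trans hrp hqs)
  have hec := (hE.phi_iff hκ (hκ.refl _) hc).1 hce
  refine ⟨c₁, c₂, h, hc, ?_⟩
  change Mat S _ _ (z a₂ a₂) (z' c₂ c₂) (z a₁ a₂) (z' c₁ c₂)
  rw [hcs, ← hE.diagEq _ _ hec]
  exact hM

theorem exists_bridge_of_shared (hD : DModel S μ z) (hE : DModel S κ z') (hμ : IsMonolith S μ)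
    (hκ : IsMonolith S κ) (hab : μ ⊆ Zrel S μ) (hab' : κ ⊆ Zrel S κ)
    (hφ : phi S μ z = phi S κ z') {d : STerm S 3} (hd : MaltsevOn d (phi S μ z))
    (hTC : TC S (phi S μ z) (phi S μ z)) :
    ∃ T, IsBridgeLR S (diag A) (diag B) μ κ T ∧ ∀ a₁ a₂ b₁ b₂, (a₁, a₂, b₁, b₂) ∈ T →
      (a₁, b₁) ∈ btr T ∧ (a₂, b₂) ∈ btr T := by
  have hF := hD.phi_isCongruence hμ.1
  refine ⟨diffBridge S μ κ z z' (phi S μ z), isBridgeLR_diag hμ.diag_ssubset hκ.diag_ssubset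
    ?_ ?_ ?_ ?_, ?_⟩
  · intro o x hx
    refine ⟨hμ.1.1 o _ fun i => (hx i).1, hκ.1.1 o _ fun i => (hx i).2.1, ?_⟩
    have := Mat.op o _ _ _ _ fun i => (hx i).2.2
    rw [← hD.hom o _ _ fun i => hμ.1.refl _, ← hE.hom o _ _ fun i => hκ.1.refl _,
      ← hD.hom o _ _ fun i => (hx i).1, ← hE.hom o _ _ fun i => (hx i).2.1] at this
    exact this
  · ext ⟨a, b⟩
    refine ⟨fun ⟨_, _, h⟩ => h.1, fun h => ?_⟩
    obtain ⟨b₁, b₂, h'⟩ := exists_diffBridge hD hE hμ.1 hκ.1 hφ hd h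
    exact ⟨b₁, b₂, h'⟩
  · ext ⟨a, b⟩
    refine ⟨fun ⟨_, _, h⟩ => h.2.1, fun h => ?_⟩
    obtain ⟨b₁, b₂, h1, h2, h3⟩ := exists_diffBridge hE hD hκ.1 hμ.1 hφ.symm (hφ ▸ hd) h
    refine ⟨b₁, b₂, h2, h1, ?_⟩
    rw [hφ]
    exact h3.swapCols fun _ _ h => (hE.phi_isCongruence hκ.1).symm h
  · rintro a₁ a₂ b₁ b₂ ⟨h1, h2, h3⟩
    change Mat S _ _ (z a₂ a₂) (z' b₂ b₂) (z a₁ a₂) (z' b₁ b₂) at h3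
    constructor
    · rintro rfl
      exact (hE.eqv _ _ _ _ (hκ.1.refl _) h2 (hTC _ _ _ _ h3.transpose rfl)).1 rfl
    · rintro rfl
      exact (hD.eqv _ _ _ _ (hμ.1.refl _) h1
        (hTC _ _ _ _ (h3.swapCols fun _ _ h => hF.symm h).transpose rfl)).1 rfl
  · rintro a₁ a₂ b₁ b₂ ⟨h1, h2, h3⟩
    change Mat S _ _ (z a₂ a₂) (z' b₂ b₂) (z a₁ a₂) (z' b₁ b₂) at h3
    have h4 := (h3.row_mem hF.1 hF.refl subset_rfl).1
    have key : ∀ a b, (z a a, z' b b) ∈ phi S μ z →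
        (a, b) ∈ btr (diffBridge S μ κ z z' (phi S μ z)) :=
      fun a b h => ⟨hμ.1.refl a, hκ.1.refl b, .col h⟩
    exact ⟨key _ _ (by rwa [hD.diag_of_mem hab h1, hE.diag_of_mem hab' h2]), key _ _ h4⟩

end Shared

theorem TC.of_subset_zrel [Finite A] {μ : Set (A × A)} (hμ : IsCongruence S μ)
    (hab : μ ⊆ Zrel S μ) : TC S μ μ := tc_of_subset_zrel hμ.refl hμ.1 hab

theorem exists_maltsevOn [Finite A] {n : ℕ} {t : STerm S n} {u v : Fin n → Fin n → Fin 2}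
    (huv : ∀ i, u i i ≠ v i i) (ht : TaylorOn S A t u v) {μ : Set (A × A)}
    (hμ : IsCongruence S μ) (hab : μ ⊆ Zrel S μ) : ∃ d : STerm S 3, MaltsevOn d μ :=
  exists_maltsev huv ht hμ (.of_subset_zrel hμ hab)

/-- A difference map on a Taylor algebra: its kernel `phi` is the abelian monolith. -/
theorem DModel.exists_maltsevOn_phi [Finite A] {D : Type} [SAlg S D] {μ : Set (A × A)}
    {z : A → A → D} (hD : DModel S μ z) {n : ℕ} {t : STerm S n} {u v : Fin n → Fin n → Fin 2}
    (huv : ∀ i, u i i ≠ v i i) (ht : TaylorOn S A t u v) (hμ : IsMonolith S μ)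
    (hab : μ ⊆ Zrel S μ) : (∃ d : STerm S 3, MaltsevOn d (phi S μ z)) ∧
      IsMonolith S (phi S μ z) ∧ phi S μ z ⊆ Zrel S (phi S μ z) := by
  have := hD.finite
  obtain ⟨d, hd⟩ := exists_maltsevOn huv ht hμ.1 hab
  have h1 := hD.phi_subset_zrel hμ.1 hab hd
  obtain ⟨d', hd'⟩ := exists_maltsevOn huv (hD.taylorOn hμ.1 ht) (hD.phi_isCongruence hμ.1) h1
  exact ⟨⟨d', hd'⟩, hD.isMonolith_phi hμ hab hd hd', h1⟩

theorem exists_bridge_of_similar [Finite A] [Finite B] {n : ℕ} {t : STerm S n}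
    {u v : Fin n → Fin n → Fin 2} (huv : ∀ i, u i i ≠ v i i) (htA : TaylorOn S A t u v)
    (htB : TaylorOn S B t u v) (h : SimilarI S (inferInstance : SAlg S A)
      (inferInstance : SAlg S B)) :
    ∃ (μ : Set (A × A)) (κ : Set (B × B)) (T : Set (A × A × B × B)), IsMonolith S μ ∧
      IsMonolith S κ ∧ IsBridgeLR S (diag A) (diag B) μ κ T ∧
      ∀ a₁ a₂ b₁ b₂, (a₁, a₂, b₁, b₂) ∈ T → (a₁, b₁) ∈ btr T ∧ (a₂, b₂) ∈ btr T := by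
  obtain ⟨μ, κ, hμ, hκ, h1, h2, h3, h4⟩ := h
  have hsA := fun a b (h : (a, b) ∈ μ) => hμ.1.symm h
  have hsB := fun a b (h : (a, b) ∈ κ) => hκ.1.symm h
  rw [centralizes_iff hsA, centralizes_iff hsB,
    centralizer_eq (S := S) hμ.1.refl] at *
  rw [centralizer_eq (S := S) hκ.1.refl] at h1 h3
  refine ⟨μ, κ, ?_⟩
  by_cases ha : μ ⊆ Zrel S μ <;> by_cases hb : κ ⊆ Zrel S κ
  · obtain ⟨f, hf⟩ := h1 ⟨ha, hb⟩
    let _ := DAlg S A μ (Zrel S μ) hμ.1.1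
    let _ := DAlg S B κ (Zrel S κ) hκ.1.1
    have hD := (dModel_dmap hμ.1).map_equiv hf
    have hE := dModel_dmap hκ.1
    obtain ⟨⟨d, hd⟩, hm, hz⟩ := hD.exists_maltsevOn_phi huv htA hμ ha
    obtain ⟨-, hm', -⟩ := hE.exists_maltsevOn_phi huv htB hκ hb
    have := hD.finite
    obtain ⟨T, hT⟩ := exists_bridge_of_shared hD hE hμ hκ ha hb (hm.unique hm') hd
      (.of_subset_zrel hm.1 hz)
    exact ⟨T, hμ, hκ, hT⟩
  · obtain ⟨f, hf⟩ := h2 ⟨ha, hb⟩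
    let _ := DAlg S A μ (Zrel S μ) hμ.1.1
    have hD := (dModel_dmap hμ.1).map_equiv hf
    obtain ⟨-, hm, hz⟩ := hD.exists_maltsevOn_phi huv htA hμ ha
    rw [hm.unique hκ] at hz
    exact absurd hz hb
  · obtain ⟨f, hf⟩ := h3 ⟨ha, hb⟩
    let _ := DAlg S B κ (Zrel S κ) hκ.1.1
    have hD := (dModel_dmap hκ.1).map_equiv (IsHom.symm hf)
    obtain ⟨-, hm, hz⟩ := hD.exists_maltsevOn_phi huv htB hκ hb
    rw [hm.unique hμ] at hz
    exact absurd hz ha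
  · obtain ⟨f, hf⟩ := h4 ⟨ha, hb⟩
    obtain ⟨T, hT⟩ := exists_bridge_of_iso hμ hκ hf
    exact ⟨T, hμ, hκ, hT⟩

end Monolith

/-! ### Quotients -/

/-- `π` is a surjective homomorphism with kernel `ρ`. -/
structure QMap (S : Signature) {A Q : Type} [SAlg S A] [SAlg S Q] (ρ : Set (A × A))
    (π : A → Q) : Prop where
  hom : IsHom S π
  surj : Function.Surjective π
  ker : ∀ a b, π a = π b ↔ (a, b) ∈ ρ

theorem qMap_mk {A : Type} (iA : SAlg S A) {ρ : Set (A × A)} (hρ : IsCongruence S ρ) :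
    @QMap S A (ConQuot ρ) iA (quotAlg iA ρ) ρ (ConQuot.mk ρ) := by
  have hker : ∀ a b, ConQuot.mk ρ a = ConQuot.mk ρ b ↔ (a, b) ∈ ρ := fun a b =>
    Equivalence.quot_mk_eq_iff hρ.2 a b
  let _ := quotAlg iA ρ
  refine ⟨fun o x => ?_, Quot.exists_rep, hker⟩
  refine (hker _ _).2 (hρ.1 o (fun i => (x i, Classical.choose (Quot.exists_rep
    (ConQuot.mk ρ (x i))))) fun i => (hker _ _).1 ?_)
  exact (Classical.choose_spec (Quot.exists_rep (ConQuot.mk ρ (x i)))).symm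

namespace QMap
variable {A Q B R : Type} [SAlg S A] [SAlg S Q] [SAlg S B] [SAlg S R] {ρ ρplus : Set (A × A)}
  {σ σplus : Set (B × B)} {π : A → Q} {π' : B → R}

theorem taylorOn (h : QMap S ρ π) {n : ℕ} {t : STerm S n} {u v : Fin n → Fin n → Fin 2}
    (ht : TaylorOn S A t u v) : TaylorOn S Q t u v := by
  refine ⟨fun x => ?_, fun i x y => ?_⟩
  · obtain ⟨a, rfl⟩ := h.surj x
    rw [← h.hom.eval t (fun _ => a), ht.1]
  · obtain ⟨a, rfl⟩ := h.surj x
    obtain ⟨b, rfl⟩ := h.surj y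
    have key : ∀ w : Fin n → Fin 2, (t.eval fun j => if w j = 0 then π a else π b)
        = π (t.eval fun j => if w j = 0 then a else b) := by
      intro w
      rw [h.hom.eval]
      congr 1
      funext j
      split <;> rfl
    rw [key, key, ht.2]

theorem mem_iff_of_monolith (h : QMap S ρ π) (hρ : MeetIrredWith S ρ ρplus) {μ : Set (Q × Q)}
    (hμ : IsMonolith S μ) (a b : A) : (π a, π b) ∈ μ ↔ (a, b) ∈ ρplus := by
  obtain ⟨h1, h2, h3, h4, h5⟩ := hρ
  have hsub : ∀ {θ : Set (Q × Q)}, IsCongruence S θ → θ ≠ diag Q →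
      ρplus ⊆ {p : A × A | (π p.1, π p.2) ∈ θ} := by
    intro θ hθ hne
    refine h5 _ (h.hom.comap_isCongruence hθ) ?_
    refine Set.ssubset_iff_subset_ne.2 ⟨fun p hp => ?_, ?_⟩
    · have := (h.ker _ _).2 hp
      change (π p.1, π p.2) ∈ θ
      rw [this]
      exact hθ.refl _
    · intro he
      obtain ⟨x, y, hxy, hne'⟩ := hθ.exists_ne hne
      obtain ⟨a, rfl⟩ := h.surj x
      obtain ⟨b, rfl⟩ := h.surj y
      have hm : (a, b) ∈ {p : A × A | (π p.1, π p.2) ∈ θ} := hxy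
      rw [← he] at hm
      exact hne' ((h.ker _ _).2 hm)
  refine ⟨fun hab => ?_, fun hab => hsub hμ.1 hμ.2.1 hab⟩
  let ν : Set (Q × Q) := {p | ∃ a b, (a, b) ∈ ρplus ∧ p = (π a, π b)}
  have hν : ∀ a b, (π a, π b) ∈ ν ↔ (a, b) ∈ ρplus := by
    refine fun a b => ⟨?_, fun h => ⟨a, b, h, rfl⟩⟩
    rintro ⟨a', b', h', he⟩
    obtain ⟨e1, e2⟩ := Prod.mk.inj he
    exact h3.trans (h4.1 ((h.ker _ _).1 e1)) (h3.trans h' (h4.1 ((h.ker _ _).1 e2.symm)))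
  have hνc : IsCongruence S ν := by
    refine ⟨fun o x hx => ?_, fun x => ?_, fun {x y} hxy => ?_, fun {x y w} hxy hyw => ?_⟩
    · choose a b hab he using hx
      refine ⟨_, _, h3.1 o _ hab, ?_⟩
      rw [funext he]
      exact Prod.ext (h.hom o _).symm (h.hom o _).symm
    · obtain ⟨a, rfl⟩ := h.surj x
      exact (hν a a).2 (h3.refl a)
    · obtain ⟨a, rfl⟩ := h.surj x
      obtain ⟨b, rfl⟩ := h.surj y
      exact (hν _ _).2 (h3.symm ((hν _ _).1 hxy))
    · obtain ⟨a, rfl⟩ := h.surj x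
      obtain ⟨b, rfl⟩ := h.surj y
      obtain ⟨c, rfl⟩ := h.surj w
      exact (hν _ _).2 (h3.trans ((hν _ _).1 hxy) ((hν _ _).1 hyw))
  refine (hν a b).1 (hμ.2.2 ν hνc ?_ hab)
  intro he
  apply h4.2
  rintro ⟨a, b⟩ hab'
  have := (hν a b).2 hab'
  rw [he] at this
  exact (h.ker _ _).1 this

theorem exists_monolith (h : QMap S ρ π) (hρ : MeetIrredWith S ρ ρplus) :
    ∃ μ : Set (Q × Q), IsMonolith S μ := by
  obtain ⟨h1, h2, h3, h4, h5⟩ := hρ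
  let ν : Set (Q × Q) := ⋂₀ {θ | IsCongruence S θ ∧ θ ≠ diag Q}
  have hmem : ∀ a b, (a, b) ∈ ρplus → (π a, π b) ∈ ν := by
    rintro a b hab θ ⟨hθ, hne⟩
    refine h5 _ (h.hom.comap_isCongruence hθ) ?_ hab
    refine Set.ssubset_iff_subset_ne.2 ⟨fun p hp => ?_, ?_⟩
    · have := (h.ker _ _).2 hp
      change (π p.1, π p.2) ∈ θ
      rw [this]
      exact hθ.refl _
    · intro he
      obtain ⟨x, y, hxy, hne'⟩ := hθ.exists_ne hne
      obtain ⟨a, rfl⟩ := h.surj x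
      obtain ⟨b, rfl⟩ := h.surj y
      have hm : (a, b) ∈ {p : A × A | (π p.1, π p.2) ∈ θ} := hxy
      rw [← he] at hm
      exact hne' ((h.ker _ _).2 hm)
  refine ⟨ν, ⟨fun o x hx θ hθ => hθ.1.1 o x fun i => hx i θ hθ, fun x θ hθ => hθ.1.refl x,
    fun hxy θ hθ => hθ.1.symm (hxy θ hθ), fun hxy hyw θ hθ => hθ.1.trans (hxy θ hθ) (hyw θ hθ)⟩,
    ?_, fun θ hθ hne => Set.sInter_subset_of_mem ⟨hθ, hne⟩⟩
  intro he
  apply h4.2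
  rintro ⟨a, b⟩ hab
  have := hmem a b hab
  rw [he] at this
  exact (h.ker _ _).1 this

theorem pullback_bridge (h : QMap S ρ π) (h' : QMap S σ π') {L : Set (A × A)} {R' : Set (B × B)}
    {μ : Set (Q × Q)} {κ : Set (R × R)} (hμ : ∀ a b, (π a, π b) ∈ μ ↔ (a, b) ∈ L)
    (hκ : ∀ a b, (π' a, π' b) ∈ κ ↔ (a, b) ∈ R') (hL : ρ ⊂ L) (hR : σ ⊂ R')
    {T : Set (Q × Q × R × R)} (hT : IsBridgeLR S (diag Q) (diag R) μ κ T) :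
    IsBridgeLR S ρ σ L R' {p : A × A × B × B | (π p.1, π p.2.1, π' p.2.2.1, π' p.2.2.2) ∈ T} := by
  obtain ⟨⟨t1, -, -, -, -, t6⟩, t7, t8⟩ := hT
  have hL' : pr12 {p : A × A × B × B | (π p.1, π p.2.1, π' p.2.2.1, π' p.2.2.2) ∈ T} = L := by
    ext ⟨a, b⟩
    rw [← hμ, ← t7]
    constructor
    · rintro ⟨_, _, H⟩
      exact ⟨_, _, H⟩
    · rintro ⟨x, y, H⟩
      obtain ⟨c, rfl⟩ := h'.surj x
      obtain ⟨e, rfl⟩ := h'.surj y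
      exact ⟨c, e, H⟩
  have hR' : pr34 {p : A × A × B × B | (π p.1, π p.2.1, π' p.2.2.1, π' p.2.2.2) ∈ T} = R' := by
    ext ⟨a, b⟩
    rw [← hκ, ← t8]
    constructor
    · rintro ⟨_, _, H⟩
      exact ⟨_, _, H⟩
    · rintro ⟨x, y, H⟩
      obtain ⟨c, rfl⟩ := h.surj x
      obtain ⟨e, rfl⟩ := h.surj y
      exact ⟨c, e, H⟩
  refine ⟨⟨fun o x hx => ?_, ?_, ?_, by rwa [hL'], by rwa [hR'], ?_⟩, hL', hR'⟩
  · have := t1 o _ hx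
    change (π (SAlg.interp o fun i => (x i).1), π (SAlg.interp o fun i => (x i).2.1),
      π' (SAlg.interp o fun i => (x i).2.2.1), π' (SAlg.interp o fun i => (x i).2.2.2)) ∈ T
    rw [h.hom o, h.hom o, h'.hom o, h'.hom o]
    exact this
  · intro a₁ a₂ b₁ b₂ a₁' a₂' H e1 e2
    change (π a₁', π a₂', π' b₁, π' b₂) ∈ T
    rw [← (h.ker _ _).2 e1, ← (h.ker _ _).2 e2]
    exact H
  · intro a₁ a₂ b₁ b₂ b₁' b₂' H e1 e2
    change (π a₁, π a₂, π' b₁', π' b₂') ∈ T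
    rw [← (h'.ker _ _).2 e1, ← (h'.ker _ _).2 e2]
    exact H
  · intro a₁ a₂ b₁ b₂ H
    rw [← h.ker, ← h'.ker]
    exact t6 _ _ _ _ H

end QMap

/-- Similar quotients are connected by a bridge satisfying (B3). -/
theorem exists_bridge_of_similar_quot {A B : Type} [iA : SAlg S A] [iB : SAlg S B] [Finite A]
    [Finite B] (hTay : CommonTaylor S A B) {ρ ρplus : Set (A × A)} {σ σplus : Set (B × B)}
    (hρ : MeetIrredWith S ρ ρplus) (hσ : MeetIrredWith S σ σplus)
    (h : SimilarI S (quotAlg iA ρ) (quotAlg iB σ)) :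
    ∃ T : Set (A × A × B × B), IsBridgeLR S ρ σ ρplus σplus T ∧
        ∀ a₁ a₂ b₁ b₂, (a₁, a₂, b₁, b₂) ∈ T → (a₁, b₁) ∈ btr T ∧ (a₂, b₂) ∈ btr T := by
  let _ := quotAlg iA ρ
  let _ := quotAlg iB σ
  have hA := qMap_mk iA hρ.1
  have hB := qMap_mk iB hσ.1
  obtain ⟨n, t, u, v, -, huv, htA, htB⟩ := hTay
  obtain ⟨μ, κ, T, hμ, hκ, hT, hT3⟩ :=
    exists_bridge_of_similar huv (hA.taylorOn htA) (hB.taylorOn htB) h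
  exact ⟨_, hA.pullback_bridge hB (hA.mem_iff_of_monolith hρ hμ) (hB.mem_iff_of_monolith hσ hκ)
    hρ.2.2.2.1 hσ.2.2.2.1 hT, fun _ _ _ _ H => hT3 _ _ _ _ H⟩

/-! ### Minimal bridges -/

section MinimalBridges
variable {A B : Type} [SAlg S A] [SAlg S B] {ρ : Set (A × A)} {σ : Set (B × B)}
  {T : Set (A × A × B × B)}

theorem IsBridge.conv (h : IsBridge S ρ σ T) : IsBridge S σ ρ (bConv T) := by
  obtain ⟨h1, h2, h3, h4, h5, h6⟩ := h
  refine ⟨fun o x hx => h1 o (fun i => ((x i).2.2.1, (x i).2.2.2, (x i).1, (x i).2.1)) hx,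
    fun b₁ b₂ a₁ a₂ b₁' b₂' H e1 e2 => h3 a₁ a₂ b₁ b₂ b₁' b₂' H e1 e2,
    fun b₁ b₂ a₁ a₂ a₁' a₂' H e1 e2 => h2 a₁ a₂ b₁ b₂ a₁' a₂' H e1 e2, h5, h4,
    fun b₁ b₂ a₁ a₂ H => (h6 a₁ a₂ b₁ b₂ H).symm⟩

theorem mem_of_saturated {L : Set (A × A)} (hL : Saturated ρ L) {a b a' b' : A}
    (h : (a, b) ∈ L) (ha : (a', a) ∈ ρ) (hb : (b, b') ∈ ρ) : (a', b') ∈ L := by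
  rw [← hL]
  exact ⟨a, ha, b, h, hb⟩

theorem IsBridge.pr12_mem_cov (hρ : IsCongruence S ρ) (hT : IsBridge S ρ σ T)
    (hmin : ∀ T' ⊆ T, IsBridge S ρ σ T' → btr T' = btr T → T' = T) : pr12 T ∈ Cov S ρ := by
  obtain ⟨h1, h2, h3, h4, h5, h6⟩ := hT
  refine ⟨fun o x hx => ?_, ?_, h4, fun L hL hsat hρL hLT => ?_⟩
  · choose b₁ b₂ hb using hx
    exact ⟨SAlg.interp o b₁, SAlg.interp o b₂, h1 o _ hb⟩
  · ext ⟨a, b⟩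
    constructor
    · rintro ⟨a', ha, b', ⟨b₁, b₂, H⟩, hb⟩
      exact ⟨b₁, b₂, h2 _ _ _ _ _ _ H (hρ.symm ha) hb⟩
    · exact fun H => ⟨a, hρ.refl a, b, H, hρ.refl b⟩
  · have hne := Set.exists_of_ssubset hρL
    obtain ⟨⟨c, e⟩, hce, hce'⟩ := hne
    have hLpr : pr12 {p | p ∈ T ∧ (p.1, p.2.1) ∈ L} = L := by
      ext ⟨a, b⟩
      refine ⟨fun ⟨_, _, _, H⟩ => H, fun H => ?_⟩
      obtain ⟨b₁, b₂, H'⟩ := hLT H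
      exact ⟨b₁, b₂, H', H⟩
    have heq : {p | p ∈ T ∧ (p.1, p.2.1) ∈ L} = T := by
      refine hmin _ (fun p hp => hp.1) ⟨fun o x hx => ⟨h1 o x fun i => (hx i).1,
        hL o _ fun i => (hx i).2⟩, ?_, ?_, ?_, ?_, fun _ _ _ _ H => h6 _ _ _ _ H.1⟩ ?_
      · exact fun a₁ a₂ b₁ b₂ a₁' a₂' H e1 e2 => ⟨h2 _ _ _ _ _ _ H.1 e1 e2,
          mem_of_saturated hsat H.2 (hρ.symm e1) e2⟩
      · exact fun a₁ a₂ b₁ b₂ b₁' b₂' H e1 e2 => ⟨h3 _ _ _ _ _ _ H.1 e1 e2, H.2⟩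
      · rwa [hLpr]
      · refine Set.ssubset_iff_exists.2 ⟨fun ⟨b₁, b₂⟩ hb => ?_, ?_⟩
        · obtain ⟨a₁, a₂, H⟩ := h5.1 hb
          exact ⟨a₁, a₂, H, hρL.1 ((h6 _ _ _ _ H).2 hb)⟩
        · obtain ⟨b₁, b₂, H⟩ := hLT hce
          exact ⟨(b₁, b₂), ⟨c, e, H, hce⟩, fun hb => hce' ((h6 _ _ _ _ H).2 hb)⟩
      · ext ⟨a, b⟩
        exact ⟨fun H => H.1, fun H => ⟨H, hρL.1 (hρ.refl a)⟩⟩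
    rw [← hLpr, heq]

theorem IsBridge.goodBridge [Finite A] [Finite B] (hρ : IsCongruence S ρ) (hσ : IsCongruence S σ)
    {ρplus : Set (A × A)} {σplus : Set (B × B)} (hT : IsBridge S ρ σ T) (h1 : pr12 T ⊆ ρplus)
    (h2 : pr34 T ⊆ σplus) : GoodBridge S ρ ρplus σ σplus T := by
  obtain ⟨T', ⟨hsub, hT', htr⟩, hmin⟩ :=
    (Set.toFinite {T' | T' ⊆ T ∧ IsBridge S ρ σ T' ∧ btr T' = btr T}).exists_minimal
      ⟨T, subset_rfl, hT, rfl⟩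
  have hmin' : ∀ T'' ⊆ T', IsBridge S ρ σ T'' → btr T'' = btr T' → T'' = T' :=
    fun T'' hs hb ht => hs.antisymm (hmin ⟨hs.trans hsub, hb, ht.trans htr⟩ hs)
  have c1 := hT'.pr12_mem_cov hρ hmin'
  have c2 : pr34 T' ∈ Cov S σ := by
    refine hT'.conv.pr12_mem_cov hσ fun T'' hs hb ht => ?_
    have := hmin' (bConv T'') (fun p hp => hs hp) hb.conv ?_
    · rw [← this]; rfl
    · ext ⟨a, b⟩
      exact Set.ext_iff.1 ht (b, a)
  exact ⟨hT, _, ⟨c1, fun p ⟨_, _, h⟩ => h1 ⟨_, _, hsub h⟩⟩, _,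
    ⟨c2, fun p ⟨_, _, h⟩ => h2 ⟨_, _, hsub h⟩⟩, T', hsub, ⟨hT', rfl, rfl⟩, htr⟩

end MinimalBridges

/-! ### Polynomials and minimal reflexive subuniverses -/

/-- The operations generated by `G` and the constants. -/
inductive Pol (S : Signature) {A X : Type} [SAlg S A] (G : Set (X → A)) : (X → A) → Prop
  | gen {g : X → A} (h : g ∈ G) : Pol S G g
  | const (c : A) : Pol S G fun _ => c
  | op (o : S.ops) (p : Fin (S.arity o) → X → A) (H : ∀ i, Pol S G (p i)) :
      Pol S G fun x => SAlg.interp o fun i => p i x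

/-- Unary polynomials. -/
def Pol1 (S : Signature) {A : Type} [SAlg S A] (f : A → A) : Prop := Pol S {fun x => x} f

/-- Binary polynomials. -/
def Pol2 (S : Signature) {A : Type} [SAlg S A] (p : A → A → A) : Prop :=
  Pol S (X := A × A) {Prod.fst, Prod.snd} fun x => p x.1 x.2

section Polynomials
variable {A : Type} [SAlg S A]

theorem Pol.subst {X Y : Type} {G : Set (X → A)} {G' : Set (Y → A)} {k : Y → X} {f : X → A}
    (hf : Pol S G f) (hG : ∀ g ∈ G, Pol S G' fun y => g (k y)) : Pol S G' fun y => f (k y) := by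
  induction hf with
  | gen h => exact hG _ h
  | const c => exact .const c
  | op o p _ ih => exact .op o _ ih

theorem Pol1.id : Pol1 S (fun x : A => x) := .gen rfl

theorem Pol1.comp_pol {X : Type} {G : Set (X → A)} {f : A → A} {g : X → A} (hf : Pol1 S f)
    (hg : Pol S G g) : Pol S G fun x => f (g x) :=
  Pol.subst hf fun k hk => by
    rw [Set.mem_singleton_iff.1 hk]
    exact hg

theorem Pol1.comp {f g : A → A} (hf : Pol1 S f) (hg : Pol1 S g) : Pol1 S fun x => f (g x) :=
  hf.comp_pol hg

theorem Pol1.iterate {f : A → A} (hf : Pol1 S f) (k : ℕ) : Pol1 S f^[k] := by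
  induction k with
  | zero => exact .id
  | succ k ih => exact ih.comp hf

theorem Pol2.fst : Pol2 S (fun x _ : A => x) := .gen (Or.inl rfl)

theorem Pol2.snd : Pol2 S (fun _ y : A => y) := .gen (Or.inr rfl)

theorem Pol1.comp₂ {f : A → A} {p : A → A → A} (hf : Pol1 S f) (hp : Pol2 S p) :
    Pol2 S fun x y => f (p x y) :=
  hf.comp_pol hp

theorem Pol2.comp_pol {X : Type} {G : Set (X → A)} {p : A → A → A} {f g : X → A}
    (hp : Pol2 S p) (hf : Pol S G f) (hg : Pol S G g) : Pol S G fun x => p (f x) (g x) := by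
  refine Pol.subst (k := fun x => (f x, g x)) hp fun k hk => ?_
  rcases hk with rfl | rfl
  exacts [hf, hg]

theorem Pol2.swap {p : A → A → A} (hp : Pol2 S p) : Pol2 S fun x y => p y x :=
  hp.comp_pol Pol2.snd Pol2.fst

theorem Pol2.left {p : A → A → A} (hp : Pol2 S p) (c : A) : Pol1 S (p c) :=
  hp.comp_pol (.const c) Pol1.id

theorem Pol2.right {p : A → A → A} (hp : Pol2 S p) (c : A) : Pol1 S fun x => p x c :=
  hp.comp_pol Pol1.id (.const c)

theorem Pol2.iterate {p : A → A → A} (hp : Pol2 S p) (k : ℕ) : Pol2 S fun x => (p x)^[k] := by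
  induction k with
  | zero => exact Pol2.snd
  | succ k ih => exact Pol2.comp_pol ih Pol2.fst hp

theorem Pol.rel {X : Type} {G : Set (X → A)} {f : X → A} (hf : Pol S G f) {R : Set (A × A)}
    (hR : IsSubuniverse S R) (hr : ∀ a, (a, a) ∈ R) {x y : X} (hG : ∀ g ∈ G, (g x, g y) ∈ R) :
    (f x, f y) ∈ R := by
  induction hf with
  | gen h => exact hG _ h
  | const c => exact hr c
  | op o p _ ih => exact hR o _ ih

theorem Pol1.rel {f : A → A} (hf : Pol1 S f) {R : Set (A × A)} (hR : IsSubuniverse S R)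
    (hr : ∀ a, (a, a) ∈ R) {x y : A} (h : (x, y) ∈ R) : (f x, f y) ∈ R :=
  Pol.rel hf hR hr fun g hg => by
    rw [Set.mem_singleton_iff.1 hg]
    exact h

theorem Pol2.rel {p : A → A → A} (hp : Pol2 S p) {R : Set (A × A)} (hR : IsSubuniverse S R)
    (hr : ∀ a, (a, a) ∈ R) {x y x' y' : A} (h : (x, y) ∈ R) (h' : (x', y') ∈ R) :
    (p x x', p y y') ∈ R :=
  Pol.rel (x := (x, x')) (y := (y, y')) hp hR hr fun g hg => by
    rcases hg with rfl | rfl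
    exacts [h, h']

theorem Pol.twin {X : Type} {G : Set (X → A)} {f : X → A} (hf : Pol S G f) {θ : Set (A × A)}
    (hr : ∀ a, (a, a) ∈ θ) {k l : A → X} (hG : ∀ g ∈ G, Twin S θ (fun a => g (k a)) fun a => g (l a)) :
    Twin S θ (fun a => f (k a)) fun a => f (l a) := by
  induction hf with
  | gen h => exact hG _ h
  | const c => exact .const (hr c)
  | op o p _ ih => exact .op o _ _ ih

theorem Pol1.twin {f : A → A} (hf : Pol1 S f) {θ : Set (A × A)} (hr : ∀ a, (a, a) ∈ θ)
    {g h : A → A} (H : Twin S θ g h) : Twin S θ (fun a => f (g a)) fun a => f (h a) :=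
  Pol.twin hf hr fun k hk => by
    rw [Set.mem_singleton_iff.1 hk]
    exact H

theorem Pol2.twin {p : A → A → A} (hp : Pol2 S p) {θ : Set (A × A)} (hr : ∀ a, (a, a) ∈ θ)
    {g h g' h' : A → A} (H : Twin S θ g h) (H' : Twin S θ g' h') :
    Twin S θ (fun a => p (g a) (g' a)) fun a => p (h a) (h' a) :=
  Pol.twin (k := fun a => (g a, g' a)) (l := fun a => (h a, h' a)) hp hr fun k hk => by
    rcases hk with rfl | rfl
    exacts [H, H']

/-- A minimal reflexive subuniverse of `A²` other than the diagonal. -/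
structure MinSub (S : Signature) {A : Type} [SAlg S A] (τ : Set (A × A)) : Prop where
  sub : IsSubuniverse S τ
  ssub : diag A ⊂ τ
  min : ∀ L, IsSubuniverse S L → diag A ⊂ L → L ⊆ τ → L = τ

variable {τ μ : Set (A × A)}

theorem MinSub.refl (h : MinSub S τ) (a : A) : (a, a) ∈ τ := h.ssub.1 rfl

theorem MinSub.exists_ne (h : MinSub S τ) : ∃ o i, (o, i) ∈ τ ∧ o ≠ i := by
  obtain ⟨⟨o, i⟩, h1, h2⟩ := Set.exists_of_ssubset h.ssub
  exact ⟨o, i, h1, h2⟩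

theorem MinSub.inv (h : MinSub S τ) : MinSub S (rinv τ) := by
  have key : ∀ {L : Set (A × A)}, diag A ⊂ L → diag A ⊂ rinv L := by
    intro L hL
    obtain ⟨⟨o, i⟩, h1, h2⟩ := Set.exists_of_ssubset hL
    refine Set.ssubset_iff_exists.2 ⟨?_, (i, o), h1, fun e => h2 (Eq.symm e)⟩
    rintro ⟨a, b⟩ (rfl : a = b)
    exact hL.1 rfl
  have key' : ∀ {L : Set (A × A)}, IsSubuniverse S L → IsSubuniverse S (rinv L) :=
    fun hL o x hx => hL o (fun i => ((x i).2, (x i).1)) hx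
  refine ⟨key' h.sub, key h.ssub, fun L h1 h2 h3 => ?_⟩
  rw [← h.min (rinv L) (key' h1) (key h2) fun p hp => h3 hp]
  rfl

theorem MinSub.exists_pol (h : MinSub S τ) {o i : A} (hoi : (o, i) ∈ τ) (hne : o ≠ i) {c d : A}
    (hcd : (c, d) ∈ τ) : ∃ f, Pol1 S f ∧ f o = c ∧ f i = d := by
  have := h.min {p | ∃ f, Pol1 S f ∧ f o = p.1 ∧ f i = p.2} ?_ ?_ ?_
  · rw [← this] at hcd
    exact hcd
  · intro k x hx
    choose f h1 h2 h3 using hx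
    refine ⟨_, Pol.op k f h1, ?_, ?_⟩
    · simp only [h2]; rfl
    · simp only [h3]; rfl
  · refine Set.ssubset_iff_exists.2 ⟨?_, (o, i), ⟨_, .id, rfl, rfl⟩, hne⟩
    rintro ⟨a, b⟩ (rfl : a = b)
    exact ⟨_, .const a, rfl, rfl⟩
  · rintro ⟨_, _⟩ ⟨f, hf, rfl, rfl⟩
    exact hf.rel h.sub h.refl hoi

theorem MinSub.twin_pol (h : MinSub S τ) {o i : A} (hoi : (o, i) ∈ τ) (hne : o ≠ i) {g k : A → A}
    (H : Twin S τ g k) : ∃ p, Pol2 S p ∧ (∀ x, p x o = g x) ∧ ∀ x, p x i = k x := by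
  induction H with
  | id => exact ⟨_, Pol2.fst, fun _ => rfl, fun _ => rfl⟩
  | const hc =>
    obtain ⟨f, hf, h1, h2⟩ := h.exists_pol hoi hne hc
    exact ⟨_, hf.comp₂ Pol2.snd, fun _ => h1, fun _ => h2⟩
  | op c g k _ ih =>
    choose p h1 h2 h3 using ih
    refine ⟨fun x y => SAlg.interp c fun j => p j x y, Pol.op c _ h1, fun x => ?_, fun x => ?_⟩
    · simp only [h2]
    · simp only [h3]

/-- An idempotent unary polynomial `e` with minimal range among those separating a pair of `τ`;
`o` and `i` are separated points of its range. -/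
structure MinIdem (S : Signature) {A : Type} [SAlg S A] (τ : Set (A × A)) (e : A → A) (o i : A) :
    Prop where
  pol : Pol1 S e
  idem : ∀ x, e (e x) = e x
  mem : (o, i) ∈ τ
  ne : o ≠ i
  fix_left : e o = o
  fix_right : e i = i
  inj : ∀ g, Pol1 S g → (∀ x, e (g x) = g x) → ∀ x y, (x, y) ∈ τ → e x = x → e y = y → g x ≠ g y →
    ∀ x y, e x = x → e y = y → g x = g y → x = y

theorem MinSub.exists_minIdem [Finite A] (h : MinSub S τ) : ∃ e o i, MinIdem S τ e o i := by
  obtain ⟨f, ⟨hf, x, y, hxy, hne⟩, hmin⟩ : ∃ f, (Pol1 S f ∧ ∃ x y, (x, y) ∈ τ ∧ f x ≠ f y) ∧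
      ∀ g, (Pol1 S g ∧ ∃ x y, (x, y) ∈ τ ∧ g x ≠ g y) →
        (Set.range f).ncard ≤ (Set.range g).ncard := by
    obtain ⟨o, i, h1, h2⟩ := h.exists_ne
    exact exists_minimalFor_of_wellFoundedLT (fun f : A → A =>
      Pol1 S f ∧ ∃ x y, (x, y) ∈ τ ∧ f x ≠ f y) (fun f => (Set.range f).ncard)
      ⟨_, .id, o, i, h1, h2⟩ |>.imp fun f hf => ⟨hf.1, fun g hg => by
        by_contra hcon
        exact hcon (hf.2 hg (le_of_lt (not_le.1 hcon)))⟩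
  obtain ⟨k, hk, h1, h2⟩ := h.exists_pol (hf.rel h.sub h.refl hxy) hne hxy
  obtain ⟨n, hn, hid⟩ := exists_iterate_idem fun a => k (f a)
  have hfix : ∀ a, k (f a) = a → (fun a => k (f a))^[n] a = a :=
    fun a ha => Function.iterate_fixed (f := fun a => k (f a)) ha n
  have hpol := (hk.comp hf).iterate n
  have hcard : (Set.range (fun a => k (f a))^[n]).ncard ≤ (Set.range f).ncard := by
    obtain ⟨m, rfl⟩ := Nat.exists_eq_add_of_le' hn
    refine (Set.ncard_le_ncard (t := k '' Set.range f) ?_ (Set.toFinite _)).trans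
      (Set.ncard_image_le (Set.toFinite _))
    rintro _ ⟨a, rfl⟩
    rw [Function.iterate_succ_apply']
    exact ⟨_, ⟨_, rfl⟩, rfl⟩
  refine ⟨_, x, y, hpol, hid, hxy, fun he => hne (he ▸ rfl), hfix x h1, hfix y h2, ?_⟩
  generalize (fun a => k (f a))^[n] = e at *
  intro g hg heg u v huv hu hv huv' a b ha hb hab
  have hle := hcard.trans (hmin _ ⟨hg.comp hpol, u, v, huv, by simpa [hu, hv] using huv'⟩)
  have himg : Set.range (fun a => g (e a)) = g '' Set.range e := by
    rw [← Set.range_comp]; rfl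
  rw [himg] at hle
  have hinj := Set.injOn_of_ncard_image_eq ((Set.ncard_image_le (Set.toFinite _)).antisymm hle)
    (Set.toFinite _)
  exact hinj ⟨a, ha⟩ ⟨b, hb⟩ hab

variable {e : A → A} {o i : A}

theorem MinIdem.inv (hm : MinIdem S τ e o i) : MinIdem S (rinv τ) e i o :=
  ⟨hm.pol, hm.idem, hm.mem, hm.ne.symm, hm.fix_right, hm.fix_left,
    fun g hg heg x y hxy hx hy hne => hm.inj g hg heg y x hxy hy hx hne.symm⟩

theorem MinIdem.perm [Finite A] (hm : MinIdem S τ e o i) {g : A → A} (hg : Pol1 S g)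
    (heg : ∀ x, e (g x) = g x) {x y : A} (hxy : (x, y) ∈ τ) (hx : e x = x) (hy : e y = y)
    (hne : g x ≠ g y) :
    ∃ g', Pol1 S g' ∧ (∀ x, e (g' x) = g' x) ∧ ∀ x, e x = x → g' (g x) = x ∧ g (g' x) = x := by
  have hinj := hm.inj g hg heg x y hxy hx hy hne
  obtain ⟨k, hk, hid⟩ := exists_iterate_idem g
  obtain ⟨m, rfl⟩ := Nat.exists_eq_add_of_le' hk
  have hU : ∀ n x, e x = x → e (g^[n] x) = g^[n] x := by
    intro n x hx
    cases n with
    | zero => exact hx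
    | succ n => rw [Function.iterate_succ_apply', heg]
  have hinj' : ∀ n x y, e x = x → e y = y → g^[n] x = g^[n] y → x = y := by
    intro n
    induction n with
    | zero => exact fun x y _ _ h => h
    | succ n ih =>
      intro x y hx hy h
      exact hinj x y hx hy (ih _ _ (heg x) (heg y) h)
  have hfix : ∀ x, e x = x → g^[m + 1] x = x := fun x hx =>
    hinj' (m + 1) _ _ (hU _ x hx) hx (hid x)
  refine ⟨fun x => e (g^[m] x), hm.pol.comp (hg.iterate m), fun x => hm.idem _, fun x hx => ?_⟩
  constructor
  · change e (g^[m] (g x)) = x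
    rw [← Function.iterate_succ_apply, hfix x hx, hx]
  · change g (e (g^[m] x)) = x
    rw [hU m x hx, ← Function.iterate_succ_apply' (f := g), hfix x hx]

end Polynomials

/-! ### Meet operations and abelian monoliths -/

section Dichotomy
variable {A : Type} [SAlg S A] {τ μ : Set (A × A)} {e : A → A} {o i : A}

/-- `p` acts on the `τ`-pair `{o, i}` as a meet operation with zero `o` and unit `i`. -/
structure IsMeet (S : Signature) {A : Type} [SAlg S A] (τ : Set (A × A)) (p : A → A → A)
    (o i : A) : Prop where
  pol : Pol2 S p
  ne : o ≠ i
  mem : (o, i) ∈ τ ∨ (i, o) ∈ τ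
  zero_zero : p o o = o
  zero_one : p o i = o
  one_zero : p i o = o
  one_one : p i i = i

theorem IsMeet.inv {p : A → A → A} (h : IsMeet S τ p o i) : IsMeet S (rinv τ) p o i :=
  ⟨h.pol, h.ne, h.mem.symm, h.zero_zero, h.zero_one, h.one_zero, h.one_one⟩

theorem MinIdem.exists_isMeet [Finite A] (h : MinSub S τ) (hm : MinIdem S τ e o i)
    {p : A → A → A} (hp : Pol2 S p) (h0 : p o o = p o i) (h1 : p i o ≠ p i i) :
    ∃ p o i, IsMeet S τ p o i := by
  obtain ⟨f, hf, f1, f2⟩ := h.exists_pol ((hp.left i).rel h.sub h.refl hm.mem) h1 hm.mem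
  obtain ⟨p, hp, hep, h0, h1, h2⟩ : ∃ p, Pol2 S p ∧ (∀ x y, e (p x y) = p x y) ∧ p o o = p o i ∧
      p i o = o ∧ p i i = i := by
    refine ⟨fun x y => e (f (p x y)), hm.pol.comp₂ (hf.comp₂ hp), fun _ _ => hm.idem _, ?_, ?_, ?_⟩
    · simp only [h0]
    · simp only [f1, hm.fix_left]
    · simp only [f2, hm.fix_right]
  obtain ⟨g, hg, heg, hg'⟩ := hm.perm (hp.left i) (hep i) hm.mem hm.fix_left hm.fix_right
    (by rw [h1, h2]; exact hm.ne)
  obtain ⟨p, hp, hep, h0, h1⟩ : ∃ p, Pol2 S p ∧ (∀ x y, e (p x y) = p x y) ∧ p o o = p o i ∧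
      ∀ y, e y = y → p i y = y :=
    ⟨fun x y => g (p x y), hg.comp₂ hp, fun _ _ => heg _, by simp only [h0],
      fun y hy => (hg' y hy).1⟩
  have ho := hm.fix_left
  have hi := hm.fix_right
  have hc : p o (p o o) = p o o := by
    by_contra hne
    refine hm.ne (hm.inj (p o) (hp.left o) (hep o) (p o o) o ?_ (hep _ _) ho hne o i ho hi h0)
    have := (hp.right o).rel h.sub h.refl hm.mem
    rwa [h1 o ho] at this
  by_cases hci : p o o = i
  · obtain ⟨g, hg, -, hg'⟩ := hm.perm (hp.right o) (fun x => hep x o) hm.mem ho hi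
      (by rw [hci, h1 o ho]; exact hm.ne.symm)
    have g1 : g i = o := by rw [← hci]; exact (hg' o ho).1
    have g2 : g o = i := by
      have := (hg' i hi).1
      rwa [h1 o ho] at this
    refine ⟨fun x y => p (g x) y, i, o, hp.comp_pol (hg.comp_pol Pol2.fst) Pol2.snd, hm.ne.symm,
      Or.inr hm.mem, ?_, ?_, ?_, ?_⟩ <;> simp only [g1, g2]
    · rw [← h0, hci]
    · exact hci
    · exact h1 i hi
    · exact h1 o ho
  · obtain ⟨g, hg, -, hg'⟩ := hm.perm (hp.right i) (fun x => hep x i) hm.mem ho hi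
      (by rw [← h0, h1 i hi]; exact hci)
    have g1 : g (p o o) = o := by rw [h0]; exact (hg' o ho).1
    have g2 : g i = i := by
      have := (hg' i hi).1
      rwa [h1 i hi] at this
    have hmem := (hp.right i).rel h.sub h.refl hm.mem
    rw [← h0, h1 i hi] at hmem
    refine ⟨fun x y => p (g x) y, p o o, i, hp.comp_pol (hg.comp_pol Pol2.fst) Pol2.snd, hci,
      Or.inl hmem, ?_, ?_, ?_, ?_⟩ <;> simp only [g1, g2]
    · exact hc
    · exact h0.symm
    · exact h1 _ (hep _ _)
    · exact h1 i hi

theorem MinIdem.mem_zrel [Finite A] (h : MinSub S τ) (hm : MinIdem S τ e o i)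
    (hno : ¬ ∃ p o i, IsMeet S τ p o i) : (o, i) ∈ Zrel S τ := by
  intro g k H
  obtain ⟨p, hp, h1, h2⟩ := h.twin_pol hm.mem hm.ne H
  simp only [← h1, ← h2]
  constructor
  · intro h3
    by_contra h4
    exact hno (hm.exists_isMeet h hp h3 h4)
  · intro h3
    by_contra h4
    obtain ⟨p, o', i', hp'⟩ := hm.inv.exists_isMeet h.inv hp h3.symm (Ne.symm h4)
    exact hno ⟨p, o', i', hp'.inv⟩

theorem IsMonolith.exists_separating (hμ : IsMonolith S μ) (he : Pol1 S e)
    (hee : ∀ x, e (e x) = e x) (ho : e o = o) (hi : e i = i) (hoi : (o, i) ∈ μ) (hne : o ≠ i)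
    {x y : A} (hxy : (x, y) ∈ μ) (hxy' : x ≠ y) :
    ∃ f, Pol1 S f ∧ (∀ x, e (f x) = f x) ∧ (f x, o) ∈ μ ∧ f x ≠ f y := by
  classical
  by_contra! hcon
  let K : Set (A × A) := {p | p ∈ μ ∧ ∀ f, Pol1 S f → (∀ x, e (f x) = f x) →
    (f p.1, o) ∈ μ → f p.1 = f p.2}
  have hrel : ∀ {f : A → A} {a b : A}, Pol1 S f → (a, b) ∈ μ → (f a, f b) ∈ μ :=
    fun hf h => hf.rel hμ.1.1 hμ.1.refl h
  have hKr : ∀ a, (a, a) ∈ K := fun a => ⟨hμ.1.refl a, fun _ _ _ _ => rfl⟩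
  have hKt : ∀ {a b c}, (a, b) ∈ K → (b, c) ∈ K → (a, c) ∈ K := fun h h' =>
    ⟨hμ.1.trans h.1 h'.1, fun f hf hef h1 => (h.2 f hf hef h1).trans
      (h'.2 f hf hef (hμ.1.trans (hμ.1.symm (hrel hf h.1)) h1))⟩
  have hK : IsCongruence S K := by
    refine ⟨fun c z hz => ?_, hKr, fun {a b} h => ⟨hμ.1.symm h.1, fun f hf hef h1 =>
      (h.2 f hf hef (hμ.1.trans (hrel hf h.1) h1)).symm⟩, hKt⟩
    refine hybrid (fun w => (SAlg.interp c (fun j => (z j).1), SAlg.interp c w) ∈ K)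
      (fun j => (z j).1) (fun j => (z j).2) (fun j w hw => hKt hw ?_) (hKr _)
    have htr : Pol1 S fun a => SAlg.interp c (Function.update w j a) := by
      refine Pol.op c (fun k a => Function.update w j a k) fun k => ?_
      by_cases hk : k = j
      · subst hk
        simpa [Pol1] using Pol1.id (S := S) (A := A)
      · simpa [Function.update, hk] using Pol.const _
    exact ⟨hrel htr (hz j).1, fun f hf hef h1 => (hz j).2 _ (hf.comp htr) (fun _ => hef _) h1⟩
  have hKd : K ≠ diag A := fun hd => by
    have : (x, y) ∈ K := ⟨hxy, hcon⟩
    rw [hd] at this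
    exact hxy' this
  have := (hμ.2.2 K hK hKd hoi).2 e he hee (by rw [ho]; exact hμ.1.refl o)
  exact hne (by simpa [ho, hi] using this)

end Dichotomy

section Chains
variable {A : Type} [SAlg S A] {τ μ : Set (A × A)} {e : A → A} {o i : A}

/-- Twins with respect to `τ` or its inverse. -/
def TwinStep (S : Signature) {A : Type} [SAlg S A] (τ : Set (A × A)) (g h : A → A) : Prop :=
  Twin S τ g h ∨ Twin S τ h g

open Relation (ReflTransGen)

/-- The monolith is generated by chains of `τ`-steps. -/
theorem IsMonolith.chain (hμ : IsMonolith S μ) (hτ : MinSub S τ) {x y : A} (hxy : (x, y) ∈ μ) :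
    ReflTransGen (fun a b => (a, b) ∈ τ ∨ (b, a) ∈ τ) x y := by
  classical
  let r : A → A → Prop := fun a b => (a, b) ∈ τ ∨ (b, a) ∈ τ
  have hs : ∀ a b, ReflTransGen r a b → ReflTransGen r b a := fun a b h => by
    induction h with
    | refl => exact .refl
    | tail _ h ih => exact .head (Or.symm h) ih
  refine hμ.2.2 {p | ReflTransGen r p.1 p.2} ⟨fun c z hz => ?_, fun _ => .refl, fun {a b} h =>
    hs a b h, fun {a b c} h h' => ReflTransGen.trans (b := b) h h'⟩ ?_ hxy
  · refine hybrid (fun w => ReflTransGen r (SAlg.interp c fun j => (z j).1) (SAlg.interp c w))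
      (fun j => (z j).1) (fun j => (z j).2) (fun j w hw => hw.trans ?_) .refl
    refine ReflTransGen.lift (p := r) (fun a => SAlg.interp c (Function.update w j a)) (fun a b hab => ?_) _ _ (hz j)
    have key : ∀ {a b}, (a, b) ∈ τ → (SAlg.interp c (Function.update w j a),
        SAlg.interp c (Function.update w j b)) ∈ τ := by
      intro a b hab
      refine hτ.sub c (fun k => (Function.update w j a k, Function.update w j b k)) fun k => ?_
      by_cases hk : k = j
      · subst hk
        simpa using hab
      · simpa [Function.update, hk] using hτ.refl _
    exact hab.imp key key
  · obtain ⟨o, i, h, hne⟩ := hτ.exists_ne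
    intro he
    have : (o, i) ∈ {p : A × A | ReflTransGen r p.1 p.2} := .single (Or.inl h)
    rw [he] at this
    exact hne this

theorem Twin.chain (hμ : IsMonolith S μ) (hτ : MinSub S τ) {g h : A → A} (H : Twin S μ g h) :
    ReflTransGen (TwinStep S τ) g h := by
  classical
  induction H with
  | id => exact .refl
  | const hc =>
    exact ReflTransGen.lift (p := TwinStep S τ) (fun (c _ : A) => c)
      (fun a b hab => hab.imp .const .const) _ _ (hμ.chain hτ hc)
  | op c g h H ih =>
    have hp : ∀ j, Twin S τ (g j) (g j) ∧ Twin S τ (h j) (h j) := by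
      have : ∀ {g h : A → A}, Twin S μ g h → Twin S τ g g ∧ Twin S τ h h := by
        intro g h H
        induction H with
        | id => exact ⟨.id, .id⟩
        | const _ => exact ⟨.const (hτ.refl _), .const (hτ.refl _)⟩
        | op c g h _ ih => exact ⟨.op c _ _ fun j => (ih j).1, .op c _ _ fun j => (ih j).2⟩
      exact fun j => this (H j)
    refine (hybrid (fun w => (∀ k, Twin S τ (w k) (w k)) ∧ ReflTransGen (TwinStep S τ)
      (fun a => SAlg.interp c fun j => g j a) fun a => SAlg.interp c fun j => w j a)
      g h (fun j w hw => ?_) ⟨fun j => (hp j).1, .refl⟩).2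
    have hw' : ∀ k, k ≠ j → Twin S τ (w k) (w k) := fun k hk => by
      have := hw.1 k
      rwa [Function.update_of_ne hk] at this
    refine ⟨fun k => ?_, hw.2.trans ?_⟩
    · by_cases hk : k = j
      · subst hk
        simpa using (hp k).2
      · simpa [Function.update, hk] using hw' k hk
    refine ReflTransGen.lift (fun F a => SAlg.interp c fun k => Function.update w j F k a)
      (fun F F' hF => ?_) _ _ (ih j)
    have key : ∀ {F F'}, Twin S τ F F' → Twin S τ
        (fun a => SAlg.interp c fun k => Function.update w j F k a)
        fun a => SAlg.interp c fun k => Function.update w j F' k a := by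
      intro F F' hF
      refine .op c _ _ fun k => ?_
      by_cases hk : k = j
      · subst hk
        simpa using hF
      · simpa [Function.update, hk] using hw' k hk
    exact hF.imp key key

/-- Along a chain of twins, either nothing moves or every twin collapses `o` and `i`,
provided that there is no polynomial depending on both its arguments on `{o, i}`. -/
theorem chain_rigid (hτ : MinSub S τ) (hm : MinIdem S τ e o i) (hZ : (o, i) ∈ Zrel S τ)
    (hno : ∀ p, Pol2 S p → (∀ x y, e (p x y) = p x y) → p o o = p o i ∨ p o o = p i o)
    {g h : A → A} (hg : ∀ x, e (g x) = g x) (H : ReflTransGen (TwinStep S τ) g h) :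
    (e (h o) = g o ∧ e (h i) = g i) ∨ (g o = g i ∧ e (h o) = e (h i)) := by
  have step : ∀ {F F' : A → A}, Twin S τ F F' → (e (F o) = e (F' o) ∧ e (F i) = e (F' i)) ∨
      (e (F o) = e (F i) ∧ e (F' o) = e (F' i)) := by
    intro F F' H
    obtain ⟨p, hp, h1, h2⟩ := hτ.twin_pol hm.mem hm.ne (hm.pol.twin hτ.refl H)
    have hp' := hm.pol.comp₂ hp
    have hh1 : ∀ x, e (p x o) = e (F x) := fun x => by rw [h1, hm.idem]
    have hh2 : ∀ x, e (p x i) = e (F' x) := fun x => by rw [h2, hm.idem]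
    rcases hno _ hp' fun _ _ => hm.idem _ with h3 | h3
    · left
      rw [hh1, hh2] at h3
      exact ⟨h3, (hZ _ _ (hm.pol.twin hτ.refl H)).1 h3⟩
    · right
      refine ⟨by rw [← hh1, ← hh1]; exact h3, ?_⟩
      rw [← hh2, ← hh2]
      exact (hZ _ _ (Pol2.twin hp'.swap hτ.refl .id (.const hm.mem))).1 h3
  have step' : ∀ {F F' : A → A}, TwinStep S τ F F' → (e (F o) = e (F' o) ∧ e (F i) = e (F' i)) ∨
      (e (F o) = e (F i) ∧ e (F' o) = e (F' i)) := by
    rintro F F' (H | H)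
    · exact step H
    · exact (step H).imp (fun h => ⟨h.1.symm, h.2.symm⟩) fun h => ⟨h.2, h.1⟩
  induction H with
  | refl => exact Or.inl ⟨hg _, hg _⟩
  | tail _ hs ih =>
    rcases ih with ⟨h1, h2⟩ | ⟨h1, h2⟩ <;> rcases step' hs with ⟨h3, h4⟩ | ⟨h3, h4⟩
    · exact Or.inl ⟨h3.symm.trans h1, h4.symm.trans h2⟩
    · exact Or.inr ⟨by rw [← h1, ← h2, h3], h4⟩
    · exact Or.inr ⟨h1, by rw [← h3, ← h4, h2]⟩
    · exact Or.inr ⟨h1, h4⟩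

end Chains

section Abelian
variable {A : Type} [SAlg S A] {τ μ : Set (A × A)} {e : A → A} {o i : A}

theorem MinIdem.exists_loop [Finite A] (hm : MinIdem S τ e o i) {p : A → A → A} (hp : Pol2 S p)
    (hep : ∀ x y, e (p x y) = p x y) (h1 : p o o ≠ p o i) (h2 : p o o ≠ p i o) :
    ∃ q, Pol2 S q ∧ (∀ x y, e (q x y) = q x y) ∧ (∀ x, e x = x → q x o = x) ∧
      ∀ x, e x = x → q o x = x := by
  have ho := hm.fix_left
  have hi := hm.fix_right
  obtain ⟨s, hs, hes, hs'⟩ := hm.perm (hp.left o) (hep o) hm.mem ho hi h1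
  have hne : s (p o o) ≠ s (p i o) := fun h => h2 <| by
    rw [← (hs' _ (hep o o)).2, ← (hs' _ (hep i o)).2, h]
  obtain ⟨r, hr, her, hr'⟩ := hm.perm (hs.comp (hp.right o)) (fun _ => hes _) hm.mem ho hi hne
  refine ⟨fun x y => s (p (r x) y), hs.comp₂ (hp.comp_pol (hr.comp_pol Pol2.fst) Pol2.snd),
    fun _ _ => hes _, fun x hx => (hr' x hx).2, fun x hx => ?_⟩
  have hro : r o = o := by
    have := (hr' o ho).1
    rwa [(hs' o ho).1] at this
  change s (p (r o) x) = x
  rw [hro, (hs' x hx).1]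

/-- Right translations of a loop operation on a minimal set have a uniform polynomial inverse
near `o`. -/
theorem MinIdem.exists_division [Finite A] (hm : MinIdem S τ e o i) (hr : ∀ a, (a, a) ∈ τ)
    (hK : μ ⊆ Zrel S τ) {p : A → A → A} (hp : Pol2 S p) (hep : ∀ x y, e (p x y) = p x y)
    (h1 : ∀ x, e x = x → p o x = x) :
    ∃ l, Pol2 S l ∧ ∀ x y, (x, o) ∈ μ → e y = y →
      e (l x y) = l x y ∧ p x (l x y) = y ∧ l x (p x y) = y := by
  have hinj : ∀ x, (x, o) ∈ μ → ∀ y y', e y = y → e y' = y' → p x y = p x y' → y = y' := by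
    intro x hx
    refine hm.inj (p x) (hp.left x) (hep x) o i hm.mem hm.fix_left hm.fix_right fun h => ?_
    have := (hK hx _ _ (Pol2.twin hp hr .id (.const hm.mem))).1 h
    rw [h1 o hm.fix_left, h1 i hm.fix_right] at this
    exact hm.ne this
  obtain ⟨k, hk, hid⟩ := exists_iterate_idem fun z : A × A => (z.1, p z.1 z.2)
  obtain ⟨m, rfl⟩ := Nat.exists_eq_add_of_le' hk
  have hit : ∀ n x y, (fun z : A × A => (z.1, p z.1 z.2))^[n] (x, y) = (x, (p x)^[n] y) := by
    intro n x
    induction n with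
    | zero => exact fun _ => rfl
    | succ n ih =>
      intro y
      rw [Function.iterate_succ_apply, ih, Function.iterate_succ_apply]
  have hid' : ∀ x y, (p x)^[m + 1] ((p x)^[m + 1] y) = (p x)^[m + 1] y := fun x y => by
    have := hid (x, y)
    rw [hit, hit] at this
    exact congrArg Prod.snd this
  have hU : ∀ n x y, e y = y → e ((p x)^[n] y) = (p x)^[n] y := by
    intro n x y hy
    cases n with
    | zero => exact hy
    | succ n => rw [Function.iterate_succ_apply', hep]
  have hinj' : ∀ n x, (x, o) ∈ μ → ∀ y y', e y = y → e y' = y' →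
      (p x)^[n] y = (p x)^[n] y' → y = y' := by
    intro n x hx
    induction n with
    | zero => exact fun y y' _ _ h => h
    | succ n ih =>
      intro y y' hy hy' h
      exact hinj x hx y y' hy hy' (ih _ _ (hep x y) (hep x y') h)
  refine ⟨fun x => (p x)^[m], hp.iterate m, fun x y hx hy => ?_⟩
  have hfix : (p x)^[m + 1] y = y := hinj' (m + 1) x hx _ _ (hU _ _ _ hy) hy (hid' x y)
  exact ⟨hU m x y hy, by rw [← Function.iterate_succ_apply' (f := p x), hfix],
    by change (p x)^[m] (p x y) = y; rw [← Function.iterate_succ_apply, hfix]⟩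

theorem MinIdem.twin_eq [Finite A] (hμ : IsMonolith S μ) (hτ : MinSub S τ) (hτμ : τ ⊆ μ)
    (hm : MinIdem S τ e o i) (hK : μ ⊆ Zrel S τ) {g h : A → A} (H : Twin S μ g h)
    (hgh : g o = h o) : g i = h i := by
  by_contra hne
  have ho := hm.fix_left
  have hi := hm.fix_right
  have hoi := hτμ hm.mem
  obtain ⟨f, hf, hef, hfo, hfne⟩ := hμ.exists_separating hm.pol hm.idem ho hi hoi hm.ne
    (H.pair_mem hμ.1.1 subset_rfl (hμ.1.refl i)) hne
  replace H := hf.twin hμ.1.refl H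
  replace hgh := congrArg f hgh
  have hgo : (f (g o), o) ∈ μ := hμ.1.trans
    ((H.left hμ.1.refl).pair_mem hμ.1.1 subset_rfl hoi) hfo
  have HC := H.chain hμ hτ
  by_cases hno : ∀ p, Pol2 S p → (∀ x y, e (p x y) = p x y) → p o o = p o i ∨ p o o = p i o
  · rcases chain_rigid hτ hm (hK hoi) hno (fun x => hef (g x)) HC with ⟨-, h2⟩ | ⟨h1, h2⟩
    · exact hfne (h2.symm.trans (hef _))
    · rw [hef, hef] at h2
      exact hfne (h1.symm.trans (hgh.trans h2))
  push Not at hno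
  obtain ⟨p₀, hp₀, hep₀, hn1, hn2⟩ := hno
  obtain ⟨p, hp, hep, hp1, hp2⟩ := hm.exists_loop hp₀ hep₀ hn1 hn2
  obtain ⟨l, hl, hl'⟩ := hm.exists_division hτ.refl hK hp hep hp2
  have step : ∀ {F F' : A → A}, Twin S τ F F' → (e (F o), o) ∈ μ → (e (F' o), o) ∈ μ →
      l (e (F o)) (e (F i)) = l (e (F' o)) (e (F' i)) := by
    intro F F' hF h1 h2
    have hF' := hm.pol.twin hτ.refl hF
    have hlo : ∀ x, (x, o) ∈ μ → e x = x → l x x = o := fun x hx hx' => by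
      have := (hl' x o hx ho).2.2
      rwa [hp1 x hx'] at this
    have ht := Pol2.twin hp hτ.refl (g := fun _ => e (F' o)) (.const (hτ.refl (e (F' o))))
      (Pol2.twin hl hτ.refl (.const (hm.pol.rel hτ.sub hτ.refl
        (hF.pair_mem hτ.sub subset_rfl (hτ.refl o)))) hF')
    have key := (hK hoi _ _ ht).1 (by
      rw [hlo _ h1 (hm.idem _), hlo _ h2 (hm.idem _)])
    have := congrArg (l (e (F' o))) key
    rwa [(hl' _ _ h2 (hl' _ _ h1 (hm.idem _)).1).2.2,
      (hl' _ _ h2 (hl' _ _ h2 (hm.idem _)).1).2.2] at this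
  have inv : ∀ {F : A → A}, Relation.ReflTransGen (TwinStep S τ) (fun x => f (g x)) F →
      (e (F o), o) ∈ μ ∧ l (e (F o)) (e (F i)) = l (f (g o)) (f (g i)) := by
    intro F hF
    induction hF with
    | refl => exact ⟨by rwa [hef], by rw [hef, hef]⟩
    | @tail F F' _ hs ih =>
      have hmem : (e (F' o), e (F o)) ∈ μ := hm.pol.rel hμ.1.1 hμ.1.refl <| by
        rcases hs with hs | hs
        · exact hμ.1.symm ((hs.mono hτμ).pair_mem hμ.1.1 subset_rfl (hμ.1.refl o))
        · exact (hs.mono hτμ).pair_mem hμ.1.1 subset_rfl (hμ.1.refl o)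
      have hmem' := hμ.1.trans hmem ih.1
      refine ⟨hmem', ?_⟩
      rw [← ih.2]
      rcases hs with hs | hs
      · exact (step hs ih.1 hmem').symm
      · exact step hs hmem' ih.1
  have hfin := (inv HC).2
  rw [hef, hef, ← hgh] at hfin
  have := congrArg (p (f (g o))) hfin
  rw [(hl' _ _ hgo (hef _)).2.1, (hl' _ _ hgo (hef _)).2.1] at this
  exact hfne this.symm

theorem Twin.of_rinv {g h : A → A} (H : Twin S (rinv τ) g h) : Twin S τ h g := by
  induction H with
  | id => exact .id
  | const hc => exact .const hc
  | op o g h _ ih => exact .op o _ _ ih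

/-- If there is no meet operation on a minimal subuniverse below the monolith, the monolith
is abelian. -/
theorem IsMonolith.subset_zrel [Finite A] (hμ : IsMonolith S μ) (hτ : MinSub S τ) (hτμ : τ ⊆ μ)
    (hno : ¬ ∃ p o i, IsMeet S τ p o i) : μ ⊆ Zrel S μ := by
  obtain ⟨e, o, i, hm⟩ := hτ.exists_minIdem
  have hK : μ ⊆ Zrel S τ := hμ.2.2 _ (zrel_isCongruence hτ.refl) fun hd => by
    have := hm.mem_zrel hτ hno
    rw [hd] at this
    exact hm.ne this
  refine hμ.2.2 _ (zrel_isCongruence hμ.1.refl) fun hd => ?_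
  have : (o, i) ∈ Zrel S μ := fun g h H => ⟨hm.twin_eq hμ hτ hτμ hK H,
    hm.inv.twin_eq hμ hτ.inv (fun x hx => hμ.1.symm (hτμ hx))
      (fun x hx g h H => by simpa only [eq_comm] using hK hx h g H.of_rinv) H⟩
  rw [hd] at this
  exact hm.ne this

end Abelian

/-! ### Bridges with minimal anchors between subdirectly irreducible algebras -/

/-- A relation which is the graph of a bijection and closed under the operations yields an
isomorphism. -/
theorem exists_iso_of_graph {D E : Type} [SAlg S D] [SAlg S E] {W : Set (D × E)}
    (hW : IsSubuniverse S W) (h1 : ∀ x, ∃ y, (x, y) ∈ W) (h2 : ∀ y, ∃ x, (x, y) ∈ W)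
    (h3 : ∀ x y x' y', (x, y) ∈ W → (x', y') ∈ W → (x = x' ↔ y = y')) :
    ∃ f : D ≃ E, IsHom S f := by
  choose f hf using h1
  have hbij : Function.Bijective f := by
    refine ⟨fun x x' h => (h3 _ _ _ _ (hf x) (hf x')).2 h, fun y => ?_⟩
    obtain ⟨x, hx⟩ := h2 y
    exact ⟨x, (h3 _ _ _ _ (hf x) hx).1 rfl⟩
  refine ⟨Equiv.ofBijective f hbij, fun o x => ?_⟩
  exact (h3 _ _ _ _ (hf _) (hW o (fun i => (x i, f (x i))) fun i => hf _)).1 rfl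

/-- A bridge between algebras with monoliths, whose anchors are minimal and lie below the
monoliths. -/
structure MinBridge (S : Signature) {A B : Type} [SAlg S A] [SAlg S B] (μ : Set (A × A))
    (κ : Set (B × B)) (T : Set (A × A × B × B)) : Prop where
  sub : IsSubuniverse S T
  eqv : ∀ a₁ a₂ b₁ b₂, (a₁, a₂, b₁, b₂) ∈ T → (a₁ = a₂ ↔ b₁ = b₂)
  left : MinSub S (pr12 T)
  right : MinSub S (pr34 T)
  left_le : pr12 T ⊆ μ
  right_le : pr34 T ⊆ κ

/-- A monolith that is abelian, with a difference map and difference terms. -/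
structure AbModel (S : Signature) {A D : Type} [SAlg S A] [SAlg S D] (μ : Set (A × A))
    (z : A → A → D) : Prop where
  mono : IsMonolith S μ
  ab : μ ⊆ Zrel S μ
  model : DModel S μ z
  maltsev : ∃ d : STerm S 3, MaltsevOn d μ
  maltsev_phi : ∃ d : STerm S 3, MaltsevOn d (DModel.phi S μ z)
  mono_phi : IsMonolith S (DModel.phi S μ z)
  ab_phi : DModel.phi S μ z ⊆ Zrel S (DModel.phi S μ z)

section Bridges
variable {A B D E : Type} [SAlg S A] [SAlg S B] [SAlg S D] [SAlg S E] {μ : Set (A × A)}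
  {κ : Set (B × B)} {T : Set (A × A × B × B)} {z : A → A → D} {z' : B → B → E}

theorem abModel_dmap [Finite A] {n : ℕ} {t : STerm S n} {u v : Fin n → Fin n → Fin 2}
    (huv : ∀ i, u i i ≠ v i i) (ht : TaylorOn S A t u v) (hμ : IsMonolith S μ)
    (hab : μ ⊆ Zrel S μ) :
    let _ := DAlg S A μ (Zrel S μ) hμ.1.1
    AbModel S μ (dmap S μ (Zrel S μ) hμ.1.refl) := by
  intro _
  have hD := dModel_dmap (S := S) hμ.1
  obtain ⟨h1, h2, h3⟩ := hD.exists_maltsevOn_phi huv ht hμ hab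
  exact ⟨hμ, hab, hD, exists_maltsevOn huv ht hμ.1 hab, h1, h2, h3⟩

theorem MinBridge.conv (h : MinBridge S μ κ T) : MinBridge S κ μ (bConv T) :=
  ⟨fun o x hx => h.sub o (fun i => ((x i).2.2.1, (x i).2.2.2, (x i).1, (x i).2.1)) hx,
    fun b₁ b₂ a₁ a₂ H => (h.eqv a₁ a₂ b₁ b₂ H).symm, h.right, h.left, h.right_le, h.left_le⟩

/-- Interchange of the two coordinates on both sides. -/
def bSwap (T : Set (A × A × B × B)) : Set (A × A × B × B) :=
  {p | (p.2.1, p.1, p.2.2.2, p.2.2.1) ∈ T}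

theorem pr12_bSwap (T : Set (A × A × B × B)) : pr12 (bSwap T) = rinv (pr12 T) := by
  ext
  exact exists_comm

theorem pr34_bSwap (T : Set (A × A × B × B)) : pr34 (bSwap T) = rinv (pr34 T) := by
  ext
  exact exists_comm

theorem MinBridge.swap (h : MinBridge S μ κ T) (hμ : IsCongruence S μ) (hκ : IsCongruence S κ) :
    MinBridge S μ κ (bSwap T) := by
  refine ⟨fun o x hx => h.sub o (fun i => ((x i).2.1, (x i).1, (x i).2.2.2, (x i).2.2.1)) hx,
    fun a₁ a₂ b₁ b₂ H => ?_, ?_, ?_, ?_, ?_⟩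
  · rw [eq_comm, h.eqv _ _ _ _ H, eq_comm]
  · rw [pr12_bSwap]; exact h.left.inv
  · rw [pr34_bSwap]; exact h.right.inv
  · rw [pr12_bSwap]; exact fun x hx => hμ.symm (h.left_le hx)
  · rw [pr34_bSwap]; exact fun x hx => hκ.symm (h.right_le hx)

theorem MinBridge.exists_right (h : MinBridge S μ κ T) (a : A) : ∃ b, (a, a, b, b) ∈ T := by
  obtain ⟨b₁, b₂, H⟩ := h.left.refl a
  obtain rfl := (h.eqv _ _ _ _ H).1 rfl
  exact ⟨_, H⟩

theorem MinBridge.exists_left (h : MinBridge S μ κ T) (b : B) : ∃ a, (a, a, b, b) ∈ T :=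
  h.conv.exists_right b

theorem MinSub.eq_of_abelian {τ : Set (A × A)} (hτ : MinSub S τ) (hτμ : τ ⊆ μ)
    (hμ : IsMonolith S μ) {d : STerm S 3} (hd : MaltsevOn d μ) : τ = μ := by
  refine hτμ.antisymm (hμ.2.2 τ ⟨hτ.sub, hτ.refl, fun {a b} h => ?_, fun {a b c} h h' => ?_⟩
    hτ.ssub.ne')
  · have := hτ.sub.tri_mem d (hτ.refl a) h (hτ.refl b)
    rw [STerm.tri_prod] at this
    simpa only [(hd _ _ (hτμ h)).1, (hd _ _ (hτμ h)).2] using this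
  · have := hτ.sub.tri_mem d h (hτ.refl b) h'
    rw [STerm.tri_prod] at this
    simpa only [(hd _ _ (hτμ h)).1, (hd _ _ (hτμ h')).2] using this

theorem MinBridge.pr12_eq (h : MinBridge S μ κ T) (hz : AbModel S μ z) : pr12 T = μ := by
  obtain ⟨d, hd⟩ := hz.maltsev
  exact h.left.eq_of_abelian h.left_le hz.mono hd

theorem MinBridge.pr34_eq (h : MinBridge S μ κ T) (hz : AbModel S κ z') : pr34 T = κ :=
  h.conv.pr12_eq hz

/-- A rectangularity property of relations between pairs. -/
theorem eq_of_rectangle {U : Set (A × A × B × B)} (hU : IsSubuniverse S U)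
    (he : ∀ a₁ a₂ b₁ b₂, (a₁, a₂, b₁, b₂) ∈ U → (a₁ = a₂ ↔ b₁ = b₂))
    (htr : ∀ b, ∃ a, (a, a, b, b) ∈ U) (hκ : IsCongruence S κ)
    (hUκ : ∀ a₁ a₂ b₁ b₂, (a₁, a₂, b₁, b₂) ∈ U → (b₁, b₂) ∈ κ) {d : STerm S 3}
    (hd : MaltsevOn d κ) {r s : A} {p p' q : B} (h : (r, s, p, q) ∈ U) (h' : (r, s, p', q) ∈ U) :
    p = p' := by
  obtain ⟨w, hw⟩ := htr p'
  have h1 := hU.tri_mem d h h' hw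
  have h2 := hU.tri_mem d h' h' hw
  simp only [STerm.tri_prod] at h1 h2
  have hq := hUκ _ _ _ _ h'
  have hp := hUκ _ _ _ _ h
  have hpp := hκ.trans hp (hκ.symm hq)
  rw [(hd _ _ hpp).1, (hd _ _ (hκ.symm hq)).2] at h1
  rw [(hd _ _ (hκ.refl p')).1, (hd _ _ (hκ.symm hq)).2] at h2
  exact (he _ _ _ _ h1).1 ((he _ _ _ _ h2).2 rfl)

theorem twin_quad {U : Set (A × A × A × A)} (hU : IsSubuniverse S U)
    (hr : ∀ u v, (u, v) ∈ μ → (u, v, u, v) ∈ U) {g h : A → A} (H : Twin S μ g h) {a₁ a₂ c₁ c₂ : A}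
    (hm : (a₁, a₂, c₁, c₂) ∈ U) : (g a₁, h a₂, g c₁, h c₂) ∈ U := by
  induction H with
  | id => exact hm
  | const hc => exact hr _ _ hc
  | op o g h _ ih => exact hU o _ ih

theorem AbModel.mem_zrel_of_quad (hz : AbModel S μ z) {U : Set (A × A × A × A)}
    (hU : IsSubuniverse S U)
    (he : ∀ a₁ a₂ b₁ b₂, (a₁, a₂, b₁, b₂) ∈ U → (a₁ = a₂ ↔ b₁ = b₂))
    (hr : ∀ u v, (u, v) ∈ μ → (u, v, u, v) ∈ U)
    (hU1 : ∀ a₁ a₂ b₁ b₂, (a₁, a₂, b₁, b₂) ∈ U → (a₁, a₂) ∈ μ)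
    (hU2 : ∀ a₁ a₂ b₁ b₂, (a₁, a₂, b₁, b₂) ∈ U → (b₁, b₂) ∈ μ) {a₁ a₂ c₁ c₂ : A}
    (h : (a₁, a₂, c₁, c₂) ∈ U) : (a₁, c₁) ∈ Zrel S μ := by
  obtain ⟨d, hd⟩ := hz.maltsev
  have hμ := hz.mono.1
  intro g k H
  have h1 := twin_quad hU hr H h
  have h2 := twin_quad hU hr (H.right hμ.refl) h
  constructor
  · intro e
    simp only [e] at h1
    exact eq_of_rectangle hU he (fun b => ⟨b, hr b b (hμ.refl b)⟩) hμ hU2 hd h1 h2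
  · intro e
    simp only [e] at h1
    exact eq_of_rectangle (U := bConv U)
      (fun o x hx => hU o (fun i => ((x i).2.2.1, (x i).2.2.2, (x i).1, (x i).2.1)) hx)
      (fun b₁ b₂ a₁ a₂ H => (he a₁ a₂ b₁ b₂ H).symm) (fun b => ⟨b, hr b b (hμ.refl b)⟩) hμ
      (fun b₁ b₂ a₁ a₂ H => hU1 a₁ a₂ b₁ b₂ H) hd h1 h2

theorem AbModel.eq_of_quad (hz : AbModel S μ z) {U : Set (A × A × A × A)}
    (hU : IsSubuniverse S U)
    (he : ∀ a₁ a₂ b₁ b₂, (a₁, a₂, b₁, b₂) ∈ U → (a₁ = a₂ ↔ b₁ = b₂))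
    (hr : ∀ u v, (u, v) ∈ μ → (u, v, u, v) ∈ U)
    (hU1 : ∀ a₁ a₂ b₁ b₂, (a₁, a₂, b₁, b₂) ∈ U → (a₁, a₂) ∈ μ)
    (hU2 : ∀ a₁ a₂ b₁ b₂, (a₁, a₂, b₁, b₂) ∈ U → (b₁, b₂) ∈ μ) {a₁ a₂ c₁ c₂ : A}
    (h : (a₁, a₂, c₁, c₂) ∈ U) : z a₁ a₂ = z c₁ c₂ := by
  have hμ := hz.mono.1
  have hZ := zrel_isCongruence (S := S) hμ.refl
  have hφ := hz.mono_phi.1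
  have ha := hU1 _ _ _ _ h
  have hc := hU2 _ _ _ _ h
  have hac := hZ.trans (hZ.symm (hz.ab ha))
    (hZ.trans (hz.mem_zrel_of_quad hU he hr hU1 hU2 h) (hz.ab hc))
  obtain ⟨d, hd⟩ := hz.maltsev_phi
  have hxy := (hz.model.phi_iff hμ ha hc).2 hac
  have hy0 := (hz.model.phi_iff hμ hc (hμ.refl c₂)).2 (hZ.refl c₂)
  have h1 := hU.tri_mem d h (hr _ _ hc) (hr _ _ (hμ.refl c₂))
  simp only [STerm.tri_prod] at h1
  have e1 := hz.model.tri hμ d ha hc (hμ.refl c₂)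
  have e2 := hz.model.tri hμ d hc hc (hμ.refl c₂)
  rw [(hd _ _ hy0).2] at e2
  have e3 := (he _ _ _ _ h1).2 ((hz.model.eqv _ _ _ _ (hU2 _ _ _ _ h1) (hμ.refl c₂) e2).2 rfl)
  rw [← e3] at e1
  have h2 := hφ.1.tri_mem d hxy (hφ.refl (z c₁ c₂)) (hφ.refl (z c₂ c₂))
  rw [STerm.tri_prod] at h2
  simp only [← e1, (hd _ _ hy0).2] at h2
  have e4 := hz.model.diagEq _ _ ((hz.model.phi_iff hμ (hμ.refl _) (hμ.refl _)).1 h2)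
  rw [e4] at e1
  have key := (hz.ab_phi (hφ.symm hy0) (fun w => d.tri (z a₁ a₂) (z c₁ c₂) w)
    (fun w => d.tri (z c₁ c₂) (z c₁ c₂) w) ?_).1 (by rw [← e1, (hd _ _ hy0).2])
  · rwa [(hd _ _ hxy).1, (hd _ _ (hφ.refl _)).1] at key
  · have := Twin.eval (S := S) d (θ := DModel.phi S μ z)
      (g := ![fun _ => z a₁ a₂, fun _ => z c₁ c₂, fun w => w])
      (h := ![fun _ => z c₁ c₂, fun _ => z c₁ c₂, fun w => w]) fun i => by
        fin_cases i
        exacts [.const hxy, .const (hφ.refl _), .id]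
    refine this.congr (fun w => ?_) fun w => ?_ <;>
    · unfold STerm.tri
      congr 1
      funext i; fin_cases i <;> rfl

theorem MinBridge.eq_of_eq (h : MinBridge S μ κ T) (hz : AbModel S μ z) (hz' : AbModel S κ z')
    {a₁ a₂ c₁ c₂ : A} {b₁ b₂ d₁ d₂ : B} (h1 : (a₁, a₂, b₁, b₂) ∈ T) (h2 : (c₁, c₂, d₁, d₂) ∈ T)
    (he : z' b₁ b₂ = z' d₁ d₂) : z a₁ a₂ = z c₁ c₂ := by
  have hκ : ∀ {a₁ a₂ b₁ b₂}, (a₁, a₂, b₁, b₂) ∈ T → (b₁, b₂) ∈ κ :=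
    fun H => h.right_le ⟨_, _, H⟩
  refine hz.eq_of_quad (U := {p | ∃ b₁ b₂ d₁ d₂, (p.1, p.2.1, b₁, b₂) ∈ T ∧
    (p.2.2.1, p.2.2.2, d₁, d₂) ∈ T ∧ z' b₁ b₂ = z' d₁ d₂}) ?_ ?_ ?_ ?_ ?_
    ⟨_, _, _, _, h1, h2, he⟩
  · intro o x hx
    choose b₁ b₂ d₁ d₂ hb hd he using hx
    refine ⟨_, _, _, _, h.sub o _ hb, h.sub o _ hd, ?_⟩
    refine (hz'.model.hom o _ _ fun i => hκ (hb i)).trans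
      (Eq.trans ?_ (hz'.model.hom o _ _ fun i => hκ (hd i)).symm)
    simp only [he]
  · rintro a₁ a₂ c₁ c₂ ⟨b₁, b₂, d₁, d₂, hb, hd, he⟩
    rw [h.eqv _ _ _ _ hb, h.eqv _ _ _ _ hd]
    exact hz'.model.eqv _ _ _ _ (hκ hb) (hκ hd) he
  · intro u v huv
    rw [← h.pr12_eq hz] at huv
    obtain ⟨b₁, b₂, H⟩ := huv
    exact ⟨_, _, _, _, H, H, rfl⟩
  · rintro a₁ a₂ c₁ c₂ ⟨b₁, b₂, d₁, d₂, hb, hd, he⟩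
    exact h.left_le ⟨_, _, hb⟩
  · rintro a₁ a₂ c₁ c₂ ⟨b₁, b₂, d₁, d₂, hb, hd, he⟩
    exact h.left_le ⟨_, _, hd⟩

theorem MinBridge.exists_iso_of_abelian (h : MinBridge S μ κ T) (hz : AbModel S μ z)
    (hz' : AbModel S κ z') : ∃ f : D ≃ E, IsHom S f := by
  refine exists_iso_of_graph (W := {p | ∃ a₁ a₂ b₁ b₂, (a₁, a₂, b₁, b₂) ∈ T ∧
    p = (z a₁ a₂, z' b₁ b₂)}) ?_ ?_ ?_ ?_
  · intro o x hx
    choose a₁ a₂ b₁ b₂ hT he using hx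
    refine ⟨_, _, _, _, h.sub o _ hT, ?_⟩
    rw [funext he]
    exact Prod.ext (hz.model.hom o _ _ fun i => h.left_le ⟨_, _, hT i⟩).symm
      (hz'.model.hom o _ _ fun i => h.right_le ⟨_, _, hT i⟩).symm
  · intro x
    obtain ⟨a, b, hab, rfl⟩ := hz.model.surj x
    rw [← h.pr12_eq hz] at hab
    obtain ⟨b₁, b₂, H⟩ := hab
    exact ⟨_, _, _, _, _, H, rfl⟩
  · intro x
    obtain ⟨a, b, hab, rfl⟩ := hz'.model.surj x
    rw [← h.pr34_eq hz'] at hab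
    obtain ⟨b₁, b₂, H⟩ := hab
    exact ⟨_, _, _, _, _, H, rfl⟩
  · rintro _ _ _ _ ⟨a₁, a₂, b₁, b₂, hT, he⟩ ⟨c₁, c₂, d₁, d₂, hT', he'⟩
    obtain ⟨rfl, rfl⟩ := Prod.mk.inj he
    obtain ⟨rfl, rfl⟩ := Prod.mk.inj he'
    exact ⟨h.conv.eq_of_eq hz' hz hT hT', h.eq_of_eq hz hz' hT hT'⟩

end Bridges

/-! ### Bridges involving a nonabelian monolith -/

section Nonabelian
variable {A B D : Type} [SAlg S A] [SAlg S B] {μ : Set (A × A)} {κ : Set (B × B)}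
  {T : Set (A × A × B × B)} {z : A → A → D}

theorem Twin.lift (hT : IsSubuniverse S T) {g h : A → A} (H : Twin S (pr12 T) g h) :
    ∃ g' h', Twin S (pr34 T) g' h' ∧
      ∀ x y x' y', (x, y, x', y') ∈ T → (g x, h y, g' x', h' y') ∈ T := by
  induction H with
  | id => exact ⟨_, _, .id, fun _ _ _ _ h => h⟩
  | const hc =>
    obtain ⟨b₁, b₂, hb⟩ := hc
    exact ⟨_, _, .const ⟨_, _, hb⟩, fun _ _ _ _ _ => hb⟩
  | op o g h _ ih =>
    choose g' h' H1 H2 using ih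
    exact ⟨_, _, .op o _ _ H1, fun x y x' y' h => hT o _ fun i => H2 i _ _ _ _ h⟩

theorem MinBridge.mem_zrel (h : MinBridge S μ κ T) {a a' : A} {b b' : B} (hb : (a, a, b, b) ∈ T)
    (hb' : (a', a', b', b') ∈ T) (hbb : (b, b') ∈ Zrel S (pr34 T)) : (a, a') ∈ Zrel S (pr12 T) := by
  intro g k H
  obtain ⟨g', k', H', hl⟩ := H.lift h.sub
  rw [h.eqv _ _ _ _ (hl _ _ _ _ hb), h.eqv _ _ _ _ (hl _ _ _ _ hb')]
  exact hbb _ _ H'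

theorem IsMeet.zrel_eq {τ : Set (A × A)} {p : A → A → A} {o i : A} (hp : IsMeet S τ p o i)
    (hτ : MinSub S τ) (hτμ : τ ⊆ μ) (hμ : IsMonolith S μ) : Zrel S τ = diag A := by
  by_contra hne
  have hZ := zrel_isCongruence (S := S) hτ.refl
  have hoi : (o, i) ∈ Zrel S τ := by
    refine hμ.2.2 _ hZ hne ?_
    rcases hp.mem with h | h
    exacts [hτμ h, hμ.1.symm (hτμ h)]
  rcases hp.mem with h | h
  · have := (hoi _ _ (hp.pol.twin hτ.refl (.const h) .id)).1 (by rw [hp.zero_zero, hp.one_zero])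
    rw [hp.zero_one, hp.one_one] at this
    exact hp.ne this
  · have := (hoi _ _ (hp.pol.twin hτ.refl (.const h) .id)).1 (by rw [hp.zero_zero, hp.one_zero])
    rw [hp.zero_one, hp.one_one] at this
    exact hp.ne this.symm

theorem MinSub.exists_isMeet [Finite A] {τ : Set (A × A)} (hτ : MinSub S τ) (hτμ : τ ⊆ μ)
    (hμ : IsMonolith S μ) (hna : ¬ μ ⊆ Zrel S μ) :
    (∃ p o i, IsMeet S τ p o i) ∧ Zrel S τ = diag A := by
  have : ∃ p o i, IsMeet S τ p o i := by
    by_contra hno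
    exact hna (hμ.subset_zrel hτ hτμ hno)
  obtain ⟨p, o, i, hp⟩ := this
  exact ⟨⟨p, o, i, hp⟩, hp.zrel_eq hτ hτμ hμ⟩

theorem MinBridge.exists_iso_of_nonabelian [Finite A] [Finite B] (h : MinBridge S μ κ T)
    (hμ : IsMonolith S μ) (hκ : IsMonolith S κ) (hna : ¬ μ ⊆ Zrel S μ) (hnb : ¬ κ ⊆ Zrel S κ) :
    ∃ f : A ≃ B, IsHom S f := by
  have hA := (h.left.exists_isMeet h.left_le hμ hna).2
  have hB := (h.right.exists_isMeet h.right_le hκ hnb).2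
  refine exists_iso_of_graph (W := btr T)
    (fun o x hx => h.sub o (fun i => ((x i).1, (x i).1, (x i).2, (x i).2)) hx)
    h.exists_right h.exists_left fun a b a' b' h1 h2 => ⟨?_, ?_⟩
  · rintro rfl
    have := h.conv.mem_zrel (a := b) (a' := b') h1 h2 (fun _ _ _ => Iff.rfl)
    rw [show pr12 (bConv T) = pr34 T from rfl, hB] at this
    exact this
  · rintro rfl
    have := h.mem_zrel h1 h2 (fun _ _ _ => Iff.rfl)
    rw [hA] at this
    exact this

/-- The relation between pairs of `B` and elements of `D` induced by a bridge. -/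
def BridgeVal (T : Set (A × A × B × B)) (z : A → A → D) (b₁ b₂ : B) (x : D) : Prop :=
  ∃ a₁ a₂, (a₁, a₂, b₁, b₂) ∈ T ∧ z a₁ a₂ = x

theorem BridgeVal.exists_loop (h : MinBridge S μ κ T) (b : B) : ∃ x, BridgeVal T z b b x := by
  obtain ⟨a, ha⟩ := h.exists_left b
  exact ⟨_, _, _, ha, rfl⟩

variable [SAlg S D]

theorem BridgeVal.unique (h : MinBridge S μ κ T) (hz : AbModel S μ z) {b₁ b₂ : B} {x y : D}
    (hx : BridgeVal T z b₁ b₂ x) (hy : BridgeVal T z b₁ b₂ y) : x = y := by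
  obtain ⟨a₁, a₂, h1, rfl⟩ := hx
  obtain ⟨c₁, c₂, h2, rfl⟩ := hy
  refine hz.eq_of_quad (U := {p | ∃ b₁ b₂, (p.1, p.2.1, b₁, b₂) ∈ T ∧
    (p.2.2.1, p.2.2.2, b₁, b₂) ∈ T}) ?_ ?_ ?_ ?_ ?_ ⟨_, _, h1, h2⟩
  · intro o x hx
    choose b₁ b₂ H1 H2 using hx
    exact ⟨_, _, h.sub o _ H1, h.sub o _ H2⟩
  · rintro _ _ _ _ ⟨b₁, b₂, H1, H2⟩
    exact (h.eqv _ _ _ _ H1).trans (h.eqv _ _ _ _ H2).symm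
  · intro u v huv
    rw [← h.pr12_eq hz] at huv
    obtain ⟨b₁, b₂, H⟩ := huv
    exact ⟨_, _, H, H⟩
  · rintro _ _ _ _ ⟨b₁, b₂, H1, -⟩
    exact h.left_le ⟨_, _, H1⟩
  · rintro _ _ _ _ ⟨b₁, b₂, -, H2⟩
    exact h.left_le ⟨_, _, H2⟩

theorem BridgeVal.eq_of_loop (h : MinBridge S μ κ T) (hz : AbModel S μ z) {b₁ b₂ c : B} {x : D}
    (hx : BridgeVal T z b₁ b₂ x) (hc : BridgeVal T z c c x) : b₁ = b₂ := by
  obtain ⟨a₁, a₂, h1, rfl⟩ := hx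
  obtain ⟨c₁, c₂, h2, he⟩ := hc
  exact (h.eqv _ _ _ _ h1).1 ((hz.model.eqv _ _ _ _ (h.left_le ⟨_, _, h2⟩)
    (h.left_le ⟨_, _, h1⟩) he).1 ((h.eqv _ _ _ _ h2).2 rfl))

theorem BridgeVal.eq_of_phi (h : MinBridge S μ κ T) (hz : AbModel S μ z)
    (hB : Zrel S (pr34 T) = diag B) {c d : B} {x y : D} (hx : BridgeVal T z c c x)
    (hy : BridgeVal T z d d y) (hxy : (x, y) ∈ DModel.phi S μ z) : c = d := by
  obtain ⟨a, a', h1, rfl⟩ := hx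
  obtain ⟨e, e', h2, rfl⟩ := hy
  obtain rfl := (h.eqv _ _ _ _ h1).2 rfl
  obtain rfl := (h.eqv _ _ _ _ h2).2 rfl
  rw [hz.model.phi_iff hz.mono.1 (hz.mono.1.refl _) (hz.mono.1.refl _)] at hxy
  have : (c, d) ∈ Zrel S (pr34 T) :=
    h.conv.mem_zrel (a := c) (a' := d) h1 h2 (Zrel.mono h.left_le hxy)
  rw [hB] at this
  exact this

theorem BridgeVal.exists_pol (h : MinBridge S μ κ T) (hz : AbModel S μ z) {p : B → B → B}
    (hp : Pol2 S p) : ∃ P : D → D → D, Pol2 S P ∧ ∀ b₁ b₂ c₁ c₂ x y, BridgeVal T z b₁ b₂ x →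
      BridgeVal T z c₁ c₂ y → BridgeVal T z (p b₁ c₁) (p b₂ c₂) (P x y) := by
  suffices H : ∀ f : B × B → B, Pol S {Prod.fst, Prod.snd} f →
      ∃ F : D × D → D, Pol S {Prod.fst, Prod.snd} F ∧ ∀ b₁ b₂ c₁ c₂ x y, BridgeVal T z b₁ b₂ x →
        BridgeVal T z c₁ c₂ y → BridgeVal T z (f (b₁, c₁)) (f (b₂, c₂)) (F (x, y)) by
    obtain ⟨F, h1, h2⟩ := H _ hp
    exact ⟨fun x y => F (x, y), h1, h2⟩
  intro f hf
  induction hf with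
  | gen hg =>
    rcases hg with rfl | rfl
    · exact ⟨_, .gen (Or.inl rfl), fun _ _ _ _ _ _ h1 _ => h1⟩
    · exact ⟨_, .gen (Or.inr rfl), fun _ _ _ _ _ _ _ h2 => h2⟩
  | const c =>
    obtain ⟨x, hx⟩ := BridgeVal.exists_loop (z := z) h c
    exact ⟨_, .const x, fun _ _ _ _ _ _ _ _ => hx⟩
  | op o f _ ih =>
    choose F h1 h2 using ih
    refine ⟨_, .op o F h1, fun b₁ b₂ c₁ c₂ x y hx hy => ?_⟩
    choose a₁ a₂ h3 h4 using fun i => h2 i b₁ b₂ c₁ c₂ x y hx hy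
    refine ⟨_, _, h.sub o _ h3, ?_⟩
    rw [hz.model.hom o _ _ fun i => h.left_le ⟨_, _, h3 i⟩]
    exact congrArg _ (funext h4)

theorem BridgeVal.not_phi_one (h : MinBridge S μ κ T) (hz : AbModel S μ z) {p : B → B → B}
    {o i : B} (hp : IsMeet S (pr34 T) p o i) {x y : D} (hx : BridgeVal T z o i x)
    (hy : BridgeVal T z i i y) : (x, y) ∉ DModel.phi S μ z := by
  intro hxy
  obtain ⟨P, hP, hv⟩ := BridgeVal.exists_pol h hz hp.pol
  have h1 : P x x = x := BridgeVal.unique h hz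
    (by simpa only [hp.zero_zero, hp.one_one] using hv _ _ _ _ _ _ hx hx) hx
  have h2 : P x y = x := BridgeVal.unique h hz
    (by simpa only [hp.zero_one, hp.one_one] using hv _ _ _ _ _ _ hx hy) hx
  have h3 : P y x = x := BridgeVal.unique h hz
    (by simpa only [hp.one_zero, hp.one_one] using hv _ _ _ _ _ _ hy hx) hx
  have h4 : P y y = y := BridgeVal.unique h hz
    (by simpa only [hp.one_one] using hv _ _ _ _ _ _ hy hy) hy
  have := (hz.ab_phi hxy _ _ (hP.twin hz.mono_phi.1.refl .id (.const hxy))).1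
    (by rw [h1, h2])
  simp only [h3, h4] at this
  subst this
  exact hp.ne (BridgeVal.eq_of_loop h hz hx hy)

theorem BridgeVal.not_phi_zero (h : MinBridge S μ κ T) (hz : AbModel S μ z) {p : B → B → B}
    {o i : B} (hp : IsMeet S (pr34 T) p o i) {x y : D} (hx : BridgeVal T z o i x)
    (hy : BridgeVal T z o o y) : (x, y) ∉ DModel.phi S μ z := by
  intro hxy
  obtain ⟨P, hP, hv⟩ := BridgeVal.exists_pol h hz hp.pol
  have h1 : P x x = x := BridgeVal.unique h hz
    (by simpa only [hp.zero_zero, hp.one_one] using hv _ _ _ _ _ _ hx hx) hx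
  have h2 : P x y = y := BridgeVal.unique h hz
    (by simpa only [hp.zero_zero, hp.one_zero] using hv _ _ _ _ _ _ hx hy) hy
  have h3 : P y x = y := BridgeVal.unique h hz
    (by simpa only [hp.zero_zero, hp.zero_one] using hv _ _ _ _ _ _ hy hx) hy
  have h4 : P y y = y := BridgeVal.unique h hz
    (by simpa only [hp.zero_zero] using hv _ _ _ _ _ _ hy hy) hy
  have := (hz.ab_phi hxy _ _ (hP.twin hz.mono_phi.1.refl .id (.const hxy))).2
    (by rw [h3, h4])
  simp only [h1, h2] at this
  subst this
  exact hp.ne (BridgeVal.eq_of_loop h hz hx hy)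

theorem MinBridge.not_isMeet (h : MinBridge S μ κ T) (hz : AbModel S μ z)
    (hB : Zrel S (pr34 T) = diag B) {p : B → B → B} {o i : B} (hp : IsMeet S (pr34 T) p o i) :
    (o, i) ∉ pr34 T := by
  rintro ⟨a₁, a₂, haT⟩
  have ha : (a₁, a₂) ∈ μ := h.left_le ⟨_, _, haT⟩
  obtain ⟨x, hax⟩ : ∃ x, z a₁ a₂ = x := ⟨_, rfl⟩
  have hx : BridgeVal T z o i x := ⟨_, _, haT, hax⟩
  obtain ⟨e, he⟩ := h.exists_right a₂
  obtain ⟨y, hey⟩ : ∃ y, z a₂ a₂ = y := ⟨_, rfl⟩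
  have hy : BridgeVal T z e e y := ⟨_, _, he, hey⟩
  have hφ := hz.mono_phi.1
  have hxy : (x, y) ∈ DModel.phi S μ z := by
    rw [← hax, ← hey, hz.model.phi_iff hz.mono.1 ha (hz.mono.1.refl _)]
    exact (zrel_isCongruence hz.mono.1.refl).refl _
  obtain ⟨u, hu⟩ := BridgeVal.exists_loop (z := z) h o
  obtain ⟨v, hv⟩ := BridgeVal.exists_loop (z := z) h i
  obtain ⟨P, hP, hval⟩ := BridgeVal.exists_pol h hz hp.pol
  have hne : o ≠ e := by
    rintro rfl
    exact BridgeVal.not_phi_zero h hz hp hx hy hxy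
  have hyx := hφ.symm hxy
  have hrel : ∀ {a b c d}, (a, b) ∈ DModel.phi S μ z → (c, d) ∈ DModel.phi S μ z →
      (P a c, P b d) ∈ DModel.phi S μ z := fun h1 h2 => hP.rel hφ.1 hφ.refl h1 h2
  have x1 : P u x = u := BridgeVal.unique h hz
    (by simpa only [hp.zero_zero, hp.zero_one] using hval _ _ _ _ _ _ hu hx) hu
  have x2 : P x u = u := BridgeVal.unique h hz
    (by simpa only [hp.zero_zero, hp.one_zero] using hval _ _ _ _ _ _ hx hu) hu
  have x3 : P x x = x := BridgeVal.unique h hz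
    (by simpa only [hp.zero_zero, hp.one_one] using hval _ _ _ _ _ _ hx hx) hx
  have x4 : P v x = x := BridgeVal.unique h hz
    (by simpa only [hp.one_zero, hp.one_one] using hval _ _ _ _ _ _ hv hx) hx
  have e1 : p o e = o := BridgeVal.eq_of_phi h hz hB (hval _ _ _ _ _ _ hu hy) hu
    (by simpa only [x1] using hrel (hφ.refl u) hyx)
  have e2 : p e o = o := BridgeVal.eq_of_phi h hz hB (hval _ _ _ _ _ _ hy hu) hu
    (by simpa only [x2] using hrel hyx (hφ.refl u))
  have e3 : p e e = e := BridgeVal.eq_of_phi h hz hB (hval _ _ _ _ _ _ hy hy) hy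
    (hφ.trans (by simpa only [x3] using hrel hyx hyx) hxy)
  have e4 : p i e = e := BridgeVal.eq_of_phi h hz hB (hval _ _ _ _ _ _ hv hy) hy
    (hφ.trans (by simpa only [x4] using hrel (hφ.refl v) hyx) hxy)
  have hx' : BridgeVal T z o e (P x y) := by
    simpa only [e1, e4] using hval _ _ _ _ _ _ hx hy
  have hoe : (o, e) ∈ pr34 T := by
    obtain ⟨c₁, c₂, hc, -⟩ := hx'
    exact ⟨_, _, hc⟩
  exact BridgeVal.not_phi_one h hz ⟨hp.pol, hne, Or.inl hoe, hp.zero_zero, e1, e2, e3⟩ hx' hy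
    (hφ.trans (by simpa only [x3] using hrel (hφ.refl x) hyx) hxy)

theorem MinBridge.abelian_right [Finite B] (h : MinBridge S μ κ T) (hz : AbModel S μ z)
    (hκ : IsMonolith S κ) : κ ⊆ Zrel S κ := by
  by_contra hnb
  obtain ⟨⟨p, o, i, hp⟩, hB⟩ := h.right.exists_isMeet h.right_le hκ hnb
  rcases hp.mem with H | H
  · exact h.not_isMeet hz hB hp H
  · have h' := h.swap hz.mono.1 hκ.1
    have hp' := hp.inv
    rw [← pr34_bSwap] at hp'
    refine h'.not_isMeet hz (hp'.zrel_eq h'.right h'.right_le hκ) hp' ?_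
    rw [pr34_bSwap]
    exact H

end Nonabelian

/-! ### Similarity from good bridges -/

section Similarity
variable {A B : Type} [SAlg S A] [SAlg S B]

theorem QMap.exists_minSub {Q : Type} [SAlg S Q] {ρ τ : Set (A × A)} {π : A → Q}
    (h : QMap S ρ π) (hρ : IsCongruence S ρ) (hτ : τ ∈ Cov S ρ) :
    ∃ L : Set (Q × Q), MinSub S L ∧ ∀ a b, (π a, π b) ∈ L ↔ (a, b) ∈ τ := by
  obtain ⟨h1, h2, h3, h4⟩ := hτ
  have hmem : ∀ a b, (∃ a' b', (a', b') ∈ τ ∧ (π a, π b) = (π a', π b')) ↔ (a, b) ∈ τ := by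
    refine fun a b => ⟨?_, fun H => ⟨_, _, H, rfl⟩⟩
    rintro ⟨a', b', H, he⟩
    obtain ⟨e1, e2⟩ := Prod.mk.inj he
    exact mem_of_saturated h2 H ((h.ker _ _).1 e1) ((h.ker _ _).1 e2.symm)
  refine ⟨{p | ∃ a b, (a, b) ∈ τ ∧ p = (π a, π b)}, ⟨?_, ?_, ?_⟩, hmem⟩
  · intro o x hx
    choose a b hab he using hx
    refine ⟨_, _, h1 o _ hab, ?_⟩
    rw [funext he]
    exact Prod.ext (h.hom o _).symm (h.hom o _).symm
  · obtain ⟨⟨a, b⟩, hab, hab'⟩ := Set.exists_of_ssubset h3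
    refine Set.ssubset_iff_exists.2 ⟨?_, (π a, π b), ⟨_, _, hab, rfl⟩,
      fun he => hab' ((h.ker _ _).1 he)⟩
    rintro ⟨x, y⟩ (rfl : x = y)
    obtain ⟨a, rfl⟩ := h.surj x
    exact ⟨a, a, h3.1 (hρ.refl a), rfl⟩
  · intro L hL hdL hLτ
    have hLi : {p : A × A | (π p.1, π p.2) ∈ L} = τ := by
      refine h4 _ (fun o x hx => ?_) ?_ ?_ fun p hp => (hmem _ _).1 (hLτ hp)
      · change (π (SAlg.interp o fun i => (x i).1), π (SAlg.interp o fun i => (x i).2)) ∈ L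
        rw [h.hom o, h.hom o]
        exact hL o _ hx
      · ext ⟨a, b⟩
        constructor
        · rintro ⟨a', e1, b', H, e2⟩
          change (π a, π b) ∈ L
          rw [(h.ker _ _).2 e1, ← (h.ker _ _).2 e2]
          exact H
        · exact fun H => ⟨a, hρ.refl a, b, H, hρ.refl b⟩
      · obtain ⟨⟨x, y⟩, hxy, hxy'⟩ := Set.exists_of_ssubset hdL
        obtain ⟨a, rfl⟩ := h.surj x
        obtain ⟨b, rfl⟩ := h.surj y
        exact Set.ssubset_iff_exists.2 ⟨fun p hp => hdL.1 ((h.ker _ _).2 hp), (a, b), hxy,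
          fun he => hxy' ((h.ker _ _).2 he)⟩
    refine hLτ.antisymm ?_
    rintro _ ⟨a, b, hab, rfl⟩
    rw [← hLi] at hab
    exact hab

theorem GoodBridge.exists_minBridge {Q R : Type} [SAlg S Q] [SAlg S R] {ρ ρplus : Set (A × A)}
    {σ σplus : Set (B × B)} {T : Set (A × A × B × B)} {π : A → Q} {π' : B → R}
    (h : QMap S ρ π) (h' : QMap S σ π') (hρ : MeetIrredWith S ρ ρplus)
    (hσ : MeetIrredWith S σ σplus) (hT : GoodBridge S ρ ρplus σ σplus T) {μ : Set (Q × Q)}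
    {κ : Set (R × R)} (hμ : IsMonolith S μ) (hκ : IsMonolith S κ) :
    ∃ T' : Set (Q × Q × R × R), MinBridge S μ κ T' := by
  obtain ⟨-, τ, ⟨hτ, hτ'⟩, ω, ⟨hω, hω'⟩, T', -, ⟨hT', e1, e2⟩, -⟩ := hT
  obtain ⟨L, hL, hLm⟩ := h.exists_minSub hρ.1 hτ
  obtain ⟨M, hM, hMm⟩ := h'.exists_minSub hσ.1 hω
  obtain ⟨t1, -, -, -, -, t6⟩ := hT'
  let V : Set (Q × Q × R × R) := {p | ∃ a₁ a₂ b₁ b₂, (a₁, a₂, b₁, b₂) ∈ T' ∧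
    p = (π a₁, π a₂, π' b₁, π' b₂)}
  have hV1 : pr12 V = L := by
    ext ⟨x, y⟩
    constructor
    · rintro ⟨_, _, a₁, a₂, b₁, b₂, H, he⟩
      simp only [Prod.mk.injEq] at he
      rw [he.1, he.2.1, hLm, ← e1]
      exact ⟨_, _, H⟩
    · intro H
      obtain ⟨a, rfl⟩ := h.surj x
      obtain ⟨b, rfl⟩ := h.surj y
      rw [hLm, ← e1] at H
      obtain ⟨b₁, b₂, H⟩ := H
      exact ⟨_, _, _, _, _, _, H, rfl⟩
  have hV2 : pr34 V = M := by
    ext ⟨x, y⟩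
    constructor
    · rintro ⟨_, _, a₁, a₂, b₁, b₂, H, he⟩
      simp only [Prod.mk.injEq] at he
      rw [he.2.2.1, he.2.2.2, hMm, ← e2]
      exact ⟨_, _, H⟩
    · intro H
      obtain ⟨a, rfl⟩ := h'.surj x
      obtain ⟨b, rfl⟩ := h'.surj y
      rw [hMm, ← e2] at H
      obtain ⟨a₁, a₂, H⟩ := H
      exact ⟨_, _, _, _, _, _, H, rfl⟩
  refine ⟨V, fun o x hx => ?_, ?_, hV1 ▸ hL, hV2 ▸ hM, ?_, ?_⟩
  · choose a₁ a₂ b₁ b₂ H he using hx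
    refine ⟨_, _, _, _, t1 o _ H, ?_⟩
    rw [funext he]
    refine Prod.ext (h.hom o _).symm (Prod.ext (h.hom o _).symm (Prod.ext (h'.hom o _).symm
      (h'.hom o _).symm))
  · rintro _ _ _ _ ⟨a₁, a₂, b₁, b₂, H, he⟩
    simp only [Prod.mk.injEq] at he
    obtain ⟨rfl, rfl, rfl, rfl⟩ := he
    rw [h.ker, h'.ker]
    exact t6 _ _ _ _ H
  · rw [hV1]
    rintro ⟨x, y⟩ H
    obtain ⟨a, rfl⟩ := h.surj x
    obtain ⟨b, rfl⟩ := h.surj y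
    exact (h.mem_iff_of_monolith hρ hμ _ _).2 (hτ' ((hLm _ _).1 H))
  · rw [hV2]
    rintro ⟨x, y⟩ H
    obtain ⟨a, rfl⟩ := h'.surj x
    obtain ⟨b, rfl⟩ := h'.surj y
    exact (h'.mem_iff_of_monolith hσ hκ _ _).2 (hω' ((hMm _ _).1 H))

theorem MinBridge.similar [Finite A] [Finite B] {n : ℕ} {t : STerm S n}
    {u v : Fin n → Fin n → Fin 2} (huv : ∀ i, u i i ≠ v i i) (htA : TaylorOn S A t u v)
    (htB : TaylorOn S B t u v) {μ : Set (A × A)} {κ : Set (B × B)} {T : Set (A × A × B × B)}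
    (hμ : IsMonolith S μ) (hκ : IsMonolith S κ) (h : MinBridge S μ κ T) :
    SimilarI S (inferInstance : SAlg S A) (inferInstance : SAlg S B) := by
  refine ⟨μ, κ, hμ, hκ, ?_⟩
  have hsA := fun a b (h : (a, b) ∈ μ) => hμ.1.symm h
  have hsB := fun a b (h : (a, b) ∈ κ) => hκ.1.symm h
  rw [centralizes_iff hsA, centralizes_iff hsB,
    centralizer_eq (S := S) hμ.1.refl, centralizer_eq (S := S) hκ.1.refl]
  refine ⟨fun ⟨ha, hb⟩ => ?_, fun ⟨ha, hb⟩ => ?_, fun ⟨ha, hb⟩ => ?_, fun ⟨ha, hb⟩ => ?_⟩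
  · let _ := DAlg S A μ (Zrel S μ) hμ.1.1
    let _ := DAlg S B κ (Zrel S κ) hκ.1.1
    exact h.exists_iso_of_abelian (abModel_dmap huv htA hμ ha) (abModel_dmap huv htB hκ hb)
  · let _ := DAlg S A μ (Zrel S μ) hμ.1.1
    exact absurd (h.abelian_right (abModel_dmap huv htA hμ ha) hκ) hb
  · let _ := DAlg S B κ (Zrel S κ) hκ.1.1
    exact absurd (h.conv.abelian_right (abModel_dmap huv htB hκ hb) hμ) ha
  · exact h.exists_iso_of_nonabelian hμ hκ ha hb

end Similarity

theorem GoodBridge.similar {A B : Type} [iA : SAlg S A] [iB : SAlg S B] [Finite A] [Finite B]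
    (hTay : CommonTaylor S A B) {ρ ρplus : Set (A × A)} {σ σplus : Set (B × B)}
    (hρ : MeetIrredWith S ρ ρplus) (hσ : MeetIrredWith S σ σplus) {T : Set (A × A × B × B)}
    (hT : GoodBridge S ρ ρplus σ σplus T) : SimilarI S (quotAlg iA ρ) (quotAlg iB σ) := by
  obtain ⟨n, t, u, v, -, huv, htA, htB⟩ := hTay
  let _ := quotAlg iA ρ
  let _ := quotAlg iB σ
  have h := qMap_mk iA hρ.1
  have h' := qMap_mk iB hσ.1
  have := Finite.of_surjective _ h.surj
  have := Finite.of_surjective _ h'.surj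
  obtain ⟨μ, hμ⟩ := h.exists_monolith hρ
  obtain ⟨κ, hκ⟩ := h'.exists_monolith hσ
  obtain ⟨T', hT'⟩ := hT.exists_minBridge h h' hρ hσ hμ hκ
  exact hT'.similar huv (h.taylorOn htA) (h'.taylorOn htB) hμ hκ

end Zhuk

/-- equivalence of (1) existence of a good bridge from `(A,ρ)` to `(B,σ)`,
(2) existence of a bridge from `(A,ρ,ρ⁺)` to `(B,σ,σ⁺)` satisfying (B3), and
(3) similarity of `A/ρ` and `B/σ`. -/
theorem stmt_18 {S : Zhuk.Signature} {A B : Type} [iA : Zhuk.SAlg S A] [iB : Zhuk.SAlg S B]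
    [Finite A] [Finite B]
    (hTay : Zhuk.CommonTaylor S A B)
    (ρ ρplus : Set (A × A)) (σ σplus : Set (B × B))
    (hρ : Zhuk.MeetIrredWith S ρ ρplus) (hσ : Zhuk.MeetIrredWith S σ σplus) :
    ((∃ T : Set (A × A × B × B), Zhuk.GoodBridge S ρ ρplus σ σplus T) ↔
      (∃ T : Set (A × A × B × B), Zhuk.IsBridgeLR S ρ σ ρplus σplus T ∧
        ∀ a₁ a₂ b₁ b₂, (a₁, a₂, b₁, b₂) ∈ T →
          (a₁, b₁) ∈ Zhuk.btr T ∧ (a₂, b₂) ∈ Zhuk.btr T)) ∧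
    ((∃ T : Set (A × A × B × B), Zhuk.GoodBridge S ρ ρplus σ σplus T) ↔
      Zhuk.SimilarI S (Zhuk.quotAlg iA ρ) (Zhuk.quotAlg iB σ)) := by
  have h12 := fun T (hT : Zhuk.IsBridgeLR S ρ σ ρplus σplus T) =>
    hT.1.goodBridge hρ.1 hσ.1 hT.2.1.subset hT.2.2.subset
  have h31 := fun h => Zhuk.exists_bridge_of_similar_quot hTay hρ hσ h
  refine ⟨⟨fun ⟨_, hT⟩ => h31 (hT.similar hTay hρ hσ), fun ⟨T, hT, _⟩ => ⟨T, h12 T hT⟩⟩,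
    fun ⟨_, hT⟩ => hT.similar hTay hρ hσ, fun h => ?_⟩
  obtain ⟨T, hT, -⟩ := h31 h
  exact ⟨T, h12 T hT⟩
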